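/- Let X = ℝⁿ, n ≥ 2, with κ the α-Riesz kernel of order α ∈ (0, n) with α ≤ 2. Let A ⊆ ℝⁿ be such that E⁺(A) is closed in the strong metric d, cap_*(A) = ∞ and cap_*(A) > 0, and let f := −U^ζ where ζ ∈ E⁺ and ζ(ℝⁿ) ≤ 1. Assume that the closure Ā of A in ℝⁿ is inner α-thin at infinity, and that D := ℝⁿ∖Ā is connected in the case α = 2. If ζ(D) > 0, then no solution of the inner Gauss variational problem for (A, f) exists. -/

import Mathlib

open MeasureTheory Topology Filter Set ENNReal

noncomputable section

namespace GaussVar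

variable {X : Type*} [TopologicalSpace X] [MeasurableSpace X]

/-- A (positive) Radon measure: a regular Borel measure. -/
def IsRadon (μ : Measure X) : Prop := μ.Regular

/-- The mutual energy `I(μ,ν) = ∬ κ(x,y) d(μ⊗ν)(x,y)`. -/
def mutualEnergy (κ : X → X → ℝ≥0∞) (μ ν : Measure X) : ℝ≥0∞ :=
  ∫⁻ p : X × X, κ p.1 p.2 ∂(μ.prod ν)

/-- The energy `I(μ) := I(μ,μ)`. -/
def energy (κ : X → X → ℝ≥0∞) (μ : Measure X) : ℝ≥0∞ := mutualEnergy κ μ μ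

/-- Membership in the cone `E⁺` of Radon measures with finite energy. -/
def memEplus (κ : X → X → ℝ≥0∞) (μ : Measure X) : Prop :=
  IsRadon μ ∧ energy κ μ < ⊤

/-- A kernel: symmetric and lower semicontinuous with values in `[0,∞]`. -/
def IsKernel (κ : X → X → ℝ≥0∞) : Prop :=
  (∀ x y, κ x y = κ y x) ∧ LowerSemicontinuous (fun p : X × X => κ p.1 p.2)

/-- The strong (energy) metric `d(μ,ν) := (I(μ)+I(ν)−2I(μ,ν))^{1/2}` on `E⁺`. -/
def strongDist (κ : X → X → ℝ≥0∞) (μ ν : Measure X) : ℝ :=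
  Real.sqrt ((energy κ μ).toReal + (energy κ ν).toReal - 2 * (mutualEnergy κ μ ν).toReal)

/-- The energy principle (strict positive definiteness). -/
def EnergyPrinciple (κ : X → X → ℝ≥0∞) : Prop :=
  ∀ μ ν : Measure X, memEplus κ μ → memEplus κ ν →
    2 * mutualEnergy κ μ ν ≤ energy κ μ + energy κ ν ∧
      (2 * mutualEnergy κ μ ν = energy κ μ + energy κ ν → μ = ν)

/-- Convergence of a sequence in the strong metric. -/
def StrongTendstoSeq (κ : X → X → ℝ≥0∞) (μ : ℕ → Measure X) (μ₀ : Measure X) : Prop :=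
  Tendsto (fun n => strongDist κ (μ n) μ₀) atTop (𝓝 0)

/-- Vague convergence of a sequence of measures. -/
def VagueTendstoSeq (μ : ℕ → Measure X) (μ₀ : Measure X) : Prop :=
  ∀ φ : X → ℝ, Continuous φ → HasCompactSupport φ →
    Tendsto (fun n => ∫ x, φ x ∂(μ n)) atTop (𝓝 (∫ x, φ x ∂μ₀))

/-- Cauchy sequence in the strong metric. -/
def StrongCauchySeq (κ : X → X → ℝ≥0∞) (μ : ℕ → Measure X) : Prop :=
  ∀ ε : ℝ, 0 < ε → ∃ N : ℕ, ∀ m ≥ N, ∀ n ≥ N, strongDist κ (μ m) (μ n) < ε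

/-- A perfect kernel: satisfies the energy principle, `(E⁺,d)` is complete, and
strong convergence implies vague convergence. -/
def IsPerfect (κ : X → X → ℝ≥0∞) : Prop :=
  EnergyPrinciple κ ∧
    (∀ μ : ℕ → Measure X, (∀ n, memEplus κ (μ n)) → StrongCauchySeq κ μ →
        ∃ μ₀ : Measure X, memEplus κ μ₀ ∧ StrongTendstoSeq κ μ μ₀) ∧
    (∀ (μ : ℕ → Measure X) (μ₀ : Measure X), (∀ n, memEplus κ (μ n)) → memEplus κ μ₀ →
        StrongTendstoSeq κ μ μ₀ → VagueTendstoSeq μ μ₀)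

/-- `μ` is concentrated on `A`: the complement of `A` is locally `μ`-negligible. -/
def Concentrated (μ : Measure X) (A : Set X) : Prop :=
  ∀ K : Set X, IsCompact K → μ (Aᶜ ∩ K) = 0

/-- Membership in `Ĕ⁺(A)`: finite-energy Radon measures concentrated on `A`
of unit total mass. -/
def memBreve (κ : X → X → ℝ≥0∞) (A : Set X) (μ : Measure X) : Prop :=
  memEplus κ μ ∧ Concentrated μ A ∧ μ Set.univ = 1

/-- `w(A) := inf { I(μ) : μ ∈ Ĕ⁺(A) }` (with `inf ∅ = ⊤`). -/
def wcap (κ : X → X → ℝ≥0∞) (A : Set X) : ℝ≥0∞ :=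
  ⨅ (μ : Measure X) (_ : memBreve κ A μ), energy κ μ

/-- The inner capacity `cap_*(A) := 1 / w(A)`. -/
def innerCap (κ : X → X → ℝ≥0∞) (A : Set X) : ℝ≥0∞ := (wcap κ A)⁻¹

/-- The outer capacity `cap^*(E) := inf { cap_*(D) : D open, E ⊆ D }`. -/
def outerCap (κ : X → X → ℝ≥0∞) (E : Set X) : ℝ≥0∞ :=
  ⨅ (D : Set X) (_ : IsOpen D ∧ E ⊆ D), innerCap κ D

/-- `P` holds nearly everywhere (n.e.) on `A`: the exceptional subset of `A`
has inner capacity zero. -/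
def NearlyEverywhere (κ : X → X → ℝ≥0∞) (A : Set X) (P : X → Prop) : Prop :=
  innerCap κ {x ∈ A | ¬ P x} = 0

/-- The potential `U^μ(x) := ∫ κ(x,y) dμ(y)`. -/
def potential (κ : X → X → ℝ≥0∞) (μ : Measure X) (x : X) : ℝ≥0∞ :=
  ∫⁻ y, κ x y ∂μ

/-- An external field: `f = ψ + U^{ϑ⁺} − U^{ϑ⁻}` where `ψ` is lower semicontinuous,
`(−∞,∞]`-valued, positive if `X` is noncompact, and `ϑ⁺, ϑ⁻ ∈ E⁺`. -/
def IsExternalField (κ : X → X → ℝ≥0∞) (f : X → EReal) : Prop :=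
  ∃ (ψ : X → EReal) (ϑp ϑm : Measure X),
    LowerSemicontinuous ψ ∧ (∀ x, ψ x ≠ ⊥) ∧ (¬ CompactSpace X → ∀ x, 0 ≤ ψ x) ∧
    memEplus κ ϑp ∧ memEplus κ ϑm ∧
    ∀ x, f x = ψ x + (potential κ ϑp x : EReal) - (potential κ ϑm x : EReal)

/-- `f` is `μ`-integrable (as an extended-real-valued function). -/
def FieldIntegrable (f : X → EReal) (μ : Measure X) : Prop :=
  Integrable (fun x => (f x).toReal) μ ∧ (∀ᵐ x ∂μ, f x ≠ ⊤ ∧ f x ≠ ⊥)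

/-- `∫ f dμ` for an a.e.-finite integrable field. -/
def fieldIntegral (f : X → EReal) (μ : Measure X) : ℝ := ∫ x, (f x).toReal ∂μ

/-- The Gauss functional `I_f(μ) := I(μ) + 2 ∫ f dμ`. -/
def gaussI (κ : X → X → ℝ≥0∞) (f : X → EReal) (μ : Measure X) : ℝ :=
  (energy κ μ).toReal + 2 * fieldIntegral f μ

/-- Membership in `Ĕ⁺_f(A)`. -/
def Admissible (κ : X → X → ℝ≥0∞) (A : Set X) (f : X → EReal) (μ : Measure X) : Prop :=
  memBreve κ A μ ∧ FieldIntegrable f μ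

/-- `w_f(A) := inf { I_f(μ) : μ ∈ Ĕ⁺_f(A) }` (with `inf ∅ = ⊤`). -/
def wf (κ : X → X → ℝ≥0∞) (A : Set X) (f : X → EReal) : EReal :=
  ⨅ (μ : Measure X) (_ : Admissible κ A f μ), ((gaussI κ f μ : ℝ) : EReal)

/-- `l` is a solution of the inner Gauss variational problem for `(A,f)`. -/
def IsSolution (κ : X → X → ℝ≥0∞) (A : Set X) (f : X → EReal) (l : Measure X) : Prop :=
  Admissible κ A f l ∧ ((gaussI κ f l : ℝ) : EReal) = wf κ A f

/-- The `f`-weighted potential `U_f^μ := U^μ + f`. -/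
def wPotential (κ : X → X → ℝ≥0∞) (f : X → EReal) (μ : Measure X) (x : X) : EReal :=
  (potential κ μ x : EReal) + f x

/-- `∫ U_f^μ dμ`, the weighted equilibrium constant of a solution. -/
def wConst (κ : X → X → ℝ≥0∞) (f : X → EReal) (μ : Measure X) : ℝ :=
  ∫ x, (wPotential κ f μ x).toReal ∂μ

/-- The cone `E⁺(A)` is closed in the strong metric. -/
def StrongClosedEplusOn (κ : X → X → ℝ≥0∞) (A : Set X) : Prop :=
  ∀ (μ : ℕ → Measure X) (μ₀ : Measure X),
    (∀ n, memEplus κ (μ n) ∧ Concentrated (μ n) A) →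
    memEplus κ μ₀ → StrongTendstoSeq κ μ μ₀ → Concentrated μ₀ A

/-- Frostman's (first) maximum principle. -/
def FrostmanMax (κ : X → X → ℝ≥0∞) : Prop :=
  ∀ μ : Measure X, memEplus κ μ →
    (∀ x : X, (∀ U : Set X, IsOpen U → x ∈ U → 0 < μ U) → potential κ μ x ≤ 1) →
    ∀ x : X, potential κ μ x ≤ 1

/-- The domination (second maximum) principle. -/
def DominationPrinciple (κ : X → X → ℝ≥0∞) : Prop :=
  ∀ μ ν : Measure X, memEplus κ μ → memEplus κ ν →
    (∀ᵐ x ∂μ, potential κ μ x ≤ potential κ ν x) →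
    ∀ x : X, potential κ μ x ≤ potential κ ν x

/-- `β` is the inner balayage of `ζ` onto `A`: `β ∈ E⁺(A)` and `U^β = U^ζ` n.e. on `A`. -/
def IsInnerBalayage (κ : X → X → ℝ≥0∞) (A : Set X) (ζ β : Measure X) : Prop :=
  memEplus κ β ∧ Concentrated β A ∧
    NearlyEverywhere κ A (fun x => potential κ β x = potential κ ζ x)

/-- `γ` is the inner capacitary measure of `A`: `γ ∈ E⁺(A)` and `U^γ = 1` n.e. on `A`. -/
def IsCapacitaryMeasure (κ : X → X → ℝ≥0∞) (A : Set X) (γ : Measure X) : Prop :=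
  memEplus κ γ ∧ Concentrated γ A ∧
    NearlyEverywhere κ A (fun x => potential κ γ x = 1)

/-- `A` is quasiclosed: approximable in outer capacity by closed sets. -/
def Quasiclosed (κ : X → X → ℝ≥0∞) (A : Set X) : Prop :=
  ∀ ε : ℝ≥0∞, 0 < ε → ∃ F : Set X, IsClosed F ∧ outerCap κ (symmDiff A F) < ε

/-- `A` is quasicompact: approximable in outer capacity by compact sets. -/
def Quasicompact (κ : X → X → ℝ≥0∞) (A : Set X) : Prop :=
  ∀ ε : ℝ≥0∞, 0 < ε → ∃ K : Set X, IsCompact K ∧ outerCap κ (symmDiff A K) < ε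


/-- Euclidean space `ℝⁿ`. -/
abbrev Rn (n : ℕ) := EuclideanSpace ℝ (Fin n)

/-- The α-Riesz kernel `|x−y|^(α−n)` on `ℝⁿ` (with value `∞` on the diagonal). -/
def rieszKernel (n : ℕ) (α : ℝ) : Rn n → Rn n → ℝ≥0∞ :=
  fun x y => (ENNReal.ofReal (dist x y)) ^ (α - (n : ℝ))

/-- `B` is inner α-thin at infinity. -/
def InnerThinAtInfinity (n : ℕ) (α : ℝ) (B : Set (Rn n)) : Prop :=
  ∃ q : ℝ, 1 < q ∧
    (∑' k : ℕ, innerCap (rieszKernel n α)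
        (B ∩ {x : Rn n | q ^ k ≤ ‖x‖ ∧ ‖x‖ < q ^ (k + 1)}) /
      ENNReal.ofReal (q ^ ((k : ℝ) * ((n : ℝ) - α)))) ≠ ⊤

/-- The Gauss–Weierstrass heat kernel on `ℝⁿ`, with values in `[0,∞]`. -/
def heatK (n : ℕ) (t : ℝ) (x : Rn n) : ℝ≥0∞ :=
  ENNReal.ofReal ((4 * Real.pi * t) ^ (-((n : ℝ) / 2)) * Real.exp (-‖x‖ ^ 2 / (4 * t)))

lemma measurable_heatK (n : ℕ) : Measurable (fun p : ℝ × Rn n => heatK n p.1 p.2) := by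
  unfold heatK
  fun_prop

lemma heatK_neg (n : ℕ) (t : ℝ) (x : Rn n) : heatK n t (-x) = heatK n t x := by
  simp [heatK]

lemma lintegral_exp_neg_mul_norm_sq (n : ℕ) {b : ℝ} (hb : 0 < b) (m : Rn n) :
    ∫⁻ z : Rn n, ENNReal.ofReal (Real.exp (-b * ‖z - m‖ ^ 2)) =
      ENNReal.ofReal ((Real.pi / b) ^ ((n : ℝ) / 2)) := by
  rw [lintegral_sub_right_eq_self (fun z : Rn n => ENNReal.ofReal (Real.exp (-b * ‖z‖ ^ 2))) m]
  have h := GaussianFourier.integral_rexp_neg_mul_sq_norm (V := Rn n) hb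
  rw [finrank_euclideanSpace_fin] at h
  rw [← h, ofReal_integral_eq_lintegral_ofReal]
  · by_contra hc
    rw [integral_undef hc] at h
    have : 0 < (Real.pi / b) ^ ((n : ℝ) / 2) := by positivity
    linarith
  · exact ae_of_all _ fun _ => (Real.exp_pos _).le

lemma lintegral_heatK (n : ℕ) {t : ℝ} (ht : 0 < t) : ∫⁻ x, heatK n t x = 1 := by
  have h : ∀ x : Rn n, heatK n t x = ENNReal.ofReal ((4 * Real.pi * t) ^ (-((n : ℝ) / 2))) *
      ENNReal.ofReal (Real.exp (-(1 / (4 * t)) * ‖x - 0‖ ^ 2)) := by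
    intro x
    rw [heatK, ENNReal.ofReal_mul (by positivity)]
    congr 3
    rw [sub_zero]; ring
  simp_rw [h]
  rw [lintegral_const_mul _ (by fun_prop), lintegral_exp_neg_mul_norm_sq n (by positivity),
    ← ENNReal.ofReal_mul (by positivity), Real.rpow_neg (by positivity),
    show Real.pi / (1 / (4 * t)) = 4 * Real.pi * t by field_simp,
    inv_mul_cancel₀ (by positivity), ENNReal.ofReal_one]

lemma heat_complete_square {n : ℕ} {s t : ℝ} (hs : 0 < s) (ht : 0 < t) (x z : Rn n) :
    -‖x - z‖ ^ 2 / (4 * s) + -‖z‖ ^ 2 / (4 * t) =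
      -‖x‖ ^ 2 / (4 * (s + t)) + -((s + t) / (4 * s * t)) * ‖z - (t / (s + t)) • x‖ ^ 2 := by
  have hst : 0 < s + t := by positivity
  rw [norm_sub_sq_real, norm_sub_sq_real, norm_smul, real_inner_smul_right, real_inner_comm z x,
    Real.norm_of_nonneg (by positivity)]
  field_simp
  ring

lemma heatK_semigroup (n : ℕ) {s t : ℝ} (hs : 0 < s) (ht : 0 < t) (x : Rn n) :
    ∫⁻ z, heatK n s (x - z) * heatK n t z = heatK n (s + t) x := by
  have hst : 0 < s + t := by positivity
  have h : ∀ z : Rn n, heatK n s (x - z) * heatK n t z =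
      ENNReal.ofReal ((4 * Real.pi * s) ^ (-((n : ℝ) / 2)) * (4 * Real.pi * t) ^ (-((n : ℝ) / 2)) *
        Real.exp (-‖x‖ ^ 2 / (4 * (s + t)))) *
      ENNReal.ofReal (Real.exp (-((s + t) / (4 * s * t)) * ‖z - (t / (s + t)) • x‖ ^ 2)) := by
    intro z
    rw [heatK, heatK, ← ENNReal.ofReal_mul (by positivity), ← ENNReal.ofReal_mul (by positivity)]
    congr 1
    rw [mul_mul_mul_comm, ← Real.exp_add, heat_complete_square hs ht, Real.exp_add]
    ring
  simp_rw [h]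
  rw [lintegral_const_mul _ (by fun_prop), lintegral_exp_neg_mul_norm_sq n (by positivity),
    ← ENNReal.ofReal_mul (by positivity), heatK]
  congr 1
  rw [mul_right_comm, ← Real.mul_rpow (by positivity) (by positivity),
    Real.rpow_neg (by positivity), Real.rpow_neg (by positivity),
    ← Real.inv_rpow (by positivity), ← Real.inv_rpow (by positivity),
    ← Real.mul_rpow (by positivity) (by positivity)]
  congr 2
  field_simp

lemma heatK_eq_exp_mul {n : ℕ} {t θ : ℝ} (hθ1 : θ < 1) (x : Rn n) :
    heatK n t x = ENNReal.ofReal (Real.exp (-(θ * ‖x‖ ^ 2) / (4 * t))) *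
      heatK n t (Real.sqrt (1 - θ) • x) := by
  rw [heatK, heatK, ← ENNReal.ofReal_mul (by positivity), norm_smul, mul_pow,
    Real.norm_of_nonneg (by positivity), Real.sq_sqrt (by linarith), mul_left_comm,
    ← Real.exp_add]
  congr 3
  ring

lemma heatK_le_tail {n : ℕ} {t ρ : ℝ} (ht : 0 < t) (hρ : 0 ≤ ρ) {x : Rn n} (hx : ρ ≤ ‖x‖) :
    heatK n t x ≤ ENNReal.ofReal (Real.exp (-ρ ^ 2 / (8 * t)) * 2 ^ ((n : ℝ) / 2)) *
      heatK n (2 * t) x := by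
  rw [heatK, heatK, ← ENNReal.ofReal_mul (by positivity)]
  apply ENNReal.ofReal_le_ofReal
  rw [show 4 * Real.pi * (2 * t) = 2 * (4 * Real.pi * t) by ring,
    Real.mul_rpow (x := 2) (by norm_num) (by positivity), Real.rpow_neg (x := 2) (by norm_num)]
  have h2 : (0 : ℝ) < 2 ^ ((n : ℝ) / 2) := by positivity
  rw [show Real.exp (-ρ ^ 2 / (8 * t)) * 2 ^ ((n : ℝ) / 2) *
    ((2 ^ ((n : ℝ) / 2))⁻¹ * (4 * Real.pi * t) ^ (-((n : ℝ) / 2)) *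
      Real.exp (-‖x‖ ^ 2 / (4 * (2 * t)))) = (4 * Real.pi * t) ^ (-((n : ℝ) / 2)) *
      (Real.exp (-ρ ^ 2 / (8 * t)) * Real.exp (-‖x‖ ^ 2 / (4 * (2 * t)))) by field_simp,
    ← Real.exp_add]
  gcongr
  have : ρ ^ 2 ≤ ‖x‖ ^ 2 := by gcongr
  rw [show -ρ ^ 2 / (8 * t) + -‖x‖ ^ 2 / (4 * (2 * t)) = -(ρ ^ 2 + ‖x‖ ^ 2) / (8 * t) by
    field_simp; ring, div_le_div_iff₀ (by positivity) (by positivity)]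
  nlinarith

/-- Convolution of the heat kernel with a measure. -/
def heatP {n : ℕ} (t : ℝ) (μ : Measure (Rn n)) (x : Rn n) : ℝ≥0∞ :=
  ∫⁻ y, heatK n t (x - y) ∂μ

/-- The convolution kernel obtained by mixing heat kernels according to `ρ`. -/
def mixK {n : ℕ} (ρ : Measure ℝ) (x : Rn n) : ℝ≥0∞ := ∫⁻ t, heatK n t x ∂ρ

/-- The potential of `μ` with respect to the kernel `mixK ρ`. -/
def mixP {n : ℕ} (ρ : Measure ℝ) (μ : Measure (Rn n)) (x : Rn n) : ℝ≥0∞ :=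
  ∫⁻ y, mixK ρ (x - y) ∂μ

variable {n : ℕ}

@[fun_prop]
lemma measurable_heatK_comp {β : Type*} [MeasurableSpace β] {f : β → ℝ} {g : β → Rn n}
    (hf : Measurable f) (hg : Measurable g) : Measurable (fun b => heatK n (f b) (g b)) :=
  (measurable_heatK n).comp (hf.prodMk hg)

lemma measurable_mixK (ρ : Measure ℝ) [SFinite ρ] : Measurable (mixK (n := n) ρ) := by
  unfold mixK
  exact Measurable.lintegral_prod_right' (f := fun p : Rn n × ℝ => heatK n p.2 p.1) (by fun_prop)

@[fun_prop]
lemma measurable_mixK_comp {β : Type*} [MeasurableSpace β] (ρ : Measure ℝ) [SFinite ρ]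
    {g : β → Rn n} (hg : Measurable g) : Measurable (fun b => mixK ρ (g b)) :=
  (measurable_mixK ρ).comp hg

@[fun_prop]
lemma measurable_mixP (ρ : Measure ℝ) [SFinite ρ] (μ : Measure (Rn n)) [SFinite μ] :
    Measurable (mixP ρ μ) := by
  unfold mixP
  exact Measurable.lintegral_prod_right' (f := fun p : Rn n × Rn n => mixK ρ (p.1 - p.2))
    (by fun_prop)

lemma mixK_neg (ρ : Measure ℝ) (x : Rn n) : mixK ρ (-x) = mixK ρ x := by
  simp [mixK, heatK_neg]

lemma mixK_sub_comm (ρ : Measure ℝ) (x y : Rn n) : mixK ρ (x - y) = mixK ρ (y - x) := by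
  rw [← mixK_neg, neg_sub]

lemma mixP_eq_lintegral_heatP (ρ : Measure ℝ) [SFinite ρ] (μ : Measure (Rn n)) [SFinite μ]
    (x : Rn n) : mixP ρ μ x = ∫⁻ t, heatP t μ x ∂ρ := by
  unfold mixP mixK heatP
  rw [lintegral_lintegral_swap]
  exact Measurable.aemeasurable (f := fun p : Rn n × ℝ => heatK n p.2 (x - p.1)) (by fun_prop)

lemma lintegral_mixP_comm (ρ : Measure ℝ) [SFinite ρ] (μ ν : Measure (Rn n)) [SFinite μ]
    [SFinite ν] : ∫⁻ x, mixP ρ μ x ∂ν = ∫⁻ x, mixP ρ ν x ∂μ := by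
  unfold mixP
  rw [lintegral_lintegral_swap
    (Measurable.aemeasurable (f := fun p : Rn n × Rn n => mixK ρ (p.1 - p.2)) (by fun_prop))]
  simp_rw [mixK_sub_comm ρ]

lemma heatP_heatP {s t : ℝ} (hs : 0 < s) (ht : 0 < t) (μ : Measure (Rn n)) [SFinite μ]
    (x : Rn n) : ∫⁻ z, heatK n s (x - z) * heatP t μ z = heatP (s + t) μ x := by
  unfold heatP
  have h1 : ∀ z, heatK n s (x - z) * ∫⁻ y, heatK n t (z - y) ∂μ =
      ∫⁻ y, heatK n s (x - z) * heatK n t (z - y) ∂μ :=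
    fun z => (lintegral_const_mul _ (by fun_prop)).symm
  simp_rw [h1]
  rw [lintegral_lintegral_swap (Measurable.aemeasurable
    (f := fun p : Rn n × Rn n => heatK n s (x - p.1) * heatK n t (p.1 - p.2)) (by fun_prop))]
  refine lintegral_congr fun y => ?_
  rw [← heatK_semigroup n hs ht, ← lintegral_sub_right_eq_self
    (fun z => heatK n s (x - y - z) * heatK n t z) y]
  simp

@[fun_prop]
lemma measurable_heatP {β : Type*} [MeasurableSpace β] (μ : Measure (Rn n)) [SFinite μ]
    {f : β → ℝ} {g : β → Rn n} (hf : Measurable f) (hg : Measurable g) :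
    Measurable (fun b => heatP (f b) μ (g b)) := by
  unfold heatP
  exact Measurable.lintegral_prod_right'
    (f := fun p : β × Rn n => heatK n (f p.1) (g p.1 - p.2)) (by fun_prop)

/-- Potentials compose according to convolution of the mixing measures. -/
lemma mixP_mixP (ρ ρ' : Measure ℝ) [SFinite ρ] [SFinite ρ'] (hρ : ∀ᵐ t ∂ρ, 0 < t)
    (hρ' : ∀ᵐ t ∂ρ', 0 < t) (μ : Measure (Rn n)) [SFinite μ] (x : Rn n) :
    mixP ρ (volume.withDensity (mixP ρ' μ)) x = mixP (ρ.conv ρ') μ x := by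
  rw [mixP_eq_lintegral_heatP, mixP_eq_lintegral_heatP, Measure.lintegral_conv (by fun_prop)]
  refine lintegral_congr_ae (hρ.mono fun s hs => ?_)
  simp only
  rw [heatP, lintegral_withDensity_eq_lintegral_mul _ (by fun_prop) (by fun_prop)]
  simp only [Pi.mul_apply]
  have h1 : ∀ z, mixP ρ' μ z * heatK n s (x - z) =
      ∫⁻ t, heatK n s (x - z) * heatP t μ z ∂ρ' := fun z => by
    rw [mixP_eq_lintegral_heatP ρ', mul_comm, lintegral_const_mul _ (by fun_prop)]
  simp_rw [h1]
  rw [lintegral_lintegral_swap (Measurable.aemeasurable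
    (f := fun p : Rn n × ℝ => heatK n s (x - p.1) * heatP p.2 μ p.1) (by fun_prop))]
  exact lintegral_congr_ae (hρ'.mono fun t ht => heatP_heatP hs ht μ x)

lemma two_mul_le_add_sq_ennreal (a b : ℝ≥0∞) : 2 * (a * b) ≤ a * a + b * b := by
  rcases eq_or_ne a ⊤ with rfl | ha
  · simp
  rcases eq_or_ne b ⊤ with rfl | hb
  · simp
  lift a to NNReal using ha
  lift b to NNReal using hb
  norm_cast
  have := two_mul_le_add_sq (a : ℝ) b
  rw [← NNReal.coe_le_coe]
  push_cast
  nlinarith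

lemma lintegral_heatP_eq {t : ℝ} (ht : 0 < t) (μ ν : Measure (Rn n)) [SFinite μ] [SFinite ν] :
    ∫⁻ x, heatP t μ x ∂ν = ∫⁻ z, heatP (t / 2) μ z * heatP (t / 2) ν z := by
  have h2 : 0 < t / 2 := by positivity
  have : ∀ x, heatP t μ x = ∫⁻ z, heatK n (t / 2) (x - z) * heatP (t / 2) μ z := fun x => by
    rw [heatP_heatP h2 h2, add_halves]
  simp_rw [this]
  rw [lintegral_lintegral_swap (Measurable.aemeasurable
    (f := fun p : Rn n × Rn n => heatK n (t / 2) (p.1 - p.2) * heatP (t / 2) μ p.2)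
    (by fun_prop))]
  refine lintegral_congr fun z => ?_
  rw [lintegral_mul_const _ (by fun_prop), mul_comm]
  congr 1
  unfold heatP
  refine lintegral_congr fun y => ?_
  rw [← heatK_neg, neg_sub]

/-- Mixtures of heat kernels are positive definite. -/
lemma two_mul_lintegral_mixP_le (ρ : Measure ℝ) [SFinite ρ] (hρ : ∀ᵐ t ∂ρ, 0 < t)
    (μ ν : Measure (Rn n)) [SFinite μ] [SFinite ν] :
    2 * ∫⁻ x, mixP ρ μ x ∂ν ≤ ∫⁻ x, mixP ρ μ x ∂μ + ∫⁻ x, mixP ρ ν x ∂ν := by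
  have key : ∀ (μ ν : Measure (Rn n)) [SFinite μ] [SFinite ν], ∫⁻ x, mixP ρ μ x ∂ν =
      ∫⁻ t, ∫⁻ z, heatP (t / 2) μ z * heatP (t / 2) ν z ∂volume ∂ρ := by
    intro μ ν _ _
    simp_rw [mixP_eq_lintegral_heatP]
    rw [lintegral_lintegral_swap (Measurable.aemeasurable
      (f := fun p : Rn n × ℝ => heatP p.2 μ p.1) (by fun_prop))]
    exact lintegral_congr_ae (hρ.mono fun t ht => lintegral_heatP_eq ht μ ν)
  have hm : ∀ (μ ν : Measure (Rn n)) [SFinite μ] [SFinite ν], Measurable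
      (fun t => ∫⁻ z, heatP (t / 2) μ z * heatP (t / 2) ν z ∂volume) := by
    intro μ ν _ _
    exact Measurable.lintegral_prod_right'
      (f := fun p : ℝ × Rn n => heatP (p.1 / 2) μ p.2 * heatP (p.1 / 2) ν p.2) (by fun_prop)
  rw [key, key, key, ← lintegral_const_mul _ (hm μ ν), ← lintegral_add_left (hm μ μ)]
  refine lintegral_mono fun t => ?_
  simp only
  rw [← lintegral_const_mul _ (by fun_prop), ← lintegral_add_left (by fun_prop)]
  exact lintegral_mono fun z => two_mul_le_add_sq_ennreal _ _

/-- The density `t ^ (β - 1)` on `(0, ∞)`. -/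
def kd (β t : ℝ) : ℝ≥0∞ := (Ioi (0 : ℝ)).indicator (fun t => ENNReal.ofReal (t ^ (β - 1))) t

/-- The measure `t ^ (β - 1) dt` on `(0, ∞)`, whose heat mixture is a multiple of the Riesz
kernel of order `2 β`. -/
def kM (β : ℝ) : Measure ℝ := volume.withDensity (kd β)

/-- The restriction of `kM β` to `(0, r]`. -/
def vM (β r : ℝ) : Measure ℝ := (kM β).restrict (Ioc 0 r)

@[fun_prop]
lemma measurable_kd (β : ℝ) : Measurable (kd β) := by
  unfold kd
  exact Measurable.indicator (by fun_prop) measurableSet_Ioi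

instance (β : ℝ) : SFinite (kM β) := by unfold kM; infer_instance

instance (β r : ℝ) : SFinite (vM β r) := by unfold vM; infer_instance

lemma kd_of_pos {β t : ℝ} (ht : 0 < t) : kd β t = ENNReal.ofReal (t ^ (β - 1)) :=
  indicator_of_mem (mem_Ioi.2 ht) _

lemma kd_of_nonpos {β t : ℝ} (ht : t ≤ 0) : kd β t = 0 :=
  indicator_of_notMem (by simpa using ht) _

lemma kd_anti {β s t : ℝ} (hβ : β ≤ 1) (hs : 0 < s) (hst : s ≤ t) : kd β t ≤ kd β s := by
  rw [kd_of_pos hs, kd_of_pos (hs.trans_le hst)]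
  exact ENNReal.ofReal_le_ofReal (Real.rpow_le_rpow_of_nonpos hs hst (by linarith))

lemma kM_ae_pos (β : ℝ) : ∀ᵐ t ∂kM β, 0 < t := by
  have h : kM β (Iic 0) = 0 := by
    rw [kM, withDensity_apply _ measurableSet_Iic, setLIntegral_congr_fun (g := fun _ => 0)
      measurableSet_Iic (fun t ht => kd_of_nonpos ht)]
    simp
  rw [ae_iff]
  simpa [Iic_def] using h

lemma vM_le_kM (β r : ℝ) : vM β r ≤ kM β := Measure.restrict_le_self

lemma vM_ae_mem (β r : ℝ) : ∀ᵐ t ∂vM β r, t ∈ Ioc 0 r := ae_restrict_mem measurableSet_Ioc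

lemma vM_ae_pos (β r : ℝ) : ∀ᵐ t ∂vM β r, 0 < t := (vM_ae_mem β r).mono fun _ h => h.1

lemma vM_univ_lt_top {β : ℝ} (hβ : 0 < β) (r : ℝ) : vM β r univ < ⊤ := by
  rw [vM, Measure.restrict_apply_univ, kM, withDensity_apply _ measurableSet_Ioc,
    setLIntegral_congr_fun measurableSet_Ioc (fun t ht => kd_of_pos ht.1)]
  rcases le_total r 0 with hr | hr
  · simp [Ioc_eq_empty (not_lt.2 hr)]
  · have := (intervalIntegral.intervalIntegrable_rpow' (a := 0) (b := r)
      (show -1 < β - 1 by linarith)).1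
    exact (lintegral_ofReal_le_lintegral_enorm _).trans_lt this.2

lemma vM_univ_ne_zero {β r : ℝ} (hr : 0 < r) : vM β r univ ≠ 0 := by
  rw [vM, Measure.restrict_apply_univ, kM, withDensity_apply _ measurableSet_Ioc, Ne,
    lintegral_eq_zero_iff (measurable_kd β)]
  intro h
  have h2 : ∀ᵐ t ∂(volume.restrict (Ioc 0 r)), False := by
    filter_upwards [h, ae_restrict_mem measurableSet_Ioc] with t ht hm
    rw [kd_of_pos hm.1] at ht
    simp only [Pi.zero_apply, ENNReal.ofReal_eq_zero] at ht
    exact absurd (Real.rpow_pos_of_pos hm.1 _) (not_lt.2 ht)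
  rw [ae_iff] at h2
  simp at h2
  linarith

lemma lintegral_conv_kM (ρ : Measure ℝ) [SFinite ρ] (β : ℝ) {E : ℝ → ℝ≥0∞} (hE : Measurable E) :
    ∫⁻ t, E t ∂(ρ.conv (kM β)) = ∫⁻ τ, E τ * ∫⁻ s, kd β (τ - s) ∂ρ := by
  rw [Measure.lintegral_conv hE]
  have h1 : ∀ s, ∫⁻ t, E (s + t) ∂kM β = ∫⁻ τ, E τ * kd β (τ - s) := fun s => by
    rw [kM, lintegral_withDensity_eq_lintegral_mul _ (by fun_prop) (by fun_prop),
      ← lintegral_sub_right_eq_self (fun t => (kd β * fun t => E (s + t)) t) s]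
    refine lintegral_congr fun t => ?_
    simp [mul_comm]
  simp_rw [h1]
  rw [lintegral_lintegral_swap (Measurable.aemeasurable
    (f := fun p : ℝ × ℝ => E p.2 * kd β (p.2 - p.1)) (by fun_prop))]
  exact lintegral_congr fun τ => lintegral_const_mul _ (by fun_prop)

lemma lintegral_kd_sub_vM_of_nonpos {β r τ : ℝ} (hτ : τ ≤ 0) :
    ∫⁻ s, kd β (τ - s) ∂vM β r = 0 := by
  rw [lintegral_eq_zero_iff (by fun_prop)]
  filter_upwards [vM_ae_pos β r] with s hs
  exact kd_of_nonpos (by linarith)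

lemma lintegral_kd_sub_vM_le {β : ℝ} (hβ0 : 0 < β) (hβ1 : β ≤ 1) (r τ : ℝ) :
    ∫⁻ s, kd β (τ - s) ∂vM β r ≤ 4 * vM β r univ * kd β τ := by
  rcases le_or_gt τ 0 with hτ | hτ
  · simp [lintegral_kd_sub_vM_of_nonpos hτ]
  let w : ℝ → ℝ≥0∞ := (Ioc 0 r).indicator (kd β)
  have hw : Measurable w := (measurable_kd β).indicator measurableSet_Ioc
  have hwi : ∫⁻ s, w s = vM β r univ := by
    rw [lintegral_indicator measurableSet_Ioc, vM, Measure.restrict_apply_univ, kM,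
      withDensity_apply _ measurableSet_Ioc]
  have hhalf : kd β (τ / 2) ≤ 2 * kd β τ := by
    rw [kd_of_pos hτ, kd_of_pos (half_pos hτ), show (2 : ℝ≥0∞) = ENNReal.ofReal 2 by simp,
      ← ENNReal.ofReal_mul (by norm_num), Real.div_rpow hτ.le (by norm_num)]
    apply ENNReal.ofReal_le_ofReal
    rw [div_eq_inv_mul, ← Real.rpow_neg (by norm_num)]
    gcongr
    calc (2 : ℝ) ^ (-(β - 1)) ≤ 2 ^ (1 : ℝ) :=
          Real.rpow_le_rpow_of_exponent_le (by norm_num) (by linarith)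
      _ = 2 := Real.rpow_one 2
  calc ∫⁻ s, kd β (τ - s) ∂vM β r = ∫⁻ s, w s * kd β (τ - s) := by
        rw [vM, kM, restrict_withDensity measurableSet_Ioc,
          lintegral_withDensity_eq_lintegral_mul _ (by fun_prop) (by fun_prop),
          ← lintegral_indicator measurableSet_Ioc]
        refine lintegral_congr fun s => ?_
        by_cases hs : s ∈ Ioc 0 r <;> simp [w, hs]
    _ ≤ ∫⁻ s, kd β (τ / 2) * (w s + w (τ - s)) := by
        refine lintegral_mono fun s => ?_
        simp only [w, indicator]
        split_ifs with h1 h2 h2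
        · rcases le_total (τ / 2) s with h | h
          · rw [mul_add]
            refine le_add_left (mul_le_mul' (kd_anti hβ1 (half_pos hτ) h) le_rfl)
          · rw [mul_add, mul_comm]
            exact le_add_right (mul_le_mul' (kd_anti hβ1 (half_pos hτ) (by linarith)) le_rfl)
        · rw [add_zero, mul_comm]
          rcases le_or_gt τ s with h | h
          · rw [kd_of_nonpos (by linarith)]; simp
          refine mul_le_mul' (kd_anti hβ1 (half_pos hτ) ?_) le_rfl
          simp only [mem_Ioc, not_and, not_le] at h1 h2
          have := h2 (by linarith)
          linarith
        · simp
        · simp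
    _ = kd β (τ / 2) * (2 * vM β r univ) := by
        rw [lintegral_const_mul _ (by fun_prop), lintegral_add_left hw,
          lintegral_sub_left_eq_self w τ, hwi, two_mul]
    _ ≤ 2 * kd β τ * (2 * vM β r univ) := by gcongr
    _ = 4 * vM β r univ * kd β τ := by ring

lemma lintegral_conv_vM_le {β : ℝ} (hβ0 : 0 < β) (hβ1 : β ≤ 1) (r : ℝ) {E : ℝ → ℝ≥0∞}
    (hE : Measurable E) :
    ∫⁻ t, E t ∂((vM β r).conv (kM β)) ≤ 4 * vM β r univ * ∫⁻ t, E t ∂kM β := by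
  rw [lintegral_conv_kM _ _ hE, kM, lintegral_withDensity_eq_lintegral_mul _ (by fun_prop) hE,
    ← lintegral_const_mul _ (by fun_prop)]
  refine lintegral_mono fun τ => ?_
  calc E τ * ∫⁻ s, kd β (τ - s) ∂vM β r ≤ E τ * (4 * vM β r univ * kd β τ) := by
        gcongr; exact lintegral_kd_sub_vM_le hβ0 hβ1 r τ
    _ = _ := by simp only [Pi.mul_apply]; ring

lemma tendsto_lintegral_kd_sub_vM {β : ℝ} (hβ0 : 0 < β) (hβ1 : β ≤ 1) (τ : ℝ) :
    Tendsto (fun r => (vM β r univ)⁻¹ * ∫⁻ s, kd β (τ - s) ∂vM β r) (𝓝[>] 0) (𝓝 (kd β τ)) := by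
  rcases le_or_gt τ 0 with hτ | hτ
  · simp [lintegral_kd_sub_vM_of_nonpos hτ, kd_of_nonpos hτ]
  have hcont : Tendsto (fun r => kd β (τ - r)) (𝓝[>] 0) (𝓝 (kd β τ)) := by
    rw [kd_of_pos hτ]
    have h1 : Tendsto (fun r : ℝ => ENNReal.ofReal ((τ - r) ^ (β - 1))) (𝓝[>] 0)
        (𝓝 (ENNReal.ofReal (τ ^ (β - 1)))) := by
      refine ENNReal.tendsto_ofReal (Tendsto.mono_left ?_ nhdsWithin_le_nhds)
      have : ContinuousAt (fun r : ℝ => (τ - r) ^ (β - 1)) 0 :=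
        ContinuousAt.rpow_const (by fun_prop) (by left; simpa using hτ.ne')
      simpa [ContinuousAt] using this
    refine h1.congr' ?_
    filter_upwards [mem_nhdsWithin_of_mem_nhds (Iio_mem_nhds hτ)] with r hr
    rw [kd_of_pos (by simpa using hr)]
  have havg : ∀ r, 0 < r → ∀ c : ℝ≥0∞, (vM β r univ)⁻¹ * ∫⁻ _, c ∂vM β r = c := fun r hr c => by
    rw [lintegral_const, mul_comm, mul_assoc,
      ENNReal.mul_inv_cancel (vM_univ_ne_zero hr) (vM_univ_lt_top hβ0 r).ne, mul_one]
  refine tendsto_of_tendsto_of_tendsto_of_le_of_le' tendsto_const_nhds hcont ?_ ?_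
  · filter_upwards [self_mem_nhdsWithin, mem_nhdsWithin_of_mem_nhds (Iio_mem_nhds hτ)] with r hr hr2
    rw [← havg r hr (kd β τ)]
    gcongr 1
    refine lintegral_mono_ae ?_
    filter_upwards [vM_ae_mem β r] with s hs
    exact kd_anti hβ1 (by linarith [hs.2, mem_Iio.1 hr2]) (by linarith [hs.1])
  · filter_upwards [self_mem_nhdsWithin, mem_nhdsWithin_of_mem_nhds (Iio_mem_nhds hτ)] with r hr hr2
    rw [← havg r hr (kd β (τ - r))]
    gcongr 1
    refine lintegral_mono_ae ?_
    filter_upwards [vM_ae_mem β r] with s hs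
    exact kd_anti hβ1 (by linarith [mem_Iio.1 hr2]) (by linarith [hs.2])

lemma tendsto_lintegral_conv_vM {β : ℝ} (hβ0 : 0 < β) (hβ1 : β ≤ 1) {E : ℝ → ℝ≥0∞}
    (hE : Measurable E) (hfin : ∫⁻ t, E t ∂kM β ≠ ⊤) :
    Tendsto (fun r => (vM β r univ)⁻¹ * ∫⁻ t, E t ∂((vM β r).conv (kM β))) (𝓝[>] 0)
      (𝓝 (∫⁻ t, E t ∂kM β)) := by
  have hk : ∫⁻ t, E t ∂kM β = ∫⁻ τ, E τ * kd β τ := by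
    rw [kM, lintegral_withDensity_eq_lintegral_mul _ (by fun_prop) hE]
    simp [mul_comm]
  have hm : ∀ r, Measurable fun τ => ∫⁻ s, kd β (τ - s) ∂vM β r := fun r =>
    Measurable.lintegral_prod_right' (f := fun p : ℝ × ℝ => kd β (p.1 - p.2)) (by fun_prop)
  have hrw : ∀ r, (vM β r univ)⁻¹ * ∫⁻ t, E t ∂((vM β r).conv (kM β)) =
      ∫⁻ τ, E τ * ((vM β r univ)⁻¹ * ∫⁻ s, kd β (τ - s) ∂vM β r) := fun r => by
    rw [lintegral_conv_kM _ _ hE, ← lintegral_const_mul _ (by have := hm r; fun_prop)]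
    exact lintegral_congr fun τ => by ring
  simp_rw [hrw]
  rw [hk]
  refine tendsto_lintegral_filter_of_dominated_convergence (fun τ => 4 * (E τ * kd β τ)) ?_ ?_ ?_ ?_
  · exact Eventually.of_forall fun r => by have := hm r; fun_prop
  · filter_upwards [self_mem_nhdsWithin] with r hr
    refine ae_of_all _ fun τ => ?_
    calc E τ * ((vM β r univ)⁻¹ * ∫⁻ s, kd β (τ - s) ∂vM β r)
        ≤ E τ * ((vM β r univ)⁻¹ * (4 * vM β r univ * kd β τ)) := by
          gcongr; exact lintegral_kd_sub_vM_le hβ0 hβ1 r τ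
      _ = 4 * (E τ * kd β τ) * ((vM β r univ)⁻¹ * vM β r univ) := by ring
      _ = _ := by
        rw [ENNReal.inv_mul_cancel (vM_univ_ne_zero hr) (vM_univ_lt_top hβ0 r).ne, mul_one]
  · rw [lintegral_const_mul _ (by fun_prop), ← hk]
    exact ENNReal.mul_ne_top (by norm_num) hfin
  · refine ae_of_all _ fun τ => ?_
    rcases le_or_gt τ 0 with hτ | hτ
    · simp [lintegral_kd_sub_vM_of_nonpos hτ, kd_of_nonpos hτ]
    · refine ENNReal.Tendsto.const_mul (tendsto_lintegral_kd_sub_vM hβ0 hβ1 τ) (Or.inl ?_)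
      rw [kd_of_pos hτ]
      simpa using Real.rpow_pos_of_pos hτ _

/-- The normalising constant `∫₀^∞ v^{-β} / (1 + v) dv`. -/
def betaC (β : ℝ) : ℝ≥0∞ := ∫⁻ v in Ioi (0 : ℝ), ENNReal.ofReal (v ^ (-β) / (1 + v))

/-- A probability measure on `[r, ∞)` whose convolution with `kM β` is the restriction of
`kM β` to `(r, ∞)`. -/
def nuM (β r : ℝ) : Measure ℝ :=
  if β = 1 then Measure.dirac r else
    volume.withDensity ((Ioi r).indicator fun s =>
      (betaC β)⁻¹ * ENNReal.ofReal (r ^ β * s⁻¹ * (s - r) ^ (-β)))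

lemma betaC_ne_top {β : ℝ} (hβ0 : 0 < β) (hβ1 : β < 1) : betaC β ≠ ⊤ := by
  have h1 : IntegrableOn (fun v : ℝ => v ^ (-β)) (Ioc 0 1) :=
    (intervalIntegral.intervalIntegrable_rpow' (by linarith)).1
  have h2 : IntegrableOn (fun v : ℝ => v ^ (-β - 1)) (Ioi 1) :=
    integrableOn_Ioi_rpow_of_lt (by linarith) one_pos
  have h1' : ∫⁻ v in Ioc (0 : ℝ) 1, ENNReal.ofReal (v ^ (-β) / (1 + v)) < ⊤ := by
    refine lt_of_le_of_lt ?_ h1.2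
    refine le_trans (setLIntegral_mono' measurableSet_Ioc fun v hv => ?_)
      (lintegral_ofReal_le_lintegral_enorm _)
    refine ENNReal.ofReal_le_ofReal (div_le_self (Real.rpow_nonneg hv.1.le _) (by linarith [hv.1]))
  have h2' : ∫⁻ v in Ioi (1 : ℝ), ENNReal.ofReal (v ^ (-β) / (1 + v)) < ⊤ := by
    refine lt_of_le_of_lt ?_ h2.2
    refine le_trans (setLIntegral_mono' measurableSet_Ioi fun v hv => ?_)
      (lintegral_ofReal_le_lintegral_enorm _)
    have hv0 : (0 : ℝ) < v := one_pos.trans hv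
    refine ENNReal.ofReal_le_ofReal ?_
    rw [Real.rpow_sub hv0, Real.rpow_one]
    gcongr
    linarith
  rw [betaC, ← Ioc_union_Ioi_eq_Ioi zero_le_one]
  exact ((lintegral_union_le _ _ _).trans_lt (ENNReal.add_lt_top.2 ⟨h1', h2'⟩)).ne

lemma betaC_ne_zero (β : ℝ) : betaC β ≠ 0 := by
  rw [betaC, Ne, lintegral_eq_zero_iff (by fun_prop)]
  intro h
  have h2 : ∀ᵐ t ∂(volume.restrict (Ioi (0 : ℝ))), False := by
    filter_upwards [h, ae_restrict_mem measurableSet_Ioi] with t ht hm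
    simp only [Pi.zero_apply, ENNReal.ofReal_eq_zero] at ht
    have h0 : (0 : ℝ) < t := hm
    exact absurd (show 0 < t ^ (-β) / (1 + t) by positivity) (not_lt.2 ht)
  rw [ae_iff] at h2
  simp at h2

instance (β r : ℝ) : SFinite (nuM β r) := by
  unfold nuM
  split_ifs <;> infer_instance

lemma nuM_ae_ge (β r : ℝ) : ∀ᵐ s ∂nuM β r, r ≤ s := by
  unfold nuM
  split_ifs with h
  · rw [ae_dirac_iff measurableSet_Ici]
  · rw [ae_withDensity_iff (Measurable.indicator (by fun_prop) measurableSet_Ioi)]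
    refine ae_of_all _ fun s hs => ?_
    by_contra hc
    exact hs (indicator_of_notMem (by simpa using (not_le.1 hc).le) _)

lemma nuM_univ {β r : ℝ} (hβ0 : 0 < β) (hβ1 : β ≤ 1) (hr : 0 < r) : nuM β r univ = 1 := by
  unfold nuM
  split_ifs with h
  · simp
  have hlt : β < 1 := lt_of_le_of_ne hβ1 h
  rw [withDensity_apply _ MeasurableSet.univ, setLIntegral_univ,
    lintegral_indicator measurableSet_Ioi, lintegral_const_mul _ (by fun_prop)]
  have himg : Set.image (fun v : ℝ => r + r * v) (Ioi 0) = Ioi r := by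
    ext s
    simp only [mem_image, mem_Ioi]
    constructor
    · rintro ⟨v, hv, rfl⟩
      have := mul_pos hr hv
      linarith
    · intro hs
      exact ⟨(s - r) / r, div_pos (by linarith) hr, by field_simp; ring⟩
  rw [← himg, lintegral_image_eq_lintegral_abs_deriv_mul (f' := fun _ => r) measurableSet_Ioi
    (fun v _ => by
      simpa using (((hasDerivAt_id v).const_mul r).const_add r).hasDerivWithinAt)
    (fun a _ b _ hab => by simpa [hr.ne'] using hab)]
  rw [← ENNReal.inv_mul_cancel (betaC_ne_zero β) (betaC_ne_top hβ0 hlt)]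
  congr 1
  refine setLIntegral_congr_fun measurableSet_Ioi fun v hv => ?_
  have hv0 : (0 : ℝ) < v := hv
  rw [← ENNReal.ofReal_mul (abs_nonneg _), abs_of_pos hr]
  congr 1
  rw [add_sub_cancel_left, Real.mul_rpow hr.le hv0.le, Real.rpow_neg hr.le]
  have : 0 < r ^ β := by positivity
  field_simp

lemma lintegral_kd_sub_nuM {β r : ℝ} (hβ0 : 0 < β) (hβ1 : β ≤ 1) (hr : 0 < r) (τ : ℝ) :
    ∫⁻ s, kd β (τ - s) ∂nuM β r = (Ioi r).indicator (kd β) τ := by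
  unfold nuM
  split_ifs with h
  · rw [lintegral_dirac' _ (by fun_prop), h]
    by_cases hτ : r < τ
    · rw [indicator_of_mem (mem_Ioi.2 hτ), kd_of_pos (by linarith), kd_of_pos (by linarith)]
      simp
    · rw [indicator_of_notMem (by simpa using hτ), kd_of_nonpos (by linarith)]
  have hlt : β < 1 := lt_of_le_of_ne hβ1 h
  rw [lintegral_withDensity_eq_lintegral_mul _
    (Measurable.indicator (by fun_prop) measurableSet_Ioi) (by fun_prop)]
  by_cases hτ : r < τ
  swap
  · rw [indicator_of_notMem (by simpa using hτ), lintegral_eq_zero_iff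
      (Measurable.mul (Measurable.indicator (by fun_prop) measurableSet_Ioi) (by fun_prop))]
    refine ae_of_all _ fun s => ?_
    simp only [Pi.mul_apply, Pi.zero_apply, mul_eq_zero, indicator_apply_eq_zero, mem_Ioi]
    rcases le_or_gt s r with hs | hs
    · exact Or.inl fun h => absurd hs (not_le.2 h)
    · exact Or.inr (kd_of_nonpos (by linarith))
  have hτ0 : 0 < τ := hr.trans hτ
  rw [indicator_of_mem (mem_Ioi.2 hτ), kd_of_pos hτ0]
  have h1 : ∀ s, ((Ioi r).indicator (fun s => (betaC β)⁻¹ *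
      ENNReal.ofReal (r ^ β * s⁻¹ * (s - r) ^ (-β))) * fun s => kd β (τ - s)) s =
      (betaC β)⁻¹ * (Ioo r τ).indicator (fun s =>
        ENNReal.ofReal (r ^ β * s⁻¹ * (s - r) ^ (-β) * (τ - s) ^ (β - 1))) s := fun s => by
    simp only [Pi.mul_apply]
    by_cases hs : r < s
    · rw [indicator_of_mem (mem_Ioi.2 hs)]
      by_cases hs2 : s < τ
      · have := hr.trans hs
        have : 0 < s - r := by linarith
        rw [indicator_of_mem (show s ∈ Ioo r τ from ⟨hs, hs2⟩), kd_of_pos (by linarith), mul_assoc,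
          ← ENNReal.ofReal_mul (by positivity)]
      · rw [indicator_of_notMem (fun hm => hs2 hm.2), kd_of_nonpos (by linarith)]
        simp
    · rw [indicator_of_notMem (by simpa using hs), indicator_of_notMem (fun hm => hs hm.1)]
      simp
  simp_rw [h1]
  rw [lintegral_const_mul _ (Measurable.indicator (by fun_prop) measurableSet_Ioo),
    lintegral_indicator measurableSet_Ioo]
  have himg : Set.image (fun v : ℝ => r * τ * (1 + v) / (τ + r * v)) (Ioi 0) = Ioo r τ := by
    ext s
    simp only [mem_image, mem_Ioi, mem_Ioo]
    constructor
    · rintro ⟨v, hv, rfl⟩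
      have : 0 < τ + r * v := by positivity
      rw [lt_div_iff₀ this, div_lt_iff₀ this]
      constructor
      · nlinarith [mul_pos (mul_pos hr hv) (sub_pos.2 hτ)]
      · nlinarith [mul_pos hτ0 (sub_pos.2 hτ)]
    · rintro ⟨hs1, hs2⟩
      have h3 : 0 < τ - s := by linarith
      have h4 : 0 < τ - r := by linarith
      refine ⟨τ * (s - r) / (r * (τ - s)), div_pos (mul_pos hτ0 (by linarith)) (by positivity), ?_⟩
      have h5 : τ + r * (τ * (s - r) / (r * (τ - s))) = τ * (τ - r) / (τ - s) := by
        field_simp; ring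
      rw [h5]
      field_simp
      ring
  have hderiv : ∀ v ∈ Ioi (0 : ℝ), HasDerivWithinAt (fun v : ℝ => r * τ * (1 + v) / (τ + r * v))
      (r * τ * (τ - r) / (τ + r * v) ^ 2) (Ioi 0) v := fun v hv => by
    have hv0 : (0 : ℝ) < v := hv
    have hp : τ + r * v ≠ 0 := by positivity
    have hd := ((((hasDerivAt_id v).const_add 1).const_mul (r * τ)).div
      (((hasDerivAt_id v).const_mul r).const_add τ) hp).hasDerivWithinAt (s := Ioi 0)
    refine hd.congr_deriv ?_
    simp only [id]
    field_simp
    ring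
  have hinj : InjOn (fun v : ℝ => r * τ * (1 + v) / (τ + r * v)) (Ioi 0) := by
    intro a ha b hb hab
    have ha0 : (0 : ℝ) < a := ha
    have hb0 : (0 : ℝ) < b := hb
    simp only at hab
    rw [div_eq_div_iff (by positivity) (by positivity)] at hab
    have h6 : (r * τ * (τ - r)) * (a - b) = 0 := by linear_combination hab
    have h7 : r * τ * (τ - r) ≠ 0 := by
      have : 0 < τ - r := by linarith
      positivity
    have := (mul_eq_zero.1 h6).resolve_left h7
    linarith
  rw [← himg, lintegral_image_eq_lintegral_abs_deriv_mul measurableSet_Ioi hderiv hinj]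
  have h2 : ∀ v ∈ Ioi (0 : ℝ), ENNReal.ofReal |r * τ * (τ - r) / (τ + r * v) ^ 2| *
      ENNReal.ofReal (r ^ β * (r * τ * (1 + v) / (τ + r * v))⁻¹ *
        (r * τ * (1 + v) / (τ + r * v) - r) ^ (-β) *
        (τ - r * τ * (1 + v) / (τ + r * v)) ^ (β - 1)) =
      ENNReal.ofReal (τ ^ (β - 1)) * ENNReal.ofReal (v ^ (-β) / (1 + v)) := fun v hv => by
    have hv0 : (0 : ℝ) < v := hv
    have hp : 0 < τ + r * v := by positivity
    have h4 : 0 < τ - r := by linarith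
    rw [← ENNReal.ofReal_mul (abs_nonneg _), ← ENNReal.ofReal_mul (by positivity),
      abs_of_pos (by positivity)]
    congr 1
    have e1 : r * τ * (1 + v) / (τ + r * v) - r = r * v * (τ - r) / (τ + r * v) := by
      field_simp; ring
    have e2 : τ - r * τ * (1 + v) / (τ + r * v) = τ * (τ - r) / (τ + r * v) := by
      field_simp; ring
    rw [e1, e2, Real.div_rpow (by positivity) hp.le, Real.div_rpow (by positivity) hp.le,
      Real.mul_rpow (by positivity) h4.le, Real.mul_rpow hr.le hv0.le,
      Real.mul_rpow hτ0.le h4.le, Real.rpow_sub_one h4.ne', Real.rpow_sub_one hp.ne',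
      Real.rpow_sub_one hτ0.ne', Real.rpow_neg hr.le, Real.rpow_neg h4.le, Real.rpow_neg hp.le]
    have : 0 < r ^ β := by positivity
    have : 0 < τ ^ β := by positivity
    have : 0 < (τ - r) ^ β := by positivity
    have : 0 < (τ + r * v) ^ β := by positivity
    field_simp
  rw [setLIntegral_congr_fun measurableSet_Ioi h2, lintegral_const_mul _ (by fun_prop), mul_left_comm]
  change _ * ((betaC β)⁻¹ * betaC β) = _
  rw [ENNReal.inv_mul_cancel (betaC_ne_zero β) (betaC_ne_top hβ0 hlt), mul_one]

lemma nuM_conv_kM {β r : ℝ} (hβ0 : 0 < β) (hβ1 : β ≤ 1) (hr : 0 < r) :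
    (nuM β r).conv (kM β) = (kM β).restrict (Ioi r) := by
  ext S hS
  rw [← lintegral_indicator_one hS, lintegral_conv_kM _ _ (by fun_prop (disch := exact hS)),
    Measure.restrict_apply hS, kM, withDensity_apply _ (hS.inter measurableSet_Ioi),
    ← lintegral_indicator (hS.inter measurableSet_Ioi)]
  refine lintegral_congr fun τ => ?_
  rw [lintegral_kd_sub_nuM hβ0 hβ1 hr]
  by_cases h1 : τ ∈ S <;> by_cases h2 : τ ∈ Ioi r <;> simp [h1, h2, indicator]

lemma lintegral_ofReal_eq_of_integral_pos {γ : Type*} [MeasurableSpace γ] {μ : Measure γ}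
    {f : γ → ℝ} {c : ℝ} (hf : 0 ≤ᵐ[μ] f) (hc : 0 < c) (h : ∫ x, f x ∂μ = c) :
    ∫⁻ x, ENNReal.ofReal (f x) ∂μ = ENNReal.ofReal c := by
  rw [← h, ofReal_integral_eq_lintegral_ofReal _ hf]
  by_contra hi
  rw [integral_undef hi] at h
  exact hc.ne h

lemma lintegral_kM (β : ℝ) {E : ℝ → ℝ≥0∞} (hE : Measurable E) :
    ∫⁻ t, E t ∂kM β = ∫⁻ t in Ioi 0, ENNReal.ofReal (t ^ (β - 1)) * E t := by
  rw [kM, lintegral_withDensity_eq_lintegral_mul _ (by fun_prop) hE,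
    ← lintegral_indicator measurableSet_Ioi]
  refine lintegral_congr fun t => ?_
  by_cases h : t ∈ Ioi (0 : ℝ) <;> simp [kd, h]

lemma mixK_kM (n : ℕ) {β : ℝ} (hn : β < n / 2) {x : Rn n} (hx : x ≠ 0) :
    mixK (kM β) x = ENNReal.ofReal ((4 * Real.pi) ^ (-((n : ℝ) / 2)) *
      4 ^ ((n : ℝ) / 2 - β) * Real.Gamma (n / 2 - β)) * ENNReal.ofReal ‖x‖ ^ (2 * β - n) := by
  have hR : 0 < ‖x‖ := norm_pos_iff.2 hx
  have hG : 0 < Real.Gamma ((n : ℝ) / 2 - β) := Real.Gamma_pos_of_pos (by linarith)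
  rw [mixK, lintegral_kM _ (by fun_prop)]
  have himg : Set.image (fun u : ℝ => u⁻¹) (Ioi 0) = Ioi 0 := by
    ext s
    simp only [mem_image, mem_Ioi]
    exact ⟨by rintro ⟨u, hu, rfl⟩; exact inv_pos.2 hu, fun hs => ⟨s⁻¹, inv_pos.2 hs, inv_inv s⟩⟩
  rw [← himg, lintegral_image_eq_lintegral_abs_deriv_mul measurableSet_Ioi
    (fun v (hv : v ∈ Ioi (0 : ℝ)) => (hasDerivAt_inv (ne_of_gt hv)).hasDerivWithinAt)
    (inv_injective.injOn)]
  have h1 : ∀ u ∈ Ioi (0 : ℝ), ENNReal.ofReal |-(u ^ 2)⁻¹| *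
      (ENNReal.ofReal (u⁻¹ ^ (β - 1)) * heatK n u⁻¹ x) =
      ENNReal.ofReal ((4 * Real.pi) ^ (-((n : ℝ) / 2))) *
      ENNReal.ofReal (u ^ ((n : ℝ) / 2 - β - 1) * Real.exp (-(‖x‖ ^ 2 / 4 * u))) := fun u hu => by
    have hu0 : (0 : ℝ) < u := hu
    rw [heatK, ← ENNReal.ofReal_mul (by positivity), ← ENNReal.ofReal_mul (by positivity),
      ← ENNReal.ofReal_mul (by positivity), abs_neg, abs_of_pos (by positivity)]
    congr 1
    rw [Real.mul_rpow (by positivity) (by positivity), Real.inv_rpow hu0.le,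
      Real.inv_rpow hu0.le, ← Real.rpow_neg hu0.le, ← Real.rpow_neg hu0.le, neg_neg,
      ← Real.rpow_natCast, ← Real.rpow_neg hu0.le]
    have e1 : u ^ ((n : ℝ) / 2 - β - 1) = u ^ (-((2 : ℕ) : ℝ)) * u ^ (-(β - 1)) * u ^ ((n : ℝ) / 2) := by
      rw [← Real.rpow_add hu0, ← Real.rpow_add hu0]
      congr 1
      push_cast
      ring
    rw [e1, show -‖x‖ ^ 2 / (4 * u⁻¹) = -(‖x‖ ^ 2 / 4 * u) by field_simp]
    ring
  rw [setLIntegral_congr_fun measurableSet_Ioi h1, lintegral_const_mul _ (by fun_prop),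
    lintegral_ofReal_eq_of_integral_pos (c := (1 / (‖x‖ ^ 2 / 4)) ^ ((n : ℝ) / 2 - β) *
      Real.Gamma (n / 2 - β)) _ (by positivity)
      (Real.integral_rpow_mul_exp_neg_mul_Ioi (by linarith) (by positivity)),
    ENNReal.ofReal_rpow_of_pos hR, ← ENNReal.ofReal_mul (by positivity),
    ← ENNReal.ofReal_mul (by positivity)]
  · congr 1
    have e2 : (1 / (‖x‖ ^ 2 / 4)) ^ ((n : ℝ) / 2 - β) =
        4 ^ ((n : ℝ) / 2 - β) * ‖x‖ ^ (2 * β - n) := by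
      rw [one_div_div, Real.div_rpow (by norm_num) (by positivity), ← Real.rpow_natCast,
        ← Real.rpow_mul hR.le, div_eq_mul_inv, ← Real.rpow_neg hR.le]
      congr 2
      push_cast
      ring
    rw [e2]
    ring
  · filter_upwards [ae_restrict_mem measurableSet_Ioi] with t ht
    have : (0 : ℝ) < t := ht
    simp only [Pi.zero_apply]
    positivity

lemma mixK_kM_zero (n : ℕ) {β : ℝ} : mixK (kM β) (0 : Rn n) = ⊤ := by
  rw [mixK, lintegral_kM _ (by fun_prop)]
  have h1 : ∀ u ∈ Ioi (0 : ℝ), ENNReal.ofReal (u ^ (β - 1)) * heatK n u 0 =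
      ENNReal.ofReal ((4 * Real.pi) ^ (-((n : ℝ) / 2))) *
      ENNReal.ofReal (u ^ (β - 1 - (n : ℝ) / 2)) := fun u hu => by
    have hu0 : (0 : ℝ) < u := hu
    rw [heatK, ← ENNReal.ofReal_mul (by positivity), ← ENNReal.ofReal_mul (by positivity)]
    congr 1
    rw [sub_eq_add_neg (β - 1), Real.rpow_add hu0, Real.mul_rpow (by positivity) hu0.le]
    simp
    ring
  rw [setLIntegral_congr_fun measurableSet_Ioi h1, lintegral_const_mul _ (by fun_prop)]
  refine ENNReal.mul_eq_top.2 (Or.inl ⟨?_, ?_⟩)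
  · simp; positivity
  · by_contra hc
    refine not_integrableOn_Ioi_rpow (β - 1 - (n : ℝ) / 2) ⟨by fun_prop, ?_⟩
    rw [HasFiniteIntegral, setLIntegral_congr_fun (g := fun u =>
      ENNReal.ofReal (u ^ (β - 1 - (n : ℝ) / 2))) measurableSet_Ioi]
    · exact lt_top_iff_ne_top.2 hc
    · intro u hu
      exact Real.enorm_of_nonneg (Real.rpow_nonneg (le_of_lt hu) _)

/-- The multiplicative constant relating the heat mixture `mixK (kM β)` to the Riesz kernel. -/
def rieszC (n : ℕ) (β : ℝ) : ℝ≥0∞ :=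
  ENNReal.ofReal ((4 * Real.pi) ^ (-((n : ℝ) / 2)) *
    4 ^ ((n : ℝ) / 2 - β) * Real.Gamma (n / 2 - β))

lemma rieszC_ne_zero {β : ℝ} (hn : β < n / 2) : rieszC n β ≠ 0 := by
  have hG : 0 < Real.Gamma ((n : ℝ) / 2 - β) := Real.Gamma_pos_of_pos (by linarith)
  rw [rieszC, Ne, ENNReal.ofReal_eq_zero, not_le]
  positivity

lemma rieszC_ne_top {β : ℝ} : rieszC n β ≠ ⊤ := ENNReal.ofReal_ne_top

lemma mixK_kM_sub {β : ℝ} (hn : β < n / 2) (x y : Rn n) :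
    mixK (kM β) (x - y) = rieszC n β * rieszKernel n (2 * β) x y := by
  rw [rieszKernel, dist_eq_norm]
  rcases eq_or_ne (x - y) 0 with h | h
  · rw [h, mixK_kM_zero]
    simp only [norm_zero, ENNReal.ofReal_zero]
    rw [ENNReal.zero_rpow_of_neg (by linarith), ENNReal.mul_top (rieszC_ne_zero hn)]
  · rw [mixK_kM n hn h, rieszC]

lemma mixK_restrict_Ioi_le {β : ℝ} (hn : β < n / 2) {ε : ℝ≥0∞} (hε : ε ≠ 0) :
    ∃ T : ℝ, 0 < T ∧ ∀ x : Rn n, mixK ((kM β).restrict (Ioi T)) x ≤ ε := by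
  have key : ∀ T : ℝ, 0 < T → ∀ x : Rn n, mixK ((kM β).restrict (Ioi T)) x ≤
      ENNReal.ofReal ((4 * Real.pi) ^ (-((n : ℝ) / 2)) * (T ^ (-((n : ℝ) / 2 - β)) /
        ((n : ℝ) / 2 - β))) := fun T hT x => by
    have hlt : β - 1 - (n : ℝ) / 2 < -1 := by linarith
    rw [mixK, ← lintegral_indicator measurableSet_Ioi,
      lintegral_kM _ (Measurable.indicator (by fun_prop) measurableSet_Ioi)]
    calc _ ≤ ∫⁻ t in Ioi T, ENNReal.ofReal ((4 * Real.pi) ^ (-((n : ℝ) / 2))) *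
          ENNReal.ofReal (t ^ (β - 1 - (n : ℝ) / 2)) := by
          rw [← lintegral_indicator measurableSet_Ioi, ← lintegral_indicator measurableSet_Ioi]
          refine lintegral_mono fun t => ?_
          by_cases ht : t ∈ Ioi T
          · have ht0 : (0 : ℝ) < t := hT.trans ht
            rw [indicator_of_mem (mem_Ioi.2 ht0), indicator_of_mem ht, indicator_of_mem ht, heatK,
              ← ENNReal.ofReal_mul (by positivity), ← ENNReal.ofReal_mul (by positivity)]
            refine ENNReal.ofReal_le_ofReal ?_
            rw [sub_eq_add_neg (β - 1), Real.rpow_add ht0,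
              Real.mul_rpow (by positivity) ht0.le]
            have : Real.exp (-‖x‖ ^ 2 / (4 * t)) ≤ 1 := by
              rw [Real.exp_le_one_iff, div_nonpos_iff]
              exact Or.inr ⟨by simp, by positivity⟩
            calc _ ≤ t ^ (β - 1) * ((4 * Real.pi) ^ (-((n : ℝ) / 2)) * t ^ (-((n : ℝ) / 2)) * 1) := by
                  gcongr
              _ = _ := by ring
          · by_cases ht' : t ∈ Ioi (0 : ℝ) <;> simp [indicator, ht, ht']
      _ = _ := by
          rw [lintegral_const_mul _ (by fun_prop), ENNReal.ofReal_mul (by positivity)]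
          congr 1
          rw [← ofReal_integral_eq_lintegral_ofReal (integrableOn_Ioi_rpow_of_lt hlt hT),
            integral_Ioi_rpow_of_lt hlt hT]
          · congr 1
            rw [show β - 1 - (n : ℝ) / 2 + 1 = -((n : ℝ) / 2 - β) by ring, neg_div_neg_eq]
          · filter_upwards [ae_restrict_mem measurableSet_Ioi] with t ht
            exact Real.rpow_nonneg (hT.le.trans (le_of_lt ht)) _
  have hlim : Tendsto (fun T : ℝ => ENNReal.ofReal ((4 * Real.pi) ^ (-((n : ℝ) / 2)) *
      (T ^ (-((n : ℝ) / 2 - β)) / ((n : ℝ) / 2 - β)))) atTop (𝓝 0) := by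
    rw [← ENNReal.ofReal_zero]
    refine ENNReal.tendsto_ofReal ?_
    have := ((tendsto_rpow_neg_atTop (show 0 < (n : ℝ) / 2 - β by linarith)).div_const
      ((n : ℝ) / 2 - β)).const_mul ((4 * Real.pi) ^ (-((n : ℝ) / 2)))
    simpa using this
  obtain ⟨T, hT, hT0⟩ := ((hlim.eventually (ge_mem_nhds (pos_iff_ne_zero.2 hε))).and
    (eventually_gt_atTop 0)).exists
  exact ⟨T, hT0, fun x => (key T hT0 x).trans hT⟩

lemma mixK_vM_le {β r d θ : ℝ} (hn : β < n / 2) (hθ0 : 0 ≤ θ) (hθ1 : θ < 1)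
    (hd : 0 ≤ d) {x : Rn n} (hx : d ≤ ‖x‖) :
    mixK (vM β r) x ≤ ENNReal.ofReal (Real.exp (-(θ * d ^ 2) / (4 * r))) *
      ENNReal.ofReal (Real.sqrt (1 - θ)) ^ (2 * β - n) * mixK (kM β) x := by
  have hs : 0 < Real.sqrt (1 - θ) := Real.sqrt_pos.2 (by linarith)
  have h1 : mixK (kM β) (Real.sqrt (1 - θ) • x) =
      ENNReal.ofReal (Real.sqrt (1 - θ)) ^ (2 * β - n) * mixK (kM β) x := by
    rcases eq_or_ne x 0 with rfl | h0
    · rw [smul_zero, mixK_kM_zero, ENNReal.mul_top]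
      rw [ENNReal.ofReal_rpow_of_pos hs]
      simp
      positivity
    · rw [mixK_kM n hn h0, mixK_kM n hn (smul_ne_zero hs.ne' h0), norm_smul,
        Real.norm_of_nonneg hs.le, ENNReal.ofReal_mul hs.le,
        ENNReal.mul_rpow_of_ne_top ENNReal.ofReal_ne_top ENNReal.ofReal_ne_top]
      ring
  rw [mul_assoc, ← h1]
  calc mixK (vM β r) x ≤ ∫⁻ t, ENNReal.ofReal (Real.exp (-(θ * d ^ 2) / (4 * r))) *
        heatK n t (Real.sqrt (1 - θ) • x) ∂vM β r := by
        refine lintegral_mono_ae ?_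
        filter_upwards [vM_ae_mem β r] with t ht
        rw [heatK_eq_exp_mul hθ1]
        gcongr ENNReal.ofReal (Real.exp ?_) * _
        have ht0 := ht.1
        have hr := ht.1.trans_le ht.2
        rw [neg_div, neg_div, neg_le_neg_iff]
        have := ht.2
        gcongr
    _ = ENNReal.ofReal (Real.exp (-(θ * d ^ 2) / (4 * r))) *
        mixK (vM β r) (Real.sqrt (1 - θ) • x) := lintegral_const_mul _ (by fun_prop)
    _ ≤ _ := by
        gcongr
        exact lintegral_mono' (vM_le_kM β r) le_rfl

/-- Convolution of a function with the kernel `mixK ρ`. -/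
def mixF (ρ : Measure ℝ) (f : Rn n → ℝ≥0∞) (x : Rn n) : ℝ≥0∞ :=
  mixP ρ (volume.withDensity f) x

@[fun_prop]
lemma measurable_mixF (ρ : Measure ℝ) [SFinite ρ] (f : Rn n → ℝ≥0∞) : Measurable (mixF ρ f) :=
  measurable_mixP ρ _

lemma mixF_apply (ρ : Measure ℝ) [SFinite ρ] {f : Rn n → ℝ≥0∞} (hf : Measurable f) (x : Rn n) :
    mixF ρ f x = ∫⁻ y, mixK ρ (x - y) * f y := by
  rw [mixF, mixP, lintegral_withDensity_eq_lintegral_mul _ hf (by fun_prop)]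
  exact lintegral_congr fun y => mul_comm _ _

lemma mixF_mono (ρ : Measure ℝ) {f g : Rn n → ℝ≥0∞} (h : f ≤ g) (x : Rn n) :
    mixF ρ f x ≤ mixF ρ g x :=
  lintegral_mono' (withDensity_mono (ae_of_all _ h)) le_rfl

lemma mixF_add (ρ : Measure ℝ) {f g : Rn n → ℝ≥0∞} (hf : Measurable f) :
    mixF ρ (f + g) = mixF ρ f + mixF ρ g := by
  ext x
  rw [Pi.add_apply, mixF, mixP, withDensity_add_left hf, lintegral_add_measure]
  rfl

lemma mixF_const_mul (ρ : Measure ℝ) [SFinite ρ] {f : Rn n → ℝ≥0∞} (hf : Measurable f)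
    (c : ℝ≥0∞) : mixF ρ (fun x => c * f x) = fun x => c * mixF ρ f x := by
  ext x
  rw [mixF_apply _ (by fun_prop), mixF_apply _ hf, ← lintegral_const_mul _ (by fun_prop)]
  exact lintegral_congr fun y => by ring

lemma mixP_mono {ρ ρ' : Measure ℝ} (h : ρ ≤ ρ') (μ : Measure (Rn n)) (x : Rn n) :
    mixP ρ μ x ≤ mixP ρ' μ x :=
  lintegral_mono fun _ => lintegral_mono' h le_rfl

lemma lintegral_mixP_mul (ρ : Measure ℝ) [SFinite ρ] (μ : Measure (Rn n)) [SFinite μ]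
    {f : Rn n → ℝ≥0∞} (hf : Measurable f) :
    ∫⁻ x, mixP ρ μ x * f x = ∫⁻ x, mixF ρ f x ∂μ := by
  unfold mixF
  rw [← lintegral_mixP_comm, lintegral_withDensity_eq_lintegral_mul _ hf (by fun_prop)]
  exact lintegral_congr fun y => mul_comm _ _

lemma lintegral_mixF_mul_comm (ρ : Measure ℝ) [SFinite ρ] {f g : Rn n → ℝ≥0∞}
    (hf : Measurable f) (hg : Measurable g) :
    ∫⁻ x, f x * mixF ρ g x = ∫⁻ x, mixF ρ f x * g x := by
  change _ = ∫⁻ x, mixP ρ (volume.withDensity f) x * g x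
  rw [lintegral_mixP_mul _ _ hg, lintegral_withDensity_eq_lintegral_mul _ hf (by fun_prop)]
  rfl

/-- The convolution powers `ν^{∗(j+1)}`. -/
def convPow (ν : Measure ℝ) : ℕ → Measure ℝ
  | 0 => ν
  | j + 1 => ν.conv (convPow ν j)

instance sFinite_convPow (ν : Measure ℝ) [SFinite ν] (j : ℕ) : SFinite (convPow ν j) := by
  induction j with
  | zero => assumption
  | succ j ih => unfold convPow; infer_instance

lemma ae_pos_conv {ρ ρ' : Measure ℝ} [SFinite ρ] [SFinite ρ'] (h : ∀ᵐ t ∂ρ, 0 < t)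
    (h' : ∀ᵐ t ∂ρ', 0 < t) : ∀ᵐ t ∂ρ.conv ρ', 0 < t := by
  have hm : Measurable (indicator (Iic (0 : ℝ)) (1 : ℝ → ℝ≥0∞)) :=
    measurable_const.indicator measurableSet_Iic
  have h0 : (ρ.conv ρ') (Iic 0) = 0 := by
    rw [← lintegral_indicator_one measurableSet_Iic, Measure.lintegral_conv hm,
      lintegral_eq_zero_iff']
    · filter_upwards [h] with s hs
      rw [Pi.zero_apply, lintegral_eq_zero_iff' (by fun_prop)]
      filter_upwards [h'] with t ht
      exact indicator_of_notMem (by simpa using add_pos hs ht) _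
    · exact (Measurable.lintegral_prod_right' (f := fun p : ℝ × ℝ => indicator (Iic 0) 1
        (p.1 + p.2)) (by fun_prop)).aemeasurable
  rw [ae_iff]
  simpa [Iic_def] using h0

lemma ae_pos_convPow {ν : Measure ℝ} [SFinite ν] (h : ∀ᵐ t ∂ν, 0 < t) (j : ℕ) :
    ∀ᵐ t ∂convPow ν j, 0 < t := by
  induction j with
  | zero => exact h
  | succ j ih => exact ae_pos_conv h ih

lemma ae_pos_sum {ν : ℕ → Measure ℝ} (h : ∀ j, ∀ᵐ t ∂ν j, 0 < t) :
    ∀ᵐ t ∂Measure.sum ν, 0 < t := Measure.ae_sum_iff.2 h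

lemma mixF_mixF {ρ ρ' : Measure ℝ} [SFinite ρ] [SFinite ρ'] (hρ : ∀ᵐ t ∂ρ, 0 < t)
    (hρ' : ∀ᵐ t ∂ρ', 0 < t) (f : Rn n → ℝ≥0∞) :
    mixF ρ (mixF ρ' f) = mixF (ρ.conv ρ') f :=
  funext fun x => mixP_mixP ρ ρ' hρ hρ' _ x

lemma mixF_convPow {ν : Measure ℝ} [SFinite ν] (h : ∀ᵐ t ∂ν, 0 < t) (j : ℕ)
    (f : Rn n → ℝ≥0∞) : mixF (convPow ν j) f = (mixF ν)^[j + 1] f := by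
  induction j with
  | zero => rfl
  | succ j ih =>
    rw [Function.iterate_succ_apply', ← ih, mixF_mixF h (ae_pos_convPow h j)]
    rfl

/-- The sum of all iterates of the operator `mixF ν`. -/
def potW (ν : Measure ℝ) (f : Rn n → ℝ≥0∞) : Rn n → ℝ≥0∞ :=
  f + mixF (Measure.sum (convPow ν)) f

@[fun_prop]
lemma measurable_potW (ν : Measure ℝ) [SFinite ν] {f : Rn n → ℝ≥0∞} (hf : Measurable f) :
    Measurable (potW ν f) := by unfold potW; fun_prop

lemma potW_apply {ν : Measure ℝ} [SFinite ν] (h : ∀ᵐ t ∂ν, 0 < t) (f : Rn n → ℝ≥0∞)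
    (x : Rn n) : potW ν f x = ∑' j, (mixF ν)^[j] f x := by
  rw [tsum_eq_zero_add' ENNReal.summable, potW, Pi.add_apply, Function.iterate_zero_apply]
  congr 1
  simp_rw [← mixF_convPow h]
  unfold mixF mixP mixK
  simp_rw [lintegral_sum_measure]
  exact lintegral_tsum fun j => (show Measurable fun y => mixK (convPow ν j) (x - y) by
    fun_prop).aemeasurable

lemma potW_add (ν : Measure ℝ) {f g : Rn n → ℝ≥0∞} (hf : Measurable f) :
    potW ν (f + g) = potW ν f + potW ν g := by
  rw [potW, mixF_add _ hf, potW, potW]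
  abel

lemma potW_const_mul (ν : Measure ℝ) [SFinite ν] {f : Rn n → ℝ≥0∞} (hf : Measurable f)
    (c : ℝ≥0∞) : potW ν (fun x => c * f x) = fun x => c * potW ν f x := by
  ext x
  simp only [potW, Pi.add_apply, mixF_const_mul _ hf, mul_add]

lemma lintegral_potW_mul_comm (ν : Measure ℝ) [SFinite ν] {f g : Rn n → ℝ≥0∞}
    (hf : Measurable f) (hg : Measurable g) :
    ∫⁻ x, f x * potW ν g x = ∫⁻ x, potW ν f x * g x := by
  simp only [potW, Pi.add_apply, mul_add, add_mul]
  rw [lintegral_add_left (by fun_prop), lintegral_add_left (by fun_prop),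
    lintegral_mixF_mul_comm _ hf hg]

lemma two_mul_lintegral_potW_le {ν : Measure ℝ} [SFinite ν] (h : ∀ᵐ t ∂ν, 0 < t)
    {f g : Rn n → ℝ≥0∞} (hf : Measurable f) (hg : Measurable g) :
    2 * ∫⁻ x, f x * potW ν g x ≤ (∫⁻ x, f x * potW ν f x) + ∫⁻ x, g x * potW ν g x := by
  have h1 := two_mul_lintegral_mixP_le (Measure.sum (convPow ν))
    (ae_pos_sum (ae_pos_convPow h)) (volume.withDensity g) (volume.withDensity f)
  have h2 : ∀ {f g : Rn n → ℝ≥0∞}, Measurable f → ∫⁻ x,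
      mixP (Measure.sum (convPow ν)) (volume.withDensity g) x ∂(volume.withDensity f) =
      ∫⁻ x, f x * mixF (Measure.sum (convPow ν)) g x := fun hf => by
    rw [lintegral_withDensity_eq_lintegral_mul _ hf (by fun_prop)]
    rfl
  rw [h2 hf, h2 hg, h2 hf] at h1
  simp only [potW, Pi.add_apply, mul_add]
  rw [lintegral_add_left (by fun_prop), lintegral_add_left (by fun_prop),
    lintegral_add_left (by fun_prop), mul_add]
  have h3 : 2 * ∫⁻ x, f x * g x ≤ (∫⁻ x, f x * f x) + ∫⁻ x, g x * g x := by
    rw [← lintegral_const_mul _ (by fun_prop), ← lintegral_add_left (by fun_prop)]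
    exact lintegral_mono fun x => two_mul_le_add_sq_ennreal _ _
  refine (add_le_add h3 h1).trans_eq ?_
  rw [add_comm (∫⁻ x, g x * mixF _ g x), add_add_add_comm]

lemma sum_iterate_add {ν : Measure ℝ} [SFinite ν] {f σ : Rn n → ℝ≥0∞} (hσ : Measurable σ)
    (hf : f = σ + mixF ν f) (J : ℕ) (x : Rn n) :
    ∑ j ∈ Finset.range J, (mixF ν)^[j] σ x + (mixF ν)^[J] f x = f x := by
  have hadd : ∀ J, (mixF ν)^[J] f = (mixF ν)^[J] σ + (mixF ν)^[J + 1] f := by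
    intro J
    induction J with
    | zero => exact hf
    | succ J ih =>
      have hm : Measurable ((mixF ν)^[J] σ) := by
        cases J with
        | zero => exact hσ
        | succ J => rw [Function.iterate_succ_apply']; fun_prop
      calc (mixF ν)^[J + 1] f = mixF ν ((mixF ν)^[J] f) := Function.iterate_succ_apply' _ _ _
        _ = mixF ν ((mixF ν)^[J] σ + (mixF ν)^[J + 1] f) := by rw [← ih]
        _ = mixF ν ((mixF ν)^[J] σ) + mixF ν ((mixF ν)^[J + 1] f) := mixF_add _ hm
        _ = _ := by rw [← Function.iterate_succ_apply' (mixF ν) J σ,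
            ← Function.iterate_succ_apply' (mixF ν) (J + 1) f]
  induction J with
  | zero => simp
  | succ J ih =>
    rw [Finset.sum_range_succ, add_assoc, ← Pi.add_apply, ← hadd, ih]

lemma potW_le {ν : Measure ℝ} [SFinite ν] (h : ∀ᵐ t ∂ν, 0 < t) {f σ : Rn n → ℝ≥0∞}
    (hσ : Measurable σ) (hf : f = σ + mixF ν f) (x : Rn n) : potW ν σ x ≤ f x := by
  rw [potW_apply h]
  refine ENNReal.tsum_le_of_sum_range_le fun J => ?_
  rw [← sum_iterate_add hσ hf J x]
  exact le_self_add

lemma potW_eq {ν : Measure ℝ} [SFinite ν] (h : ∀ᵐ t ∂ν, 0 < t) {f σ : Rn n → ℝ≥0∞}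
    (hσ : Measurable σ) (hf : f = σ + mixF ν f) {x : Rn n}
    (hx : Tendsto (fun J => (mixF ν)^[J] f x) atTop (𝓝 0)) : potW ν σ x = f x := by
  rw [potW_apply h]
  have h1 := (ENNReal.tendsto_nat_tsum fun j => (mixF ν)^[j] σ x).add hx
  simp_rw [sum_iterate_add hσ hf, add_zero] at h1
  exact tendsto_nhds_unique h1 tendsto_const_nhds

lemma continuous_heatK (n : ℕ) (t : ℝ) : Continuous (heatK n t) := by
  unfold heatK
  exact ENNReal.continuous_ofReal.comp (by fun_prop)

lemma lowerSemicontinuous_lintegral {α β : Type*} [TopologicalSpace α] [FirstCountableTopology α]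
    [MeasurableSpace β] {m : Measure β} {g : α → β → ℝ≥0∞} (hm : ∀ x, Measurable (g x))
    (hg : ∀ y, LowerSemicontinuous fun x => g x y) :
    LowerSemicontinuous fun x => ∫⁻ y, g x y ∂m :=
  lowerSemicontinuous_iff_le_liminf.2 fun x =>
    (lintegral_mono fun y => (hg y).le_liminf x).trans (lintegral_liminf_le hm)

lemma lowerSemicontinuous_mixK (ρ : Measure ℝ) : LowerSemicontinuous (mixK (n := n) ρ) :=
  lowerSemicontinuous_lintegral (fun _ => by fun_prop)
    fun t => (continuous_heatK n t).lowerSemicontinuous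

lemma lowerSemicontinuous_mixP (ρ : Measure ℝ) [SFinite ρ] (μ : Measure (Rn n)) :
    LowerSemicontinuous (mixP ρ μ) :=
  lowerSemicontinuous_lintegral (fun _ => by fun_prop)
    fun y => (lowerSemicontinuous_mixK ρ).comp (by fun_prop)

lemma mixP_add_measure (ρ ρ' : Measure ℝ) [SFinite ρ] (μ : Measure (Rn n)) (x : Rn n) :
    mixP (ρ + ρ') μ x = mixP ρ μ x + mixP ρ' μ x := by
  unfold mixP mixK
  simp_rw [lintegral_add_measure]
  exact lintegral_add_left (show Measurable fun y => mixK ρ (x - y) by fun_prop) _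

lemma mixF_mixP {ρ ρ' : Measure ℝ} [SFinite ρ] [SFinite ρ'] (hρ : ∀ᵐ t ∂ρ, 0 < t)
    (hρ' : ∀ᵐ t ∂ρ', 0 < t) (μ : Measure (Rn n)) [SFinite μ] :
    mixF ρ (mixP ρ' μ) = mixP (ρ.conv ρ') μ :=
  funext fun x => mixP_mixP ρ ρ' hρ hρ' _ x

lemma nuM_ae_pos (β : ℝ) {r : ℝ} (hr : 0 < r) : ∀ᵐ s ∂nuM β r, 0 < s :=
  (nuM_ae_ge β r).mono fun _ h => hr.trans_le h

lemma kM_eq_add (β : ℝ) {r : ℝ} (hr : 0 < r) : kM β = vM β r + (kM β).restrict (Ioi r) := by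
  rw [vM, ← Measure.restrict_union (by
      rw [Set.disjoint_left]; exact fun x h h' => not_lt.2 h.2 h') measurableSet_Ioi,
    Ioc_union_Ioi_eq_Ioi hr.le]
  exact (Measure.restrict_eq_self_of_ae_mem (kM_ae_pos β)).symm

lemma mixP_kM_eq {β r : ℝ} (hβ0 : 0 < β) (hβ1 : β ≤ 1) (hr : 0 < r) (μ : Measure (Rn n))
    [SFinite μ] : mixP (kM β) μ = mixP (vM β r) μ + mixF (nuM β r) (mixP (kM β) μ) := by
  rw [mixF_mixP (nuM_ae_pos β hr) (kM_ae_pos β), nuM_conv_kM hβ0 hβ1 hr]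
  ext x
  rw [Pi.add_apply, ← mixP_add_measure, ← kM_eq_add β hr]

lemma nuM_conv_restrict_le {β r : ℝ} (hβ0 : 0 < β) (hβ1 : β ≤ 1) (hr : 0 < r) (a : ℝ) :
    (nuM β r).conv ((kM β).restrict (Ioi a)) ≤ (kM β).restrict (Ioi (r + a)) := by
  have hle : (nuM β r).conv ((kM β).restrict (Ioi a)) ≤ kM β := by
    calc (nuM β r).conv ((kM β).restrict (Ioi a)) ≤ (nuM β r).conv (kM β) :=
          Measure.map_mono (Measure.prod_mono le_rfl Measure.restrict_le_self) (by fun_prop)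
      _ = (kM β).restrict (Ioi r) := nuM_conv_kM hβ0 hβ1 hr
      _ ≤ kM β := Measure.restrict_le_self
  have hae : ∀ᵐ t ∂(nuM β r).conv ((kM β).restrict (Ioi a)), t ∈ Ioi (r + a) := by
    have hm : Measurable (indicator (Iic (r + a)) (1 : ℝ → ℝ≥0∞)) :=
      measurable_const.indicator measurableSet_Iic
    have h0 : ((nuM β r).conv ((kM β).restrict (Ioi a))) (Iic (r + a)) = 0 := by
      rw [← lintegral_indicator_one measurableSet_Iic, Measure.lintegral_conv hm,
        lintegral_eq_zero_iff']
      · filter_upwards [nuM_ae_ge β r] with s hs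
        rw [Pi.zero_apply, lintegral_eq_zero_iff' (by fun_prop)]
        filter_upwards [ae_restrict_mem measurableSet_Ioi] with t ht
        refine indicator_of_notMem ?_ _
        simp only [mem_Iic, not_le]
        exact add_lt_add_of_le_of_lt hs ht
      · exact (Measurable.lintegral_prod_right' (f := fun p : ℝ × ℝ => indicator (Iic (r + a)) 1
          (p.1 + p.2)) (by fun_prop)).aemeasurable
    rw [ae_iff]
    simpa [Iic_def] using h0
  rw [← Measure.restrict_eq_self_of_ae_mem hae]
  exact Measure.restrict_mono le_rfl hle

lemma iterate_mixF_kM_le {β r : ℝ} (hβ0 : 0 < β) (hβ1 : β ≤ 1) (hr : 0 < r)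
    (μ : Measure (Rn n)) [SFinite μ] {h : Rn n → ℝ≥0∞} (hh : h ≤ mixP (kM β) μ) (J : ℕ) :
    (mixF (nuM β r))^[J] h ≤ mixP ((kM β).restrict (Ioi (J * r))) μ := by
  induction J with
  | zero =>
    refine hh.trans_eq ?_
    rw [Nat.cast_zero, zero_mul, Measure.restrict_eq_self_of_ae_mem (s := Ioi 0) (kM_ae_pos β)]
  | succ J ih =>
    rw [Function.iterate_succ_apply']
    intro x
    refine (mixF_mono _ ih x).trans ?_
    rw [mixF_mixP (nuM_ae_pos β hr) (ae_restrict_of_ae (kM_ae_pos β))]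
    refine mixP_mono ?_ μ x
    convert nuM_conv_restrict_le hβ0 hβ1 hr (J * r) using 3
    push_cast
    ring

lemma tendsto_mixP_kM_restrict {β r : ℝ} (hr : 0 < r) (μ : Measure (Rn n)) [SFinite μ]
    {x : Rn n} (hx : mixP (kM β) μ x ≠ ⊤) :
    Tendsto (fun J : ℕ => mixP ((kM β).restrict (Ioi (J * r))) μ x) atTop (𝓝 0) := by
  simp_rw [mixP_eq_lintegral_heatP] at hx ⊢
  have h1 := tendsto_measure_iInter_atTop (μ := (kM β).withDensity fun t => heatP t μ x)
    (s := fun J : ℕ => Ioi (J * r)) (fun J => measurableSet_Ioi.nullMeasurableSet)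
    (fun i j hij => Ioi_subset_Ioi (by gcongr))
    ⟨0, by
      rw [withDensity_apply _ measurableSet_Ioi]
      exact ((setLIntegral_le_lintegral _ _).trans_lt hx.lt_top).ne⟩
  have h2 : ⋂ J : ℕ, Ioi ((J : ℝ) * r) = ∅ := by
    refine eq_empty_of_forall_notMem fun t ht => ?_
    obtain ⟨J, hJ⟩ := exists_nat_ge (t / r)
    exact absurd (mem_iInter.1 ht J) (not_lt.2 ((div_le_iff₀ hr).1 hJ))
  rw [h2, measure_empty] at h1
  refine h1.congr fun J => ?_
  exact withDensity_apply _ measurableSet_Ioi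

lemma mixK_vM_pos (β : ℝ) {r : ℝ} (hr : 0 < r) (x : Rn n) : 0 < mixK (vM β r) x := by
  rw [pos_iff_ne_zero, mixK, Ne, lintegral_eq_zero_iff (by fun_prop)]
  intro h
  have h2 : ∀ᵐ t ∂vM β r, False := by
    filter_upwards [h, vM_ae_pos β r] with t ht h0
    simp only [Pi.zero_apply, heatK, ENNReal.ofReal_eq_zero] at ht
    exact absurd ht (not_le.2 (by positivity))
  rw [ae_iff] at h2
  exact vM_univ_ne_zero hr (by simpa using h2)

lemma lintegral_mixP_vM_mul (β r : ℝ) (μ ψ : Measure (Rn n)) [SFinite μ] [SFinite ψ] :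
    ∫⁻ x, mixP (vM β r) μ x * mixP (kM β) ψ x = ∫⁻ x, mixP ((vM β r).conv (kM β)) ψ x ∂μ := by
  rw [lintegral_mixP_mul _ _ (by fun_prop), mixF_mixP (vM_ae_pos β r) (kM_ae_pos β)]

lemma vM_conv_ae_pos (β r : ℝ) : ∀ᵐ t ∂(vM β r).conv (kM β), 0 < t :=
  ae_pos_conv (vM_ae_pos β r) (kM_ae_pos β)

lemma lintegral_mixP_vM_conv_le {β : ℝ} (hβ0 : 0 < β) (hβ1 : β ≤ 1) (r : ℝ)
    (μ : Measure (Rn n)) [SFinite μ] (x : Rn n) :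
    mixP ((vM β r).conv (kM β)) μ x ≤ 4 * vM β r univ * mixP (kM β) μ x := by
  simp_rw [mixP_eq_lintegral_heatP]
  exact lintegral_conv_vM_le hβ0 hβ1 r (by fun_prop)

lemma lintegral_mixP_vM_conv_ne_top {β : ℝ} (hβ0 : 0 < β) (hβ1 : β ≤ 1) (r : ℝ)
    {μ ψ : Measure (Rn n)} [SFinite μ] (h : ∫⁻ x, mixP (kM β) μ x ∂ψ ≠ ⊤) :
    ∫⁻ x, mixP ((vM β r).conv (kM β)) μ x ∂ψ ≠ ⊤ := by
  refine ne_top_of_le_ne_top ?_ (lintegral_mono (lintegral_mixP_vM_conv_le hβ0 hβ1 r μ))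
  rw [lintegral_const_mul _ (by fun_prop)]
  exact ENNReal.mul_ne_top (ENNReal.mul_ne_top (by simp) (vM_univ_lt_top hβ0 r).ne) h

lemma mixP_vM_ne_zero (β : ℝ) {r : ℝ} (hr : 0 < r) {μ : Measure (Rn n)} [SFinite μ]
    (hμ : μ ≠ 0) (x : Rn n) : mixP (vM β r) μ x ≠ 0 := by
  rw [mixP, Ne, lintegral_eq_zero_iff (by fun_prop)]
  intro h
  have h2 : ∀ᵐ t ∂μ, False := by
    filter_upwards [h] with y hy
    exact (mixK_vM_pos β hr (x - y)).ne' hy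
  rw [ae_iff] at h2
  exact hμ (by simpa using h2)

/-- Integrated form of the domination principle at scale `r`. -/
lemma lintegral_mixF_inf_le {β r : ℝ} (hβ0 : 0 < β) (hβ1 : β ≤ 1) (hr : 0 < r)
    {μ ψ : Measure (Rn n)} [SFinite μ] [SFinite ψ]
    (hμ : ∫⁻ x, mixP (kM β) μ x ∂μ ≠ ⊤) (hψ : ∫⁻ x, mixP (kM β) ψ x ∂ψ ≠ ⊤)
    {v : Rn n → ℝ≥0∞} (hv : Measurable v) (hvN : mixF (nuM β r) v ≤ v) (e : ℝ≥0∞) :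
    (∫⁻ x, mixF (vM β r) (mixP (kM β) μ ⊓ v) x ∂μ) +
        2 * e * ∫⁻ x, mixP ((vM β r).conv (kM β)) μ x ∂ψ ≤
      (∫⁻ x, mixP ((vM β r).conv (kM β)) μ x ∂μ) +
        2 * e * (∫⁻ x, mixF (vM β r) (mixP (kM β) μ ⊓ v) x ∂ψ) +
        e ^ 2 * ∫⁻ x, mixP ((vM β r).conv (kM β)) ψ x ∂ψ := by
  set U := mixP (kM β) μ with hU
  set P := mixP (kM β) ψ with hP
  set g := mixP (vM β r) μ with hg
  set φ := mixP (vM β r) ψ with hφ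
  set h := U ⊓ v with hh
  set N := mixF (n := n) (nuM β r) with hN
  have hUm : Measurable U := measurable_mixP _ _
  have hPm : Measurable P := measurable_mixP _ _
  have hgm : Measurable g := measurable_mixP _ _
  have hφm : Measurable φ := measurable_mixP _ _
  have hhm : Measurable h := hUm.inf hv
  rcases eq_or_ne μ 0 with rfl | hμ0
  · have : ∀ x, mixP ((vM β r).conv (kM β)) (0 : Measure (Rn n)) x = 0 := fun x => by simp [mixP]
    simp [this]
  have hpos := nuM_ae_pos β hr
  have hUeq : U = g + N U := mixP_kM_eq hβ0 hβ1 hr μ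
  have hPeq : P = φ + N P := mixP_kM_eq hβ0 hβ1 hr ψ
  have hNh : N h ≤ h := fun x => le_inf
    ((mixF_mono _ inf_le_left x).trans ((congrFun hUeq x).ge.trans' le_add_self))
    ((mixF_mono _ inf_le_right x).trans (hvN x))
  set σ : Rn n → ℝ≥0∞ := fun x => h x - N h x with hσ
  have hσm : Measurable σ := hhm.sub (measurable_mixF _ _)
  have hσeq : h = σ + N h := funext fun x => (tsub_add_cancel_of_le (hNh x)).symm
  have hgU : ∫⁻ x, g x * U x = ∫⁻ x, mixP ((vM β r).conv (kM β)) μ x ∂μ :=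
    lintegral_mixP_vM_mul β r μ μ
  have hgUfin : ∫⁻ x, g x * U x ≠ ⊤ := hgU ▸ lintegral_mixP_vM_conv_ne_top hβ0 hβ1 r hμ
  have hφP : ∫⁻ x, φ x * P x = ∫⁻ x, mixP ((vM β r).conv (kM β)) ψ x ∂ψ :=
    lintegral_mixP_vM_mul β r ψ ψ
  have hgP : ∫⁻ x, g x * P x = ∫⁻ x, mixP ((vM β r).conv (kM β)) μ x ∂ψ := by
    rw [hg, hP, lintegral_mixP_vM_mul, lintegral_mixP_comm]
  have hgPfin : ∫⁻ x, g x * P x ≠ ⊤ := by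
    have := two_mul_lintegral_mixP_le _ (vM_conv_ae_pos β r) μ ψ
    rw [hgP]
    refine (lt_of_le_of_lt (le_mul_of_one_le_left' one_le_two) (this.trans_lt ?_)).ne
    exact ENNReal.add_lt_top.2 ⟨(lintegral_mixP_vM_conv_ne_top hβ0 hβ1 r hμ).lt_top,
      (lintegral_mixP_vM_conv_ne_top hβ0 hβ1 r hψ).lt_top⟩
  have hg0 : ∀ x, g x ≠ 0 := mixP_vM_ne_zero β hr hμ0
  have hUfin : ∀ᵐ x, U x ≠ ⊤ := by
    filter_upwards [ae_lt_top (by fun_prop) hgUfin] with x hx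
    rintro h'
    rw [h', ENNReal.mul_top (hg0 x)] at hx
    exact lt_irrefl _ hx
  have hPfin : ∀ᵐ x, P x ≠ ⊤ := by
    filter_upwards [ae_lt_top (by fun_prop) hgPfin] with x hx
    rintro h'
    rw [h', ENNReal.mul_top (hg0 x)] at hx
    exact lt_irrefl _ hx
  have hit : ∀ {ψ : Measure (Rn n)} [SFinite ψ] {f : Rn n → ℝ≥0∞}, f ≤ mixP (kM β) ψ → ∀ x,
      mixP (kM β) ψ x ≠ ⊤ → Tendsto (fun J => N^[J] f x) atTop (𝓝 0) := fun hf x hx =>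
    tendsto_of_tendsto_of_tendsto_of_le_of_le tendsto_const_nhds
      (tendsto_mixP_kM_restrict hr _ hx) (fun _ => zero_le)
      (fun J => iterate_mixF_kM_le hβ0 hβ1 hr _ hf J x)
  have hWg : ∀ᵐ x, potW (nuM β r) g x = U x :=
    hUfin.mono fun x hx => potW_eq hpos hgm hUeq (hit le_rfl x hx)
  have hWσ : ∀ᵐ x, potW (nuM β r) σ x = h x :=
    hUfin.mono fun x hx => potW_eq hpos hσm hσeq (hit inf_le_left x hx)
  have hWφ : ∀ᵐ x, potW (nuM β r) φ x = P x :=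
    hPfin.mono fun x hx => potW_eq hpos hφm hPeq (hit le_rfl x hx)
  have hgσ : ∫⁻ x, g x * potW (nuM β r) σ x = ∫⁻ x, g x * h x :=
    lintegral_congr_ae (hWσ.mono fun x hx => by simp only [hx])
  have hgh : ∫⁻ x, g x * h x = ∫⁻ x, mixF (vM β r) h x ∂μ := lintegral_mixP_mul _ _ hhm
  have hφh : ∫⁻ x, φ x * h x = ∫⁻ x, mixF (vM β r) h x ∂ψ := lintegral_mixP_mul _ _ hhm
  have hghfin : ∫⁻ x, g x * h x ≠ ⊤ :=
    ne_top_of_le_ne_top hgUfin (lintegral_mono fun x => mul_le_mul_right inf_le_left _)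
  have hσσ : ∫⁻ x, σ x * potW (nuM β r) σ x ≤ ∫⁻ x, g x * h x :=
    calc ∫⁻ x, σ x * potW (nuM β r) σ x ≤ ∫⁻ x, σ x * U x :=
          lintegral_mono fun x => mul_le_mul_right ((potW_le hpos hσm hσeq x).trans inf_le_left) _
      _ = ∫⁻ x, σ x * potW (nuM β r) g x :=
          lintegral_congr_ae (hWg.mono fun x hx => by simp only [hx])
      _ = ∫⁻ x, g x * potW (nuM β r) σ x := by
          rw [lintegral_potW_mul_comm _ hσm hgm]; simp_rw [mul_comm]
      _ = _ := hgσ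
  have hσφ : ∫⁻ x, σ x * potW (nuM β r) φ x = ∫⁻ x, φ x * h x := by
    rw [lintegral_potW_mul_comm _ hσm hφm]
    exact lintegral_congr_ae (hWσ.mono fun x hx => by simp only [hx, mul_comm])
  have hφσ : ∫⁻ x, φ x * potW (nuM β r) σ x = ∫⁻ x, φ x * h x :=
    lintegral_congr_ae (hWσ.mono fun x hx => by simp only [hx])
  have hPD := two_mul_lintegral_potW_le hpos hgm
    (show Measurable (σ + fun x => e * φ x) by fun_prop)
  have e1 : ∫⁻ x, g x * potW (nuM β r) (σ + fun x => e * φ x) x =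
      (∫⁻ x, g x * h x) + e * ∫⁻ x, g x * P x := by
    rw [potW_add _ hσm, potW_const_mul _ hφm]
    simp only [Pi.add_apply, mul_add]
    rw [lintegral_add_left (by fun_prop), hgσ, ← lintegral_const_mul _ (by fun_prop)]
    congr 1
    exact lintegral_congr_ae (hWφ.mono fun x hx => by simp only [hx]; ring)
  have e2 : ∫⁻ x, g x * potW (nuM β r) g x = ∫⁻ x, g x * U x :=
    lintegral_congr_ae (hWg.mono fun x hx => by simp only [hx])
  have e3 : ∫⁻ x, (σ + fun x => e * φ x) x * potW (nuM β r) (σ + fun x => e * φ x) x ≤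
      (∫⁻ x, g x * h x) + 2 * e * (∫⁻ x, φ x * h x) + e ^ 2 * ∫⁻ x, φ x * P x := by
    rw [potW_add _ hσm, potW_const_mul _ hφm]
    have : ∀ x, (σ + fun x => e * φ x) x * (potW (nuM β r) σ + fun x =>
        e * potW (nuM β r) φ x) x = σ x * potW (nuM β r) σ x + (e * (σ x * potW (nuM β r) φ x) +
        (e * (φ x * potW (nuM β r) σ x) + e ^ 2 * (φ x * potW (nuM β r) φ x))) := fun x => by
      simp only [Pi.add_apply]
      ring
    simp_rw [this]
    rw [lintegral_add_left (by fun_prop), lintegral_add_left (by fun_prop),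
      lintegral_add_left (by fun_prop), lintegral_const_mul _ (by fun_prop),
      lintegral_const_mul _ (by fun_prop), lintegral_const_mul _ (by fun_prop), hσφ, hφσ]
    have : ∫⁻ x, φ x * potW (nuM β r) φ x = ∫⁻ x, φ x * P x :=
      lintegral_congr_ae (hWφ.mono fun x hx => by simp only [hx])
    rw [this]
    refine (add_le_add_left hσσ _).trans_eq ?_
    ring
  rw [e1, e2] at hPD
  have hPD' := hPD.trans (add_le_add_right e3 _)
  rw [← hgh, ← hφh, ← hgU, ← hgP, ← hφP]
  refine (ENNReal.add_le_add_iff_left hghfin).1 ?_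
  refine (le_of_eq ?_).trans (hPD'.trans_eq ?_) <;> ring

/-- A sequence of scales decreasing to zero. -/
def scale (j : ℕ) : ℝ := 1 / ((j : ℝ) + 1)

lemma scale_pos (j : ℕ) : 0 < scale j := Nat.one_div_pos_of_nat

lemma tendsto_scale : Tendsto scale atTop (𝓝[>] 0) :=
  tendsto_nhdsWithin_iff.2
    ⟨tendsto_one_div_add_atTop_nhds_zero_nat, Eventually.of_forall scale_pos⟩

/-- The average of `f` against the normalised mixture `vM β r`. -/
def avgF (β r : ℝ) (f : Rn n → ℝ≥0∞) (x : Rn n) : ℝ≥0∞ :=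
  (vM β r univ)⁻¹ * mixF (vM β r) f x

lemma tendsto_exp_tail {δ : ℝ} (hδ : 0 < δ) :
    Tendsto (fun r : ℝ => ENNReal.ofReal (Real.exp (-δ ^ 2 / (8 * r)) * 2 ^ ((n : ℝ) / 2)))
      (𝓝[>] 0) (𝓝 0) := by
  have h : Tendsto (fun r : ℝ => -δ ^ 2 / (8 * r)) (𝓝[>] 0) atBot := by
    have h1 : (fun r : ℝ => -δ ^ 2 / (8 * r)) = fun r => (-δ ^ 2 / 8) * r⁻¹ := by
      ext r
      rw [div_mul_eq_div_div, div_eq_mul_inv _ r]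
    rw [h1]
    exact tendsto_inv_nhdsGT_zero.const_mul_atTop_of_neg (by nlinarith [pow_pos hδ 2])
  have h2 := (Real.tendsto_exp_atBot.comp h).mul_const ((2 : ℝ) ^ ((n : ℝ) / 2))
  rw [zero_mul] at h2
  simpa using ENNReal.tendsto_ofReal h2

lemma lintegral_heatK_sub {t : ℝ} (ht : 0 < t) (x : Rn n) : ∫⁻ y, heatK n t (x - y) = 1 := by
  rw [lintegral_sub_left_eq_self (heatK n t) x, lintegral_heatK n ht]

lemma le_lintegral_heatK_ball {t r δ : ℝ} (ht : 0 < t) (htr : t ≤ r) (hδ : 0 < δ) (x : Rn n) :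
    1 - ENNReal.ofReal (Real.exp (-δ ^ 2 / (8 * r)) * 2 ^ ((n : ℝ) / 2)) ≤
      ∫⁻ y in Metric.ball x δ, heatK n t (x - y) := by
  rw [tsub_le_iff_right, ← lintegral_heatK_sub ht x,
    ← lintegral_add_compl _ (Metric.isOpen_ball (x := x) (ε := δ)).measurableSet]
  gcongr
  calc ∫⁻ y in (Metric.ball x δ)ᶜ, heatK n t (x - y) ≤
      ∫⁻ y in (Metric.ball x δ)ᶜ,
        ENNReal.ofReal (Real.exp (-δ ^ 2 / (8 * t)) * 2 ^ ((n : ℝ) / 2)) *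
          heatK n (2 * t) (x - y) := by
        refine setLIntegral_mono' Metric.isOpen_ball.measurableSet.compl fun y hy => ?_
        refine heatK_le_tail ht hδ.le ?_
        rw [← dist_eq_norm, dist_comm]
        simpa using hy
    _ ≤ ENNReal.ofReal (Real.exp (-δ ^ 2 / (8 * t)) * 2 ^ ((n : ℝ) / 2)) := by
        refine (setLIntegral_le_lintegral _ _).trans ?_
        rw [lintegral_const_mul _ (by fun_prop), lintegral_heatK_sub (by positivity), mul_one]
    _ ≤ ENNReal.ofReal (Real.exp (-δ ^ 2 / (8 * r)) * 2 ^ ((n : ℝ) / 2)) := by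
        gcongr ENNReal.ofReal (Real.exp ?_ * _)
        rw [neg_div, neg_div]
        gcongr

lemma le_liminf_avgF {β : ℝ} (hβ0 : 0 < β) {h : Rn n → ℝ≥0∞} (hm : Measurable h)
    (hh : LowerSemicontinuous h) (x : Rn n) :
    h x ≤ liminf (fun r => avgF β r h x) (𝓝[>] 0) := by
  refine le_of_forall_lt_imp_le_of_dense fun a ha => ?_
  obtain ⟨δ, hδ, hball⟩ := Metric.eventually_nhds_iff_ball.1 (hh x a ha)
  have hlow : ∀ r > 0, a * (1 - ENNReal.ofReal (Real.exp (-δ ^ 2 / (8 * r)) *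
      2 ^ ((n : ℝ) / 2))) ≤ avgF β r h x := by
    intro r hr
    set τ := ENNReal.ofReal (Real.exp (-δ ^ 2 / (8 * r)) * 2 ^ ((n : ℝ) / 2))
    have h1 : a * (1 - τ) * vM β r univ ≤ mixF (vM β r) h x := by
      rw [mixF, mixP_eq_lintegral_heatP, ← lintegral_const]
      refine lintegral_mono_ae ?_
      filter_upwards [vM_ae_mem β r] with t ht
      rw [heatP, lintegral_withDensity_eq_lintegral_mul _ hm (by fun_prop)]
      calc a * (1 - τ) ≤ a * ∫⁻ y in Metric.ball x δ, heatK n t (x - y) := by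
            gcongr
            exact le_lintegral_heatK_ball ht.1 ht.2 hδ x
        _ = ∫⁻ y in Metric.ball x δ, a * heatK n t (x - y) :=
            (lintegral_const_mul _ (by fun_prop)).symm
        _ ≤ ∫⁻ y in Metric.ball x δ, h y * heatK n t (x - y) :=
            setLIntegral_mono' Metric.isOpen_ball.measurableSet fun y hy =>
              mul_le_mul_left (hball y hy).le _
        _ ≤ _ := setLIntegral_le_lintegral _ _
    rw [avgF, mul_comm _ (mixF _ _ _), ← div_eq_mul_inv,
      ENNReal.le_div_iff_mul_le (Or.inl (vM_univ_ne_zero hr)) (Or.inl (vM_univ_lt_top hβ0 r).ne)]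
    exact h1
  have hlim : Tendsto (fun r : ℝ => a * (1 - ENNReal.ofReal (Real.exp (-δ ^ 2 / (8 * r)) *
      2 ^ ((n : ℝ) / 2)))) (𝓝[>] 0) (𝓝 a) := by
    have h1 := ENNReal.Tendsto.sub (tendsto_const_nhds (x := (1 : ℝ≥0∞)) (f := 𝓝[>] (0 : ℝ)))
      (tendsto_exp_tail (n := n) hδ) (Or.inl one_ne_top)
    rw [tsub_zero] at h1
    simpa using ENNReal.Tendsto.const_mul (a := a) h1 (Or.inl one_ne_zero)
  rw [← hlim.liminf_eq]
  exact liminf_le_liminf (eventually_mem_nhdsWithin.mono hlow)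

lemma tendsto_avg_mixP {β : ℝ} (hβ0 : 0 < β) (hβ1 : β ≤ 1) (μ : Measure (Rn n)) [SFinite μ]
    {x : Rn n} (hx : mixP (kM β) μ x ≠ ⊤) :
    Tendsto (fun r => avgF β r (mixP (kM β) μ) x) (𝓝[>] 0) (𝓝 (mixP (kM β) μ x)) := by
  unfold avgF
  simp_rw [mixF_mixP (vM_ae_pos β _) (kM_ae_pos β)]
  rw [mixP_eq_lintegral_heatP] at hx
  simp_rw [mixP_eq_lintegral_heatP]
  exact tendsto_lintegral_conv_vM hβ0 hβ1 (by fun_prop) hx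

lemma tendsto_lintegral_avg_mixP {β : ℝ} (hβ0 : 0 < β) (hβ1 : β ≤ 1) (μ ψ : Measure (Rn n))
    [SFinite μ] [SFinite ψ] (hx : ∫⁻ x, mixP (kM β) μ x ∂ψ ≠ ⊤) :
    Tendsto (fun r => (vM β r univ)⁻¹ * ∫⁻ x, mixP ((vM β r).conv (kM β)) μ x ∂ψ)
      (𝓝[>] 0) (𝓝 (∫⁻ x, mixP (kM β) μ x ∂ψ)) := by
  have hsw : ∀ (ρ : Measure ℝ) [SFinite ρ], ∫⁻ x, mixP ρ μ x ∂ψ =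
      ∫⁻ t, ∫⁻ x, heatP t μ x ∂ψ ∂ρ := fun ρ _ => by
    simp_rw [mixP_eq_lintegral_heatP]
    exact lintegral_lintegral_swap
      (Measurable.aemeasurable (f := fun p : Rn n × ℝ => heatP p.2 μ p.1) (by fun_prop))
  rw [hsw] at hx
  simp_rw [hsw]
  exact tendsto_lintegral_conv_vM hβ0 hβ1 (Measurable.lintegral_prod_right'
    (f := fun p : ℝ × Rn n => heatP p.1 μ p.2) (by fun_prop)) hx

lemma le_of_quadratic_limits {a b c d q : ℕ → ℝ≥0∞} {I J H Q : ℝ≥0∞} (hI : I ≠ ⊤) (hQ : Q ≠ ⊤)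
    (ha : I ≤ liminf a atTop) (hb : Tendsto b atTop (𝓝 J)) (hc : Tendsto c atTop (𝓝 I))
    (hd : limsup d atTop ≤ H) (hq : Tendsto q atTop (𝓝 Q))
    (h : ∀ e j, a j + 2 * e * b j ≤ c j + 2 * e * d j + e ^ 2 * q j) : J ≤ H := by
  obtain ⟨a', -, s, hs, ha'⟩ := isCompact_univ.tendsto_subseq (x := a) fun _ => mem_univ _
  obtain ⟨d', -, s', hs', hd'⟩ := isCompact_univ.tendsto_subseq (x := d ∘ s) fun _ => mem_univ _
  have hss : Tendsto (s ∘ s') atTop atTop := hs.tendsto_atTop.comp hs'.tendsto_atTop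
  have ha1 := ha'.comp hs'.tendsto_atTop
  have hIa : I ≤ a' := ha.trans ((liminf_le_liminf_of_le hss).trans_eq ha1.liminf_eq)
  have hdH : d' ≤ H := (hd'.limsup_eq.ge.trans (limsup_le_limsup_of_le hss)).trans hd
  have key : ∀ e : ℝ≥0∞, e ≠ 0 → e ≠ ⊤ → 2 * J ≤ 2 * H + e * Q := by
    intro e he0 he
    have hmul : ∀ {k : ℝ≥0∞} {u : ℕ → ℝ≥0∞} {l}, k ≠ ⊤ → Tendsto u atTop (𝓝 l) →
        Tendsto (fun j => k * u j) atTop (𝓝 (k * l)) := fun hk hu =>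
      ENNReal.Tendsto.const_mul hu (Or.inr hk)
    have h2e : 2 * e ≠ ⊤ := ENNReal.mul_ne_top (by simp) he
    have h3 : a' + 2 * e * J ≤ I + 2 * e * d' + e ^ 2 * Q :=
      le_of_tendsto_of_tendsto' (ha1.add (hmul h2e (hb.comp hss)))
        (((hc.comp hss).add (hmul h2e hd')).add (hmul (ENNReal.pow_ne_top he) (hq.comp hss)))
        fun j => h e (s (s' j))
    have h4 : I + (2 * e * J) ≤ I + (2 * e * H + e ^ 2 * Q) := by
      rw [← add_assoc]
      exact (add_le_add_left hIa _).trans (h3.trans (by gcongr))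
    have h5 := (ENNReal.add_le_add_iff_left hI).1 h4
    refine (ENNReal.mul_le_mul_iff_right he0 he).1 ?_
    refine (le_of_eq ?_).trans (h5.trans_eq ?_) <;> ring
  have hlim : Tendsto (fun e : ℝ≥0∞ => 2 * H + e * Q) (𝓝[≠] 0) (𝓝 (2 * H + 0 * Q)) :=
    tendsto_const_nhds.add (ENNReal.Tendsto.mul_const
      (tendsto_nhdsWithin_of_tendsto_nhds tendsto_id) (Or.inr hQ))
  rw [zero_mul, add_zero] at hlim
  have h5 : 2 * J ≤ 2 * H := by
    refine ge_of_tendsto hlim ?_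
    filter_upwards [self_mem_nhdsWithin,
      nhdsWithin_le_nhds (gt_mem_nhds (show (0 : ℝ≥0∞) < 1 by simp))] with e he he1
    exact key e he (he1.trans one_lt_top).ne
  exact (ENNReal.mul_le_mul_iff_right (by simp) (by simp)).1 h5

/-- The domination principle for Riesz potentials of order `2 β ≤ 2`, in integrated form. -/
theorem lintegral_le_lintegral_inf {β : ℝ} (hβ0 : 0 < β) (hβ1 : β ≤ 1)
    {μ ψ : Measure (Rn n)} [SFinite μ] [SFinite ψ]
    (hμ : ∫⁻ x, mixP (kM β) μ x ∂μ ≠ ⊤) (hψ : ∫⁻ x, mixP (kM β) ψ x ∂ψ ≠ ⊤)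
    {v : Rn n → ℝ≥0∞} (hv : Measurable v) (hvl : LowerSemicontinuous v)
    (hvN : ∀ r > 0, mixF (nuM β r) v ≤ v)
    (hvlim : ∀ x, limsup (fun j => avgF β (scale j) v x) atTop ≤ v x)
    (hle : ∀ᵐ x ∂μ, mixP (kM β) μ x ≤ v x) : ∀ᵐ x ∂ψ, mixP (kM β) μ x ≤ v x := by
  set U := mixP (kM β) μ with hU
  set h := U ⊓ v with hh
  have hUm : Measurable U := measurable_mixP _ _
  have hhm : Measurable h := hUm.inf hv
  have hhl : LowerSemicontinuous h := (lowerSemicontinuous_mixP _ _).inf hvl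
  have hUψ : ∫⁻ x, U x ∂ψ ≠ ⊤ :=
    (lt_of_le_of_lt (le_mul_of_one_le_left' one_le_two)
      ((two_mul_lintegral_mixP_le _ (kM_ae_pos β) μ ψ).trans_lt
        (ENNReal.add_lt_top.2 ⟨hμ.lt_top, hψ.lt_top⟩))).ne
  let c : ℕ → ℝ≥0∞ := fun j => (vM β (scale j) univ)⁻¹
  have hT1 := (tendsto_lintegral_avg_mixP hβ0 hβ1 μ μ hμ).comp tendsto_scale
  have hT2 := (tendsto_lintegral_avg_mixP hβ0 hβ1 μ ψ hUψ).comp tendsto_scale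
  have hT3 := (tendsto_lintegral_avg_mixP hβ0 hβ1 ψ ψ hψ).comp tendsto_scale
  have hliminf : ∫⁻ x, h x ∂μ ≤ liminf (fun j => ∫⁻ x, avgF β (scale j) h x ∂μ) atTop := by
    refine le_trans (lintegral_mono fun x => ?_)
      (lintegral_liminf_le fun j => (by unfold avgF; fun_prop))
    exact (le_liminf_avgF hβ0 hhm hhl x).trans (liminf_le_liminf_of_le tendsto_scale)
  have hlimsup : limsup (fun j => ∫⁻ x, avgF β (scale j) h x ∂ψ) atTop ≤ ∫⁻ x, h x ∂ψ := by
    refine (limsup_lintegral_le (fun x => 4 * U x) (fun j => by unfold avgF; fun_prop)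
      (fun j => ae_of_all _ fun x => ?_) ?_).trans (lintegral_mono_ae ?_)
    · have h1 := (mixF_mono (vM β (scale j)) (inf_le_left : h ≤ U) x).trans_eq
        (congrFun (mixF_mixP (vM_ae_pos β _) (kM_ae_pos β) μ) x)
      have h2 := h1.trans (lintegral_mixP_vM_conv_le hβ0 hβ1 (scale j) μ x)
      calc avgF β (scale j) h x ≤ (vM β (scale j) univ)⁻¹ * (4 * vM β (scale j) univ * U x) := by
            unfold avgF; gcongr
        _ = (vM β (scale j) univ)⁻¹ * vM β (scale j) univ * (4 * U x) := by ring
        _ = 4 * U x := by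
            rw [ENNReal.inv_mul_cancel (vM_univ_ne_zero (scale_pos j))
              (vM_univ_lt_top hβ0 _).ne, one_mul]
    · rw [lintegral_const_mul _ hUm]
      exact ENNReal.mul_ne_top (by simp) hUψ
    · filter_upwards [ae_lt_top hUm hUψ] with x hx
      refine le_inf ?_ ?_
      · refine le_trans (limsup_le_limsup (Eventually.of_forall fun j => ?_))
          ((tendsto_avg_mixP hβ0 hβ1 μ hx.ne).comp tendsto_scale).limsup_eq.le
        exact mul_le_mul_right (mixF_mono _ inf_le_left x) _
      · refine le_trans (limsup_le_limsup (Eventually.of_forall fun j => ?_)) (hvlim x)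
        exact mul_le_mul_right (mixF_mono _ inf_le_right x) _
  have hhμ : ∫⁻ x, h x ∂μ = ∫⁻ x, U x ∂μ :=
    lintegral_congr_ae (hle.mono fun x hx => inf_eq_left.2 hx)
  have hfin : ∫⁻ x, U x ∂ψ ≤ ∫⁻ x, h x ∂ψ := by
    refine le_of_quadratic_limits hμ hψ (hhμ ▸ hliminf) hT2 hT1 hlimsup hT3 fun e j => ?_
    have h1 := mul_le_mul_right (lintegral_mixF_inf_le hβ0 hβ1 (scale_pos j) hμ hψ hv
      (hvN _ (scale_pos j)) e) (c j)
    have h2 : ∀ m : Measure (Rn n), ∫⁻ x, avgF β (scale j) h x ∂m =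
        c j * ∫⁻ x, mixF (vM β (scale j)) h x ∂m := fun m =>
      lintegral_const_mul _ (by fun_prop)
    rw [h2, h2]
    refine (le_of_eq ?_).trans (h1.trans_eq ?_)
    · rw [mul_add, mul_left_comm]
      rfl
    · rw [mul_add, mul_add, mul_left_comm (c j), mul_left_comm (c j)]
      rfl
  have hae := ae_eq_of_ae_le_of_lintegral_le (μ := ψ) (ae_of_all _ fun x => (inf_le_left : h x ≤ U x))
    (ne_top_of_le_ne_top hUψ (lintegral_mono fun x => inf_le_left)) hUm.aemeasurable hfin
  filter_upwards [hae] with x hx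
  rw [← hx]
  exact inf_le_right

lemma mixF_const {ρ : Measure ℝ} [SFinite ρ] (hρ : ∀ᵐ t ∂ρ, 0 < t) (c : ℝ≥0∞) (x : Rn n) :
    mixF ρ (fun _ => c) x = ρ univ * c := by
  rw [mixF, mixP_eq_lintegral_heatP, mul_comm, ← lintegral_const]
  refine lintegral_congr_ae (hρ.mono fun t ht => ?_)
  simp only [heatP, withDensity_const, lintegral_smul_measure, lintegral_heatK_sub ht]
  simp

/-- The domination principle with respect to a potential. -/
theorem ae_mixP_le_mixP {β : ℝ} (hβ0 : 0 < β) (hβ1 : β ≤ 1)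
    {μ ψ ζ : Measure (Rn n)} [SFinite μ] [SFinite ψ] [SFinite ζ]
    (hμ : ∫⁻ x, mixP (kM β) μ x ∂μ ≠ ⊤) (hψ : ∫⁻ x, mixP (kM β) ψ x ∂ψ ≠ ⊤)
    (hle : ∀ᵐ x ∂μ, mixP (kM β) μ x ≤ mixP (kM β) ζ x) :
    ∀ᵐ x ∂ψ, mixP (kM β) μ x ≤ mixP (kM β) ζ x := by
  refine lintegral_le_lintegral_inf hβ0 hβ1 hμ hψ (by fun_prop)
    (lowerSemicontinuous_mixP _ _) (fun r hr x => ?_) (fun x => ?_) hle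
  · conv_rhs => rw [mixP_kM_eq hβ0 hβ1 hr]
    exact le_add_self
  · rcases eq_or_ne (mixP (kM β) ζ x) ⊤ with h | h
    · rw [h]
      exact le_top
    · exact ((tendsto_avg_mixP hβ0 hβ1 ζ h).comp tendsto_scale).limsup_eq.le

/-- The maximum principle: domination with respect to a constant. -/
theorem ae_mixP_le_const {β : ℝ} (hβ0 : 0 < β) (hβ1 : β ≤ 1)
    {μ ψ : Measure (Rn n)} [SFinite μ] [SFinite ψ] {c : ℝ≥0∞}
    (hμ : ∫⁻ x, mixP (kM β) μ x ∂μ ≠ ⊤) (hψ : ∫⁻ x, mixP (kM β) ψ x ∂ψ ≠ ⊤)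
    (hle : ∀ᵐ x ∂μ, mixP (kM β) μ x ≤ c) :
    ∀ᵐ x ∂ψ, mixP (kM β) μ x ≤ c := by
  refine lintegral_le_lintegral_inf (v := fun _ => c) hβ0 hβ1 hμ hψ (by fun_prop)
    lowerSemicontinuous_const (fun r hr x => ?_) (fun x => ?_) hle
  · rw [mixF_const (nuM_ae_pos β hr), nuM_univ hβ0 hβ1 hr, one_mul]
  · refine (limsup_congr (Eventually.of_forall fun j => ?_)).trans_le (limsup_const c).le
    rw [avgF, mixF_const (vM_ae_pos β _), ← mul_assoc,
      ENNReal.inv_mul_cancel (vM_univ_ne_zero (scale_pos j)) (vM_univ_lt_top hβ0 _).ne, one_mul]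

lemma mixP_kM_eq_potential {β : ℝ} (hn : β < n / 2) (μ : Measure (Rn n)) (x : Rn n) :
    mixP (kM β) μ x = rieszC n β * potential (rieszKernel n (2 * β)) μ x := by
  simp_rw [mixP, mixK_kM_sub hn, potential]
  exact lintegral_const_mul' _ _ (rieszC_ne_top)

lemma measurable_rieszKernel (n : ℕ) (α : ℝ) :
    Measurable (fun p : Rn n × Rn n => rieszKernel n α p.1 p.2) := by
  unfold rieszKernel
  fun_prop

lemma mutualEnergy_eq (α : ℝ) (μ ν : Measure (Rn n)) [SFinite μ] [SFinite ν] :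
    mutualEnergy (rieszKernel n α) μ ν = ∫⁻ x, potential (rieszKernel n α) ν x ∂μ :=
  lintegral_prod _ (measurable_rieszKernel n α).aemeasurable

lemma measurable_potential (α : ℝ) (μ : Measure (Rn n)) [SFinite μ] :
    Measurable (potential (rieszKernel n α) μ) :=
  (measurable_rieszKernel n α).lintegral_prod_right'

lemma lintegral_mixP_kM {β : ℝ} (hn : β < n / 2) (μ ν : Measure (Rn n)) :
    ∫⁻ x, mixP (kM β) μ x ∂ν =
      rieszC n β * ∫⁻ x, potential (rieszKernel n (2 * β)) μ x ∂ν := by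
  simp_rw [mixP_kM_eq_potential hn]
  exact lintegral_const_mul' _ _ (rieszC_ne_top)

lemma energy_eq {β : ℝ} (hn : β < n / 2) (μ : Measure (Rn n)) [SFinite μ] :
    ∫⁻ x, mixP (kM β) μ x ∂μ = rieszC n β * energy (rieszKernel n (2 * β)) μ := by
  rw [lintegral_mixP_kM hn, energy, mutualEnergy_eq]

lemma energy_ne_top_iff {β : ℝ} (hn : β < n / 2) (μ : Measure (Rn n)) [SFinite μ] :
    energy (rieszKernel n (2 * β)) μ ≠ ⊤ ↔ ∫⁻ x, mixP (kM β) μ x ∂μ ≠ ⊤ := by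
  rw [energy_eq hn]
  exact ⟨fun h => ENNReal.mul_ne_top (rieszC_ne_top) h, fun h h' => h (by
    rw [h', ENNReal.mul_top (rieszC_ne_zero hn)])⟩

/-- The mutual energy with respect to the kernel `mixK (kM β)`. -/
def pE (β : ℝ) (μ ν : Measure (Rn n)) : ℝ≥0∞ := ∫⁻ x, mixP (kM β) μ x ∂ν

lemma pE_comm (β : ℝ) (μ ν : Measure (Rn n)) [SFinite μ] [SFinite ν] : pE β μ ν = pE β ν μ :=
  lintegral_mixP_comm _ _ _

lemma pE_mono {β : ℝ} {μ μ' ν ν' : Measure (Rn n)} (h : μ ≤ μ') (h' : ν ≤ ν') :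
    pE β μ ν ≤ pE β μ' ν' :=
  lintegral_mono' h' fun _ => lintegral_mono' h le_rfl

lemma pE_add_right (β : ℝ) (μ ν ν' : Measure (Rn n)) :
    pE β μ (ν + ν') = pE β μ ν + pE β μ ν' := lintegral_add_measure _ _ _

lemma pE_smul_right (β : ℝ) (μ ν : Measure (Rn n)) (c : ℝ≥0∞) :
    pE β μ (c • ν) = c * pE β μ ν := by
  rw [pE, lintegral_smul_measure, smul_eq_mul, pE]

lemma mixP_smul (ρ : Measure ℝ) (μ : Measure (Rn n)) (c : ℝ≥0∞) (x : Rn n) :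
    mixP ρ (c • μ) x = c * mixP ρ μ x := by
  rw [mixP, lintegral_smul_measure, smul_eq_mul, mixP]

lemma pE_smul_left (β : ℝ) (μ ν : Measure (Rn n)) [SFinite μ] [SFinite ν] (c : ℝ≥0∞) :
    pE β (c • μ) ν = c * pE β μ ν := by
  simp_rw [pE, mixP_smul]
  exact lintegral_const_mul _ (by fun_prop)

lemma pE_add_left (β : ℝ) (μ μ' ν : Measure (Rn n)) [SFinite ν] [SFinite μ] :
    pE β (μ + μ') ν = pE β μ ν + pE β μ' ν := by
  have (x : Rn n) : mixP (kM β) (μ + μ') x = mixP (kM β) μ x + mixP (kM β) μ' x :=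
    lintegral_add_measure _ _ _
  simp_rw [pE, this]
  exact lintegral_add_left (by fun_prop) _

lemma two_mul_pE_le (β : ℝ) (μ ν : Measure (Rn n)) [SFinite μ] [SFinite ν] :
    2 * pE β μ ν ≤ pE β μ μ + pE β ν ν :=
  two_mul_lintegral_mixP_le _ (kM_ae_pos β) μ ν

lemma pE_ne_top {β : ℝ} {μ ν : Measure (Rn n)} [SFinite μ] [SFinite ν] (hμ : pE β μ μ ≠ ⊤)
    (hν : pE β ν ν ≠ ⊤) : pE β μ ν ≠ ⊤ := fun h => by
  have := two_mul_pE_le β μ ν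
  rw [h, ENNReal.mul_top two_ne_zero, top_le_iff, ENNReal.add_eq_top] at this
  tauto

lemma pE_restrict_ne_top {β : ℝ} {μ : Measure (Rn n)} (hμ : pE β μ μ ≠ ⊤) (s : Set (Rn n)) :
    pE β (μ.restrict s) (μ.restrict s) ≠ ⊤ :=
  ne_top_of_le_ne_top hμ (pE_mono Measure.restrict_le_self Measure.restrict_le_self)

lemma pE_add_ne_top {β : ℝ} {μ ν : Measure (Rn n)} [SFinite μ] [SFinite ν]
    (hμ : pE β μ μ ≠ ⊤) (hν : pE β ν ν ≠ ⊤) : pE β (μ + ν) (μ + ν) ≠ ⊤ := by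
  have h := pE_ne_top hμ hν
  have h' := pE_ne_top hν hμ
  rw [pE_add_right, pE_add_left, pE_add_left]
  finiteness

lemma pE_smul_ne_top {β : ℝ} {μ : Measure (Rn n)} [SFinite μ] {c : ℝ≥0∞} (hc : c ≠ ⊤)
    (hμ : pE β μ μ ≠ ⊤) : pE β (c • μ) (c • μ) ≠ ⊤ := by
  rw [pE_smul_right, pE_smul_left]
  finiteness

/-- If `μ` has finite energy, then measures of small energy have small mutual energy
with `μ`. -/
lemma exists_pE_le {β : ℝ} {μ : Measure (Rn n)} [SFinite μ] (hμ : pE β μ μ ≠ ⊤) {ε : ℝ≥0∞}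
    (hε : ε ≠ 0) : ∃ δ : ℝ≥0∞, δ ≠ 0 ∧ ∀ (ν : Measure (Rn n)) [SFinite ν], pE β ν ν ≤ δ →
      pE β μ ν ≤ ε := by
  rcases eq_or_ne ε ⊤ with rfl | hε'
  · exact ⟨1, one_ne_zero, fun ν _ _ => le_top⟩
  obtain ⟨s, hs0, hs1, hs⟩ : ∃ s : ℝ≥0∞, s ≠ 0 ∧ s ≠ ⊤ ∧ s * pE β μ μ ≤ ε := by
    refine ⟨ε / (pE β μ μ + 1), ?_, ?_, ?_⟩
    · exact (ENNReal.div_pos hε (by finiteness)).ne'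
    · exact ENNReal.div_ne_top hε' (by simp)
    · refine (mul_le_mul_right (self_le_add_right _ 1) _).trans ?_
      rw [mul_comm]
      exact ENNReal.mul_div_le
  refine ⟨s * ε, mul_ne_zero hs0 hε, fun ν _ hν => ?_⟩
  have h := two_mul_pE_le β (s • μ) ν
  rw [pE_smul_left, pE_smul_left, pE_smul_right] at h
  have h1 : s * (2 * pE β μ ν) ≤ s * (ε + ε) := by
    calc s * (2 * pE β μ ν) = 2 * (s * pE β μ ν) := by ring
      _ ≤ s * (s * pE β μ μ) + pE β ν ν := h
      _ ≤ s * ε + s * ε := add_le_add (mul_le_mul_right hs _) hν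
      _ = s * (ε + ε) := by ring
  have h2 := (ENNReal.mul_le_mul_iff_right hs0 hs1).1 h1
  rw [← two_mul] at h2
  exact (ENNReal.mul_le_mul_iff_right two_ne_zero (by simp)).1 h2

/-- The Gauss functional with the field `- mixP (kM β) ζ`. -/
def gJ (β : ℝ) (ζ μ : Measure (Rn n)) : ℝ := (pE β μ μ).toReal - 2 * (pE β ζ μ).toReal

lemma le_of_forall_quadratic {a b : ℝ} (h : ∀ t : ℝ, 0 < t → t ≤ 1 → 0 ≤ t * (a + t * b)) :
    0 ≤ a := by
  by_contra! ha
  have hb : 0 < |b| + |a| + 1 := by positivity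
  set t := -a / (2 * (|b| + |a| + 1)) with ht
  have ht0 : 0 < t := by rw [ht]; apply div_pos <;> linarith
  have ht1 : t ≤ 1 := by
    rw [ht, div_le_one (by positivity)]
    have := neg_abs_le a
    have := abs_nonneg b
    linarith [abs_nonneg a]
  have h1 := h t ht0 ht1
  have h2 : 0 ≤ a + t * b := by
    by_contra! hc
    nlinarith
  have h3 : t * b ≤ -a / 2 := by
    have : t * (2 * (|b| + |a| + 1)) = -a := by rw [ht]; field_simp
    have h4 := le_abs_self b
    have h5 := abs_nonneg a
    nlinarith
  linarith

lemma pE_le_of_gJ_le {β : ℝ} {lam ν ζ : Measure (Rn n)} [IsFiniteMeasure lam] [SFinite ν]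
    [SFinite ζ] (hl : pE β lam lam ≠ ⊤) (hν : pE β ν ν ≠ ⊤) (hζ : pE β ζ ζ ≠ ⊤) {B : Set (Rn n)}
    (hB : MeasurableSet B)
    (hmin : ∀ t : ℝ, 0 < t → t ≤ 1 → gJ β ζ lam ≤ gJ β ζ (lam.restrict Bᶜ +
      (ENNReal.ofReal (1 - t) • lam.restrict B + (ENNReal.ofReal t * lam B) • ν))) :
    pE β lam (lam.restrict B) ≤ pE β ζ (lam.restrict B) + lam B * pE β lam ν := by
  set a := lam.restrict B with ha
  set c := lam.restrict Bᶜ with hc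
  have hca : lam = c + a := by
    rw [ha, hc, add_comm, Measure.restrict_add_restrict_compl hB]
  set b := (lam B).toReal with hb
  have hbe : lam B = ENNReal.ofReal b := (ENNReal.ofReal_toReal (measure_ne_top _ _)).symm
  have hb0 : 0 ≤ b := toReal_nonneg
  have haf : pE β a a ≠ ⊤ := pE_restrict_ne_top hl _
  have hcf : pE β c c ≠ ⊤ := pE_restrict_ne_top hl _
  have key : 0 ≤ (pE β ζ a).toReal + b * ((pE β lam ν).toReal - (pE β ζ ν).toReal)
      - (pE β lam a).toReal := by
    refine le_of_forall_quadratic (b := ((pE β a a).toReal + b ^ 2 * (pE β ν ν).toReal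
      - 2 * b * (pE β a ν).toReal) / 2) fun t ht0 ht1 => ?_
    have h := hmin t ht0 ht1
    have e1 : gJ β ζ lam = (pE β c c).toReal + 2 * (pE β a c).toReal + (pE β a a).toReal
        - 2 * ((pE β ζ c).toReal + (pE β ζ a).toReal) := by
      have x1 := pE_ne_top haf hcf
      have x2 := pE_ne_top hζ haf
      have x3 := pE_ne_top hζ hcf
      rw [gJ, hca]
      simp only [pE_add_right, pE_add_left]
      rw [pE_comm β c a, ENNReal.toReal_add, ENNReal.toReal_add, ENNReal.toReal_add,
        ENNReal.toReal_add]
      · ring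
      all_goals finiteness
    have e2 : gJ β ζ (c + (ENNReal.ofReal (1 - t) • a + (ENNReal.ofReal t * lam B) • ν)) =
        (pE β c c).toReal + (1 - t) ^ 2 * (pE β a a).toReal + t ^ 2 * b ^ 2 * (pE β ν ν).toReal
        + 2 * (1 - t) * (pE β a c).toReal + 2 * t * b * (pE β c ν).toReal
        + 2 * (1 - t) * t * b * (pE β a ν).toReal
        - 2 * ((pE β ζ c).toReal + (1 - t) * (pE β ζ a).toReal + t * b * (pE β ζ ν).toReal) := by
      have x1 := pE_ne_top haf hcf
      have x2 := pE_ne_top hζ haf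
      have x3 := pE_ne_top hζ hcf
      have x4 := pE_ne_top hζ hν
      have x5 := pE_ne_top haf hν
      have x6 := pE_ne_top hcf hν
      have x7 := measure_ne_top lam B
      rw [gJ]
      simp only [pE_add_right, pE_add_left, pE_smul_left, pE_smul_right]
      rw [pE_comm β c a, pE_comm β ν a, pE_comm β ν c]
      repeat rw [ENNReal.toReal_add (by finiteness) (by finiteness)]
      simp only [ENNReal.toReal_mul]
      repeat rw [ENNReal.toReal_add (by finiteness) (by finiteness)]
      simp only [ENNReal.toReal_mul]
      rw [ENNReal.toReal_ofReal ht0.le, ENNReal.toReal_ofReal (by linarith), ← hb]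
      ring
    have e3 : (pE β lam a).toReal = (pE β a c).toReal + (pE β a a).toReal := by
      have x1 := pE_ne_top haf hcf
      rw [hca, pE_add_left, pE_comm β c a, ENNReal.toReal_add (by finiteness) (by finiteness)]
    have e4 : (pE β lam ν).toReal = (pE β c ν).toReal + (pE β a ν).toReal := by
      have x5 := pE_ne_top haf hν
      have x6 := pE_ne_top hcf hν
      rw [hca, pE_add_left, ENNReal.toReal_add (by finiteness) (by finiteness)]
    rw [e1, e2] at h
    rw [e3, e4]
    nlinarith
  have x1 := pE_ne_top hl haf
  have x2 := pE_ne_top hζ haf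
  have x3 := pE_ne_top hl hν
  rw [← ENNReal.toReal_le_toReal x1 (by finiteness), ENNReal.toReal_add x2 (by finiteness),
    ENNReal.toReal_mul, ← hb]
  have := mul_nonneg hb0 (toReal_nonneg (a := pE β ζ ν))
  linarith

lemma pE_eq_energy {β : ℝ} (hn : β < n / 2) (μ : Measure (Rn n)) [SFinite μ] :
    pE β μ μ = rieszC n β * energy (rieszKernel n (2 * β)) μ := energy_eq hn μ

lemma fieldIntegrable_neg_potential {β : ℝ} (hn : β < n / 2) {ζ μ : Measure (Rn n)} [SFinite ζ]
    [SFinite μ] {f : Rn n → EReal}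
    (hf : ∀ x, f x = -((potential (rieszKernel n (2 * β)) ζ x : ℝ≥0∞) : EReal))
    (hζ : pE β ζ ζ ≠ ⊤) (hμ : pE β μ μ ≠ ⊤) :
    FieldIntegrable f μ ∧ rieszC n β * ∫⁻ x, potential (rieszKernel n (2 * β)) ζ x ∂μ = pE β ζ μ ∧
      fieldIntegral f μ = -(∫⁻ x, potential (rieszKernel n (2 * β)) ζ x ∂μ).toReal := by
  have h1 : rieszC n β * ∫⁻ x, potential (rieszKernel n (2 * β)) ζ x ∂μ = pE β ζ μ :=
    (lintegral_mixP_kM hn ζ μ).symm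
  have h2 : ∫⁻ x, potential (rieszKernel n (2 * β)) ζ x ∂μ ≠ ⊤ := fun h => pE_ne_top hζ hμ (by
    rw [← h1, h, ENNReal.mul_top (rieszC_ne_zero hn)])
  have hm : AEMeasurable (potential (rieszKernel n (2 * β)) ζ) μ :=
    (measurable_potential _ _).aemeasurable
  have h3 : ∀ᵐ x ∂μ, potential (rieszKernel n (2 * β)) ζ x < ⊤ := ae_lt_top' hm h2
  refine ⟨⟨?_, ?_⟩, h1, ?_⟩
  · simp_rw [hf, EReal.toReal_neg_eq, EReal.toReal_coe_ennreal]
    exact (integrable_toReal_of_lintegral_ne_top hm h2).neg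
  · filter_upwards [h3] with x hx
    rw [hf]
    simp [EReal.neg_eq_top_iff, EReal.neg_eq_bot_iff, hx.ne]
  · simp_rw [fieldIntegral, hf, EReal.toReal_neg_eq, EReal.toReal_coe_ennreal]
    rw [integral_neg, integral_toReal hm h3]

lemma gJ_eq_gaussI {β : ℝ} (hn : β < n / 2) {ζ μ : Measure (Rn n)} [SFinite ζ]
    [SFinite μ] {f : Rn n → EReal}
    (hf : ∀ x, f x = -((potential (rieszKernel n (2 * β)) ζ x : ℝ≥0∞) : EReal))
    (hζ : pE β ζ ζ ≠ ⊤) (hμ : pE β μ μ ≠ ⊤) :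
    gJ β ζ μ = (rieszC n β).toReal * gaussI (rieszKernel n (2 * β)) f μ := by
  obtain ⟨-, h1, h2⟩ := fieldIntegrable_neg_potential hn hf hζ hμ
  rw [gJ, gaussI, h2, ← h1, pE_eq_energy hn, ENNReal.toReal_mul, ENNReal.toReal_mul]
  ring

lemma gJ_le_of_isSolution {β : ℝ} (hn : β < n / 2) {A : Set (Rn n)} {ζ l μ : Measure (Rn n)}
    [SFinite ζ] [SFinite l] [SFinite μ] {f : Rn n → EReal}
    (hf : ∀ x, f x = -((potential (rieszKernel n (2 * β)) ζ x : ℝ≥0∞) : EReal))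
    (hζ : pE β ζ ζ ≠ ⊤) (hl : pE β l l ≠ ⊤) (hμ : memBreve (rieszKernel n (2 * β)) A μ)
    (hsol : IsSolution (rieszKernel n (2 * β)) A f l) : gJ β ζ l ≤ gJ β ζ μ := by
  have hμ' : pE β μ μ ≠ ⊤ := (energy_ne_top_iff hn μ).1 hμ.1.2.ne
  rw [gJ_eq_gaussI hn hf hζ hl, gJ_eq_gaussI hn hf hζ hμ']
  refine mul_le_mul_of_nonneg_left ?_ toReal_nonneg
  rw [← EReal.coe_le_coe_iff, hsol.2]
  exact iInf₂_le μ ⟨hμ, (fieldIntegrable_neg_potential hn hf hζ hμ').1⟩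

/-- A solution of the Gauss problem on a set of infinite capacity satisfies `U^l ≤ U^ζ`
almost everywhere. -/
theorem ae_mixP_le_of_isSolution {β : ℝ} (hn : β < n / 2) {A : Set (Rn n)}
    {ζ l : Measure (Rn n)} [SFinite ζ] [IsProbabilityMeasure l] {f : Rn n → EReal}
    (hf : ∀ x, f x = -((potential (rieszKernel n (2 * β)) ζ x : ℝ≥0∞) : EReal))
    (hζ : pE β ζ ζ ≠ ⊤) (hcap : innerCap (rieszKernel n (2 * β)) A = ⊤)
    (hsol : IsSolution (rieszKernel n (2 * β)) A f l) :
    ∀ᵐ x ∂l, mixP (kM β) l x ≤ mixP (kM β) ζ x := by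
  have hbl := hsol.1.1
  have hl : pE β l l ≠ ⊤ := (energy_ne_top_iff hn l).1 hbl.1.2.ne
  set B := {x : Rn n | mixP (kM β) ζ x < mixP (kM β) l x} with hB
  have hBm : MeasurableSet B := measurableSet_lt (by fun_prop) (by fun_prop)
  have hrf : pE β (l.restrict B) (l.restrict B) ≠ ⊤ := pE_restrict_ne_top hl _
  have key : pE β l (l.restrict B) ≤ pE β ζ (l.restrict B) := by
    refine ENNReal.le_of_forall_pos_le_add fun ε hε _ => ?_
    obtain ⟨δ, hδ0, hδ⟩ := exists_pE_le hl (ε := ε) (by exact_mod_cast hε.ne')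
    have hw : wcap (rieszKernel n (2 * β)) A = 0 := by
      rwa [innerCap, ENNReal.inv_eq_top] at hcap
    have hδ' : 0 < δ / rieszC n β := ENNReal.div_pos hδ0 rieszC_ne_top
    rw [← hw, wcap, iInf_lt_iff] at hδ'
    obtain ⟨ν, hν⟩ := hδ'
    rw [iInf_lt_iff] at hν
    obtain ⟨hνA, hνe⟩ := hν
    have : IsProbabilityMeasure ν := ⟨hνA.2.2⟩
    have hνf : pE β ν ν ≠ ⊤ := (energy_ne_top_iff hn ν).1 hνA.1.2.ne
    have hνδ : pE β ν ν ≤ δ := by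
      rw [pE_eq_energy hn]
      exact (mul_le_mul_right hνe.le _).trans ENNReal.mul_div_le
    refine (pE_le_of_gJ_le hl hνf hζ hBm fun t ht0 ht1 => ?_).trans
      (add_le_add_right (((mul_le_mul_left prob_le_one _).trans (one_mul _).le).trans (hδ ν hνδ)) _)
    have hfin := measure_ne_top l B
    have : IsFiniteMeasure (ENNReal.ofReal (1 - t) • l.restrict B) :=
      Measure.smul_finite _ (by finiteness)
    have : IsFiniteMeasure ((ENNReal.ofReal t * l B) • ν) :=
      Measure.smul_finite _ (by finiteness)
    refine gJ_le_of_isSolution hn hf hζ hl ⟨⟨?_, ?_⟩, ?_, ?_⟩ hsol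
    · unfold IsRadon
      infer_instance
    · rw [lt_top_iff_ne_top, energy_ne_top_iff hn]
      refine pE_add_ne_top (pE_restrict_ne_top hl _) (pE_add_ne_top ?_ ?_)
      · exact pE_smul_ne_top (by finiteness) hrf
      · exact pE_smul_ne_top (by finiteness) hνf
    · intro K hK
      have h1 := hbl.2.1 K hK
      have h2 := hνA.2.1 K hK
      simp only [Measure.add_apply, Measure.smul_apply, smul_eq_mul, h2, mul_zero, add_zero]
      rw [le_zero_iff.1 ((Measure.restrict_apply_le B _).trans h1.le),
        le_zero_iff.1 ((Measure.restrict_apply_le Bᶜ _).trans h1.le), mul_zero, add_zero]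
    · simp only [Measure.add_apply, Measure.smul_apply, smul_eq_mul, hνA.2.2, mul_one,
        Measure.restrict_apply_univ]
      rw [← add_mul, ← ENNReal.ofReal_add (by linarith) ht0.le, sub_add_cancel, ofReal_one,
        one_mul, add_comm, measure_add_measure_compl hBm]
      exact hbl.2.2
  have h0 : ∀ᵐ x ∂(l.restrict B), mixP (kM β) ζ x = mixP (kM β) l x := by
    refine ae_eq_of_ae_le_of_lintegral_le ?_ (pE_ne_top hζ hrf) (by fun_prop) key
    exact (ae_restrict_mem hBm).mono fun x hx => le_of_lt hx
  rw [ae_restrict_iff' hBm] at h0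
  filter_upwards [h0] with x hx
  by_contra! hc
  exact hc.ne (hx hc)

lemma pE_eq_lintegral (β : ℝ) (μ : Measure (Rn n)) [SFinite μ] :
    pE β μ μ = ∫⁻ t, ∫⁻ z, heatP (|t| / 2) μ z ^ 2 ∂volume ∂(kM β) := by
  simp_rw [pE, mixP_eq_lintegral_heatP]
  rw [lintegral_lintegral_swap (Measurable.aemeasurable
    (f := fun p : Rn n × ℝ => heatP p.2 μ p.1) (by fun_prop))]
  refine lintegral_congr_ae ((kM_ae_pos β).mono fun t ht => ?_)
  simp_rw [sq, abs_of_pos ht]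
  exact lintegral_heatP_eq ht μ μ

lemma heatK_le_heatK_zero {t : ℝ} (ht : 0 ≤ t) (x : Rn n) : heatK n t x ≤ heatK n t 0 := by
  unfold heatK
  refine ENNReal.ofReal_le_ofReal (mul_le_mul_of_nonneg_left (Real.exp_le_exp.2 ?_)
    (by positivity))
  have : 0 ≤ ‖x‖ ^ 2 / (4 * t) := by positivity
  rw [neg_div]
  simpa using this

lemma heatK_ne_top (t : ℝ) (x : Rn n) : heatK n t x ≠ ⊤ := ENNReal.ofReal_ne_top

lemma continuous_heatP {t : ℝ} (ht : 0 ≤ t) (z : Rn n) :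
    Continuous fun μ : ProbabilityMeasure (Rn n) => heatP t (μ : Measure (Rn n)) z := by
  have hc : Continuous fun y => (heatK n t (z - y)).toNNReal :=
    continuousOn_toNNReal.comp_continuous ((continuous_heatK n t).comp (by fun_prop))
      fun y => heatK_ne_top _ _
  let g : BoundedContinuousFunction (Rn n) NNReal :=
    BoundedContinuousFunction.mkOfBound ⟨_, hc⟩ (heatK n t 0).toNNReal fun x y => by
      have hb : ∀ w : Rn n, (heatK n t w).toNNReal ≤ (heatK n t 0).toNNReal := fun w =>
        ENNReal.toNNReal_mono (heatK_ne_top _ _) (heatK_le_heatK_zero ht w)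
      have h1 := NNReal.coe_le_coe.2 (hb (z - x))
      have h2 := NNReal.coe_le_coe.2 (hb (z - y))
      have h3 := (heatK n t (z - x)).toNNReal.coe_nonneg
      have h4 := (heatK n t (z - y)).toNNReal.coe_nonneg
      rw [NNReal.dist_eq, abs_le]
      simp only [ContinuousMap.coe_mk]
      constructor <;> linarith
  have h := ProbabilityMeasure.continuous_lintegral_boundedContinuousFunction g
  convert h using 2 with μ
  exact lintegral_congr fun y => (coe_toNNReal (heatK_ne_top _ _)).symm

lemma lowerSemicontinuous_pE (β : ℝ) :
    LowerSemicontinuous fun μ : ProbabilityMeasure (Rn n) =>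
      pE β (μ : Measure (Rn n)) (μ : Measure (Rn n)) := by
  simp_rw [pE_eq_lintegral]
  refine lowerSemicontinuous_lintegral (fun μ => ?_) fun t => ?_
  · exact Measurable.lintegral_prod_right'
      (f := fun p : ℝ × Rn n => heatP (|p.1| / 2) (μ : Measure (Rn n)) p.2 ^ 2) (by fun_prop)
  · refine lowerSemicontinuous_lintegral (fun μ => by fun_prop) fun z => ?_
    exact ((ENNReal.continuous_pow 2).comp (continuous_heatP (by positivity) z)).lowerSemicontinuous

/-- Energy minimizing probability measures on a compact set. -/
lemma exists_minimizer (β : ℝ) {K : Set (Rn n)} (hK : IsCompact K) {θ : Measure (Rn n)}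
    [IsProbabilityMeasure θ] (hθ : θ Kᶜ = 0) :
    ∃ m : Measure (Rn n), IsProbabilityMeasure m ∧ m Kᶜ = 0 ∧
      ∀ (ν : Measure (Rn n)) [IsProbabilityMeasure ν], ν Kᶜ = 0 → pE β m m ≤ pE β ν ν := by
  have hc : IsCompact {μ : ProbabilityMeasure (Rn n) | ∀ _ : ℕ, μ Kᶜ ≤ 0} :=
    isCompact_setOfPred_probabilityMeasure_mass_eq_compl_isCompact_le
      (u := fun _ => 0) (K := fun _ => K) tendsto_const_nhds (fun _ => hK)
      (Or.inl inferInstance)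
  have hmem : ∀ ν : ProbabilityMeasure (Rn n), (ν : Measure (Rn n)) Kᶜ = 0 →
      ν ∈ {μ : ProbabilityMeasure (Rn n) | ∀ _ : ℕ, μ Kᶜ ≤ 0} := fun ν h _ => by
    rw [← ENNReal.coe_le_coe, ProbabilityMeasure.ennreal_coeFn_eq_coeFn_toMeasure]
    exact h.le
  obtain ⟨m, hm, hmin⟩ := ((lowerSemicontinuous_pE β).lowerSemicontinuousOn _).exists_isMinOn
    ⟨_, hmem ⟨θ, inferInstance⟩ hθ⟩ hc
  refine ⟨m, inferInstance, ?_, fun ν hν h => hmin (hmem ⟨ν, hν⟩ h)⟩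
  have := hm 0
  rw [← ENNReal.coe_le_coe, ProbabilityMeasure.ennreal_coeFn_eq_coeFn_toMeasure] at this
  simpa using this

lemma pE_ne_zero (β : ℝ) {μ : Measure (Rn n)} [SFinite μ] (hμ : μ ≠ 0) : pE β μ μ ≠ 0 := by
  rw [pE, Ne, lintegral_eq_zero_iff (by fun_prop)]
  intro h
  have h2 : ∀ᵐ x ∂μ, False := by
    filter_upwards [h] with x hx
    exact mixP_vM_ne_zero β one_pos hμ x
      (le_zero_iff.1 ((mixP_mono (vM_le_kM β 1) μ x).trans (le_of_eq hx)))
  rw [ae_iff] at h2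
  exact hμ (by simpa using h2)

lemma isProbabilityMeasure_inv_smul {μ : Measure (Rn n)} [IsFiniteMeasure μ] (hμ : μ univ ≠ 0) :
    IsProbabilityMeasure ((μ univ)⁻¹ • μ) :=
  ⟨by rw [Measure.smul_apply, smul_eq_mul, ENNReal.inv_mul_cancel hμ (measure_ne_top _ _)]⟩

lemma pE_minimizer_le {β : ℝ} {m : Measure (Rn n)} [IsProbabilityMeasure m]
    (hm : pE β m m ≠ ⊤) {K : Set (Rn n)} (hmK : m Kᶜ = 0)
    (hmin : ∀ (ν : Measure (Rn n)) [IsProbabilityMeasure ν], ν Kᶜ = 0 → pE β m m ≤ pE β ν ν)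
    {ν : Measure (Rn n)} [IsFiniteMeasure ν] (hν : pE β ν ν ≠ ⊤) (hνK : ν Kᶜ = 0) :
    ν univ * pE β m m ≤ pE β m ν := by
  rcases eq_or_ne (ν univ) 0 with h0 | h0
  · simp [h0]
  have : IsProbabilityMeasure ((ν univ)⁻¹ • ν) := isProbabilityMeasure_inv_smul h0
  set P := (ν univ)⁻¹ • ν with hP
  have hPK : P Kᶜ = 0 := by simp [hP, hνK]
  have hPf : pE β P P ≠ ⊤ := pE_smul_ne_top (by simp [h0]) hν
  have key := pE_le_of_gJ_le (ζ := 0) hm hPf (by simp [pE]) MeasurableSet.univ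
    fun t ht0 ht1 => by
      have hpm : IsProbabilityMeasure (m.restrict univᶜ +
          (ENNReal.ofReal (1 - t) • m.restrict univ + (ENNReal.ofReal t * m univ) • P)) := ⟨by
        simp only [compl_univ, Measure.restrict_empty, Measure.restrict_univ, zero_add,
          Measure.add_apply, Measure.smul_apply, smul_eq_mul, measure_univ, mul_one]
        rw [← ENNReal.ofReal_add (by linarith) ht0.le, sub_add_cancel, ofReal_one]⟩
      have h0 : ∀ μ : Measure (Rn n), pE β 0 μ = 0 := fun μ => by simp [pE, mixP]
      rw [gJ, gJ, h0, h0, toReal_zero, mul_zero, sub_zero, sub_zero]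
      refine ENNReal.toReal_mono ?_ (hmin _ ?_)
      · have hf : IsFiniteMeasure (ENNReal.ofReal (1 - t) • m.restrict univ) :=
          Measure.smul_finite _ (by finiteness)
        have hf' : IsFiniteMeasure ((ENNReal.ofReal t * m univ) • P) :=
          Measure.smul_finite _ (by finiteness)
        exact pE_add_ne_top (pE_restrict_ne_top hm _) (pE_add_ne_top
          (pE_smul_ne_top (by finiteness) (pE_restrict_ne_top hm _))
          (pE_smul_ne_top (by finiteness) hPf))
      · simp [hmK, hPK]
  have h0' : pE β 0 (m.restrict univ) = 0 := by simp [pE, mixP]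
  rw [h0', zero_add, measure_univ, one_mul, Measure.restrict_univ, hP, pE_smul_right] at key
  calc ν univ * pE β m m ≤ ν univ * ((ν univ)⁻¹ * pE β m ν) := mul_le_mul_right key _
    _ = pE β m ν := by
      rw [← mul_assoc, ENNReal.mul_inv_cancel h0 (measure_ne_top _ _), one_mul]

/-- Equilibrium measures of compact sets. -/
theorem exists_equilibrium {β : ℝ} {K : Set (Rn n)} (hK : IsCompact K) {θ : Measure (Rn n)}
    [IsFiniteMeasure θ] (hθ : θ Kᶜ = 0) (hθ0 : θ ≠ 0) (hθf : pE β θ θ ≠ ⊤) :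
    ∃ γ : Measure (Rn n), IsFiniteMeasure γ ∧ γ Kᶜ = 0 ∧ pE β γ γ ≠ ⊤ ∧
      (∀ᵐ x ∂γ, mixP (kM β) γ x ≤ 1) ∧
      ∀ (ν : Measure (Rn n)) [IsFiniteMeasure ν], pE β ν ν ≠ ⊤ → ν K ≤ pE β γ ν := by
  have hθu : θ univ ≠ 0 := by simpa using hθ0
  have hKm := hK.measurableSet
  have hP : IsProbabilityMeasure ((θ univ)⁻¹ • θ) := isProbabilityMeasure_inv_smul hθu
  obtain ⟨m, hm, hmK, hmin⟩ := exists_minimizer β hK (θ := (θ univ)⁻¹ • θ) (by simp [hθ])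
  have hmf : pE β m m ≠ ⊤ := ne_top_of_le_ne_top
    (pE_smul_ne_top (ENNReal.inv_ne_top.2 hθu) hθf) (hmin _ (by simp [hθ]))
  set W := pE β m m with hW
  have hW0 : W ≠ 0 := pE_ne_zero β (IsProbabilityMeasure.ne_zero m)
  have hle : ∀ {ν : Measure (Rn n)} [IsFiniteMeasure ν], pE β ν ν ≠ ⊤ → ν Kᶜ = 0 →
      ν univ * W ≤ pE β m ν := fun {ν} _ h h' => pE_minimizer_le hmf hmK hmin h h'
  have hae : ∀ᵐ x ∂m, mixP (kM β) m x ≤ W := by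
    set B := {x : Rn n | W < mixP (kM β) m x} with hB
    have hBm : MeasurableSet B := measurableSet_lt (by fun_prop) (by fun_prop)
    have hs : pE β m (m.restrict B) + pE β m (m.restrict Bᶜ) = W := by
      rw [← pE_add_right, Measure.restrict_add_restrict_compl hBm]
    have h1 : m Bᶜ * W ≤ pE β m (m.restrict Bᶜ) := by
      have := hle (ν := m.restrict Bᶜ) (pE_restrict_ne_top hmf _)
        (le_zero_iff.1 ((Measure.restrict_apply_le _ _).trans hmK.le))
      rwa [Measure.restrict_apply_univ] at this
    have h2 : m B * W + m Bᶜ * W = W := by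
      rw [← add_mul, measure_add_measure_compl hBm, measure_univ, one_mul]
    have h3 : pE β m (m.restrict B) ≤ ∫⁻ x, W ∂(m.restrict B) := by
      rw [lintegral_const, Measure.restrict_apply_univ, mul_comm]
      have hf : m Bᶜ * W ≠ ⊤ := by finiteness
      refine (ENNReal.add_le_add_iff_right hf).1 ?_
      rw [h2]
      exact (add_le_add_right h1 _).trans hs.le
    have h0 : ∀ᵐ x ∂(m.restrict B), W = mixP (kM β) m x := by
      refine ae_eq_of_ae_le_of_lintegral_le ?_ ?_ (by fun_prop) h3
      · exact (ae_restrict_mem hBm).mono fun x hx => le_of_lt hx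
      · rw [lintegral_const]
        finiteness
    rw [ae_restrict_iff' hBm] at h0
    filter_upwards [h0] with x hx
    by_contra! hc
    exact hc.ne (hx hc)
  have hWi : W⁻¹ ≠ ⊤ := ENNReal.inv_ne_top.2 hW0
  refine ⟨W⁻¹ • m, Measure.smul_finite _ hWi, by simp [hmK], pE_smul_ne_top hWi hmf, ?_, ?_⟩
  · refine Measure.ae_smul_measure ?_ _
    filter_upwards [hae] with x hx
    rw [mixP_smul, ← ENNReal.inv_mul_cancel hW0 hmf]
    exact mul_le_mul_right hx _
  · intro ν _ hν
    have h := hle (ν := ν.restrict K) (pE_restrict_ne_top hν _)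
      (by rw [Measure.restrict_apply hKm.compl]; simp)
    rw [Measure.restrict_apply_univ] at h
    rw [pE_smul_left]
    calc ν K = W⁻¹ * (ν K * W) := by
          rw [mul_comm (ν K), ← mul_assoc, ENNReal.inv_mul_cancel hW0 hmf, one_mul]
      _ ≤ W⁻¹ * pE β m (ν.restrict K) := mul_le_mul_right h _
      _ ≤ W⁻¹ * pE β m ν := mul_le_mul_right (pE_mono le_rfl Measure.restrict_le_self) _

/-- A measure whose potential is at most `1` is dominated by the capacity. -/
lemma mul_measure_le_innerCap {β : ℝ} (hn : β < n / 2) {γ : Measure (Rn n)} [IsFiniteMeasure γ]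
    {F S : Set (Rn n)} (hF : γ Fᶜ = 0) (hS : MeasurableSet S)
    (hle : ∀ᵐ x ∂γ, mixP (kM β) γ x ≤ 1) :
    rieszC n β * γ S ≤ innerCap (rieszKernel n (2 * β)) (F ∩ S) := by
  rcases eq_or_ne (γ S) 0 with h0 | h0
  · simp [h0]
  have hu : (γ.restrict S) univ = γ S := Measure.restrict_apply_univ S
  have hP := isProbabilityMeasure_inv_smul (μ := γ.restrict S) (by rwa [hu])
  rw [hu] at hP
  set P := (γ S)⁻¹ • γ.restrict S with hPdef
  have hi : (γ S)⁻¹ ≠ ⊤ := ENNReal.inv_ne_top.2 h0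
  have hE : pE β P P ≤ (γ S)⁻¹ := by
    rw [hPdef, pE_smul_right, pE_smul_left]
    have : pE β (γ.restrict S) (γ.restrict S) ≤ γ S := calc
      pE β (γ.restrict S) (γ.restrict S) ≤ pE β γ (γ.restrict S) :=
        pE_mono Measure.restrict_le_self le_rfl
      _ ≤ ∫⁻ x, 1 ∂(γ.restrict S) := lintegral_mono_ae (ae_restrict_of_ae hle)
      _ = γ S := by simp
    calc (γ S)⁻¹ * ((γ S)⁻¹ * pE β (γ.restrict S) (γ.restrict S))
        ≤ (γ S)⁻¹ * ((γ S)⁻¹ * γ S) := by gcongr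
      _ = (γ S)⁻¹ := by rw [ENNReal.inv_mul_cancel h0 (measure_ne_top _ _), mul_one]
  have hmem : memBreve (rieszKernel n (2 * β)) (F ∩ S) P := by
    refine ⟨⟨?_, ?_⟩, fun K _ => ?_, measure_univ⟩
    · unfold IsRadon
      infer_instance
    · rw [lt_top_iff_ne_top, energy_ne_top_iff hn]
      exact ne_top_of_le_ne_top hi hE
    · have : (γ.restrict S) ((F ∩ S)ᶜ ∩ K) = 0 := by
        refine measure_mono_null inter_subset_left ?_
        rw [compl_inter]
        refine measure_union_null (le_zero_iff.1 ((Measure.restrict_apply_le _ _).trans hF.le)) ?_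
        rw [Measure.restrict_apply hS.compl, compl_inter_self, measure_empty]
      rw [hPdef, Measure.smul_apply, this, smul_zero]
  have h1 : wcap (rieszKernel n (2 * β)) (F ∩ S) ≤ energy (rieszKernel n (2 * β)) P :=
    iInf₂_le P hmem
  have h2 : rieszC n β * wcap (rieszKernel n (2 * β)) (F ∩ S) ≤ (γ S)⁻¹ :=
    (mul_le_mul_right h1 _).trans ((pE_eq_energy hn P).symm.le.trans hE)
  have hC0 := rieszC_ne_zero hn
  rw [innerCap, ENNReal.le_inv_iff_le_inv, ENNReal.mul_inv (Or.inl hC0) (Or.inl rieszC_ne_top)]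
  calc _ = (rieszC n β)⁻¹ * (rieszC n β * wcap (rieszKernel n (2 * β)) (F ∩ S)) := by
        rw [← mul_assoc, ENNReal.inv_mul_cancel hC0 rieszC_ne_top, one_mul]
    _ ≤ _ := mul_le_mul_right h2 _

lemma rpow_anti_of_nonpos {a b : ℝ≥0∞} {s : ℝ} (hs : s ≤ 0) (h : a ≤ b) : b ^ s ≤ a ^ s := by
  have := ENNReal.inv_le_inv.2 (ENNReal.rpow_le_rpow h (neg_nonneg.2 hs))
  rwa [ENNReal.rpow_neg, ENNReal.rpow_neg, inv_inv, inv_inv] at this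

/-- Measures whose potential is at most `1` have uniformly bounded mass on balls. -/
lemma exists_measure_ball_le {β : ℝ} (hn : β < n / 2) (R : ℝ) :
    ∃ M : ℝ≥0∞, M ≠ ⊤ ∧ ∀ (γ : Measure (Rn n)), (∀ᵐ x ∂γ, mixP (kM β) γ x ≤ 1) →
      γ (Metric.ball 0 R) ≤ M := by
  set k := rieszC n β * ENNReal.ofReal (2 * R) ^ (2 * β - n) with hk
  have hs : 2 * β - n ≤ 0 := by linarith
  have hk0 : k ≠ 0 := by
    refine mul_ne_zero (rieszC_ne_zero hn) ?_
    rw [Ne, ENNReal.rpow_eq_zero_iff]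
    rintro (⟨-, h⟩ | ⟨h, -⟩)
    · linarith
    · exact ENNReal.ofReal_ne_top h
  refine ⟨k⁻¹, ENNReal.inv_ne_top.2 hk0, fun γ hγ => ?_⟩
  rcases eq_or_ne (γ (Metric.ball 0 R)) 0 with h0 | h0
  · simp [h0]
  have hne : γ.restrict (Metric.ball 0 R) ≠ 0 := by simpa [Measure.restrict_eq_zero] using h0
  have : (ae (γ.restrict (Metric.ball 0 R))).NeBot := ae_neBot.2 hne
  obtain ⟨z, hz1, hz⟩ := ((ae_restrict_of_ae (s := Metric.ball 0 R) hγ).and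
    (ae_restrict_mem measurableSet_ball)).exists
  have h1 : k * γ (Metric.ball 0 R) ≤ 1 := by
    refine le_trans ?_ hz1
    rw [mixP, ← setLIntegral_const]
    refine le_trans (setLIntegral_mono' measurableSet_ball fun y hy => ?_)
      (setLIntegral_le_lintegral (Metric.ball 0 R) _)
    rw [mixK_kM_sub hn, rieszKernel]
    refine mul_le_mul_right (rpow_anti_of_nonpos hs (ENNReal.ofReal_le_ofReal ?_)) _
    have h2 := dist_triangle_right z y 0
    rw [Metric.mem_ball] at hz hy
    linarith
  rw [ENNReal.le_inv_iff_mul_le, mul_comm]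
  exact h1

lemma setLIntegral_shell_le {β : ℝ} (hn : β < n / 2) {γ : Measure (Rn n)} {a : ℝ} {S : Set (Rn n)}
    (hS : MeasurableSet S) (h : ∀ y ∈ S, a ≤ ‖y‖) {x : Rn n} (hx : 2 * ‖x‖ ≤ a) :
    ∫⁻ y in S, mixK (kM β) (x - y) ∂γ ≤
      rieszC n β * (ENNReal.ofReal (1 / 2) ^ (2 * β - n) * ENNReal.ofReal a ^ (2 * β - n)) * γ S := by
  have hs : 2 * β - n ≤ 0 := by linarith
  rw [← setLIntegral_const]
  refine setLIntegral_mono' hS fun y hy => ?_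
  rw [mixK_kM_sub hn, rieszKernel, ← ENNReal.mul_rpow_of_ne_top (by simp) (by simp),
    ← ENNReal.ofReal_mul (by norm_num)]
  refine mul_le_mul_right (rpow_anti_of_nonpos hs (ENNReal.ofReal_le_ofReal ?_)) _
  have h1 := h y hy
  have h2 := norm_sub_norm_le y x
  rw [dist_eq_norm_sub']
  linarith

/-- Potentials of measures on a thin set with potential at most `1` are uniformly small on large
scales. -/
theorem exists_mixP_restrict_le {β : ℝ} (hn : β < n / 2) {F : Set (Rn n)}
    (hthin : InnerThinAtInfinity n (2 * β) F) (x : Rn n) {ε : ℝ≥0∞} (hε : ε ≠ 0) :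
    ∃ T : ℝ, 0 < T ∧ ∀ (γ : Measure (Rn n)) [IsFiniteMeasure γ], γ Fᶜ = 0 →
      (∀ᵐ x ∂γ, mixP (kM β) γ x ≤ 1) → mixP ((kM β).restrict (Ioi T)) γ x ≤ ε := by
  obtain ⟨q, hq, hsum⟩ := hthin
  set S : ℕ → Set (Rn n) := fun k => {x | q ^ k ≤ ‖x‖ ∧ ‖x‖ < q ^ (k + 1)} with hSdef
  have hSm : ∀ k, MeasurableSet (S k) := fun k =>
    (measurableSet_le measurable_const measurable_norm).inter
      (measurableSet_lt measurable_norm measurable_const)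
  set c : ℕ → ℝ≥0∞ := fun k => innerCap (rieszKernel n (2 * β)) (F ∩ S k) /
    ENNReal.ofReal (q ^ ((k : ℝ) * ((n : ℝ) - 2 * β))) with hc
  have hs : 2 * β - n ≤ 0 := by linarith
  have hq0 : 0 < q := by linarith
  set b : ℝ≥0∞ := ENNReal.ofReal (1 / 2) ^ (2 * β - n) with hb
  have hbt : b ≠ ⊤ := by
    rw [hb, Ne, ENNReal.rpow_eq_top_iff]
    simp
  have hε2 : ε / 2 ≠ 0 := by simpa using hε
  have htail : Tendsto (fun J => b * ∑' k, c (k + J)) atTop (𝓝 0) := by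
    have := ENNReal.Tendsto.const_mul (a := b) (ENNReal.tendsto_sum_nat_add c hsum)
      (Or.inr hbt)
    rwa [mul_zero] at this
  have hbig : Tendsto (fun J : ℕ => q ^ J) atTop atTop := tendsto_pow_atTop_atTop_of_one_lt hq
  obtain ⟨J, hJ1, hJ2⟩ := ((htail.eventually (gt_mem_nhds (pos_iff_ne_zero.2 hε2))).and
    (hbig.eventually_ge_atTop (2 * ‖x‖))).exists
  obtain ⟨M, hM, hMγ⟩ := exists_measure_ball_le hn (q ^ J)
  obtain ⟨T, hT, hTx⟩ := mixK_restrict_Ioi_le (n := n) hn (ε := (ε / 2) / (M + 1))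
    (ENNReal.div_pos hε2 (by finiteness)).ne'
  refine ⟨T, hT, fun γ _ hγF hγ1 => ?_⟩
  rw [mixP, ← lintegral_add_compl _ (measurableSet_ball (x := (0 : Rn n)) (ε := q ^ J)),
    ← ENNReal.add_halves ε]
  refine add_le_add ?_ ?_
  · calc _ ≤ ∫⁻ y in Metric.ball 0 (q ^ J), (ε / 2) / (M + 1) ∂γ := lintegral_mono fun y => hTx _
      _ = (ε / 2) / (M + 1) * γ (Metric.ball 0 (q ^ J)) := setLIntegral_const _ _
      _ ≤ (ε / 2) / (M + 1) * (M + 1) :=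
        mul_le_mul_right ((hMγ γ hγ1).trans le_self_add) _
      _ ≤ ε / 2 := by
        rw [mul_comm]
        exact ENNReal.mul_div_le
  · have hsub : (Metric.ball (0 : Rn n) (q ^ J))ᶜ ⊆ ⋃ k, S (k + J) := fun y hy => by
      rw [mem_compl_iff, Metric.mem_ball, dist_zero_right, not_lt] at hy
      obtain ⟨j, hj1, hj2⟩ := exists_nat_pow_near ((one_le_pow₀ hq.le).trans hy) hq
      have : J < j + 1 := (pow_lt_pow_iff_right₀ hq).1 (hy.trans_lt hj2)
      exact mem_iUnion.2 ⟨j - J, by rw [Nat.sub_add_cancel (by omega)]; exact ⟨hj1, hj2⟩⟩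
    calc ∫⁻ y in (Metric.ball (0 : Rn n) (q ^ J))ᶜ, mixK ((kM β).restrict (Ioi T)) (x - y) ∂γ
        ≤ ∫⁻ y in ⋃ k, S (k + J), mixK (kM β) (x - y) ∂γ :=
          lintegral_mono' (Measure.restrict_mono hsub le_rfl) fun y =>
            lintegral_mono' Measure.restrict_le_self le_rfl
      _ ≤ ∑' k, ∫⁻ y in S (k + J), mixK (kM β) (x - y) ∂γ := lintegral_iUnion_le _ _
      _ ≤ ∑' k, b * c (k + J) := by
        refine ENNReal.tsum_le_tsum fun k => ?_
        have hqp : q ^ J ≤ q ^ (k + J) := pow_le_pow_right₀ hq.le (by omega)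
        refine (setLIntegral_shell_le hn (hSm _) (fun y hy => hy.1)
          (hJ2.trans hqp)).trans ?_
        have h1 := mul_measure_le_innerCap hn hγF (hSm (k + J)) hγ1
        have h2 : ENNReal.ofReal (q ^ (k + J)) ^ (2 * β - n) =
            (ENNReal.ofReal (q ^ (((k + J : ℕ) : ℝ) * ((n : ℝ) - 2 * β))))⁻¹ := by
          rw [ENNReal.ofReal_rpow_of_pos (by positivity), ← ENNReal.ofReal_inv_of_pos
            (by positivity), ← Real.rpow_natCast, ← Real.rpow_mul hq0.le, ← Real.rpow_neg hq0.le]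
          congr 2
          ring
        rw [h2, ← hb, hc]
        simp only [div_eq_mul_inv]
        calc _ = b * ((rieszC n β * γ (S (k + J))) *
              (ENNReal.ofReal (q ^ (((k + J : ℕ) : ℝ) * ((n : ℝ) - 2 * β))))⁻¹) := by ring
          _ ≤ _ := by gcongr
      _ = b * ∑' k, c (k + J) := ENNReal.tsum_mul_left
      _ ≤ ε / 2 := hJ1.le

lemma exists_rpow_ge (hn : 0 < n) (M : ℝ) :
    ∃ r : ℝ, 0 < r ∧ M ≤ (4 * Real.pi * r) ^ (-((n : ℝ) / 2)) := by
  have hM : 0 < max M 1 := by positivity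
  have hn' : (0 : ℝ) < n := by exact_mod_cast hn
  refine ⟨(max M 1) ^ (-(2 / (n : ℝ))) / (4 * Real.pi), by positivity, ?_⟩
  rw [mul_div_cancel₀ _ (by positivity), ← Real.rpow_mul hM.le]
  have : -(2 / (n : ℝ)) * -((n : ℝ) / 2) = 1 := by field_simp
  rw [this, Real.rpow_one]
  exact le_max_left _ _

lemma exists_exp_le {β c : ℝ} (hc : 0 < c) (M : ℝ) :
    ∃ r : ℝ, 0 < r ∧ r ≤ 1 ∧ M * Real.exp (-(c / r)) ≤ r ^ β := by
  have h := (tendsto_rpow_mul_exp_neg_mul_atTop_nhds_zero β c hc).const_mul M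
  rw [mul_zero] at h
  obtain ⟨x, hx1, hx⟩ := ((h.eventually (ge_mem_nhds one_pos)).and (eventually_ge_atTop 1)).exists
  have hx0 : 0 < x := by linarith
  refine ⟨x⁻¹, by positivity, inv_le_one_of_one_le₀ hx, ?_⟩
  have hp : 0 < x ^ β := Real.rpow_pos_of_pos hx0 _
  rw [Real.inv_rpow hx0.le, div_inv_eq_mul, ← one_div, le_div_iff₀ hp, ← neg_mul]
  linarith

/-- At large distances from the origin, the far part of the mixture is bounded below. -/
lemma ofReal_le_mixK_nuM {β a r : ℝ} (hβ0 : 0 < β) (hβ1 : β < 1) (hr : 0 < r)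
    (hr1 : r ≤ 1) {x : Rn n} (hx : ‖x‖ ≤ a) :
    (betaC β)⁻¹ * ENNReal.ofReal (r ^ β * (2⁻¹ * 2 ^ (-β))) *
      ENNReal.ofReal ((8 * Real.pi) ^ (-((n : ℝ) / 2)) * Real.exp (-a ^ 2 / 4)) ≤
      mixK (nuM β r) x := by
  rw [nuM, if_neg hβ1.ne, mixK, lintegral_withDensity_eq_lintegral_mul _
    (Measurable.indicator (by fun_prop) measurableSet_Ioi) (by fun_prop)]
  have h : ∀ s ∈ Ioo (1 : ℝ) 2, (betaC β)⁻¹ * ENNReal.ofReal (r ^ β * (2⁻¹ * 2 ^ (-β))) *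
      ENNReal.ofReal ((8 * Real.pi) ^ (-((n : ℝ) / 2)) * Real.exp (-a ^ 2 / 4)) ≤
      (((Ioi r).indicator fun s => (betaC β)⁻¹ *
        ENNReal.ofReal (r ^ β * s⁻¹ * (s - r) ^ (-β))) * fun s => heatK n s x) s := by
    intro s hs
    have hs0 : 0 < s := by linarith [hs.1]
    have hsr : r < s := by linarith [hs.1]
    rw [Pi.mul_apply, indicator_of_mem (by simpa using hsr), heatK]
    have h1 : (2 : ℝ)⁻¹ ≤ s⁻¹ := by gcongr; exact hs.2.le
    have h2 : (2 : ℝ) ^ (-β) ≤ (s - r) ^ (-β) :=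
      Real.rpow_le_rpow_of_nonpos (by linarith) (by linarith [hs.2]) (by linarith)
    have h3 : (8 * Real.pi) ^ (-((n : ℝ) / 2)) ≤ (4 * Real.pi * s) ^ (-((n : ℝ) / 2)) :=
      Real.rpow_le_rpow_of_nonpos (by positivity) (by nlinarith [hs.2, Real.pi_pos])
        (neg_nonpos.2 (by positivity))
    have h4 : -a ^ 2 / 4 ≤ -‖x‖ ^ 2 / (4 * s) := by
      rw [neg_div, neg_div, neg_le_neg_iff]
      gcongr
      linarith [hs.1]
    rw [mul_assoc (r ^ β)]
    gcongr
  calc _ = ∫⁻ _ in Ioo (1 : ℝ) 2, (betaC β)⁻¹ * ENNReal.ofReal (r ^ β * (2⁻¹ * 2 ^ (-β))) *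
      ENNReal.ofReal ((8 * Real.pi) ^ (-((n : ℝ) / 2)) * Real.exp (-a ^ 2 / 4)) := by
        rw [setLIntegral_const, Real.volume_Ioo]; norm_num
    _ ≤ _ := setLIntegral_mono' measurableSet_Ioo h
    _ ≤ _ := setLIntegral_le_lintegral _ _

/-- At small scales, the near part of the kernel at distance `d` is negligible compared to
the far part at distance `a`. -/
lemma exists_kernel_ratio {β a d : ℝ} (hβ0 : 0 < β) (hβ1 : β ≤ 1) (hn : β < n / 2) (hd : 0 < d)
    (ha : 0 ≤ a) (had : β = 1 → a < d) {δ : ℝ} (hδ : 0 < δ) :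
    ∃ r : ℝ, 0 < r ∧ ∃ l : ℝ≥0∞, l ≠ 0 ∧ l ≠ ⊤ ∧
      (∀ x : Rn n, ‖x‖ ≤ a → l ≤ mixK (nuM β r) x) ∧
      ∀ x : Rn n, d ≤ ‖x‖ → mixK (vM β r) x ≤ ENNReal.ofReal δ * l * mixK (kM β) x := by
  have hn0 : 0 < n := by
    have : (0 : ℝ) < n := by linarith
    exact_mod_cast this
  rcases hβ1.eq_or_lt with h1 | h1
  · have had' := had h1
    set θ := (a / d) ^ 2 with hθ
    have hθ0 : 0 ≤ θ := by positivity
    have hθ1 : θ < 1 := by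
      rw [hθ, sq_lt_one_iff₀ (by positivity), div_lt_one hd]
      exact had'
    have hθd : θ * d ^ 2 = a ^ 2 := by rw [hθ]; field_simp
    set c := Real.sqrt (1 - θ) ^ (2 * β - n) with hc
    obtain ⟨r, hr, hrM⟩ := exists_rpow_ge hn0 (c / δ)
    rw [div_le_iff₀ hδ] at hrM
    refine ⟨r, hr, ENNReal.ofReal ((4 * Real.pi * r) ^ (-((n : ℝ) / 2)) *
      Real.exp (-a ^ 2 / (4 * r))), ?_, by simp, fun x hx => ?_, fun x hx => ?_⟩
    · rw [Ne, ENNReal.ofReal_eq_zero, not_le]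
      positivity
    · rw [nuM, if_pos h1, mixK, lintegral_dirac' _ (by fun_prop), heatK]
      gcongr
    · refine (mixK_vM_le hn hθ0 hθ1 hd.le hx).trans (mul_le_mul_left ?_ _)
      rw [hθd, ENNReal.ofReal_rpow_of_pos (Real.sqrt_pos.2 (by linarith)), ← hc,
        ← ENNReal.ofReal_mul (by positivity), ← ENNReal.ofReal_mul hδ.le]
      refine ENNReal.ofReal_le_ofReal ?_
      nlinarith [mul_le_mul_of_nonneg_left hrM (Real.exp_pos (-a ^ 2 / (4 * r))).le]
  · set b := ((betaC β)⁻¹).toReal with hb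
    have hb' : (betaC β)⁻¹ = ENNReal.ofReal b :=
      (ENNReal.ofReal_toReal (ENNReal.inv_ne_top.2 (betaC_ne_zero β))).symm
    have hb0 : 0 < b := ENNReal.toReal_pos (ENNReal.inv_ne_zero.2 (betaC_ne_top hβ0 h1))
      (ENNReal.inv_ne_top.2 (betaC_ne_zero β))
    set k := b * (2⁻¹ * 2 ^ (-β)) *
      ((8 * Real.pi) ^ (-((n : ℝ) / 2)) * Real.exp (-a ^ 2 / 4)) with hk
    have hk0 : 0 < k := by positivity
    set c := Real.sqrt (1 - 1 / 2) ^ (2 * β - n) with hc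
    obtain ⟨r, hr, hr1, hrM⟩ := exists_exp_le (β := β) (c := d ^ 2 / 8) (by positivity)
      (c / (δ * k))
    refine ⟨r, hr, ENNReal.ofReal (r ^ β * k), ?_, by simp, fun x hx => ?_, fun x hx => ?_⟩
    · rw [Ne, ENNReal.ofReal_eq_zero, not_le]
      positivity
    · refine le_trans (le_of_eq ?_) (ofReal_le_mixK_nuM hβ0 h1 hr hr1 hx)
      rw [hb', ← ENNReal.ofReal_mul (by positivity), ← ENNReal.ofReal_mul (by positivity), hk]
      congr 1
      ring
    · refine (mixK_vM_le (θ := 1 / 2) hn (by norm_num) (by norm_num) hd.le hx).trans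
        (mul_le_mul_left ?_ _)
      rw [ENNReal.ofReal_rpow_of_pos (Real.sqrt_pos.2 (by norm_num)), ← hc,
        ← ENNReal.ofReal_mul (by positivity), ← ENNReal.ofReal_mul hδ.le]
      refine ENNReal.ofReal_le_ofReal ?_
      have he : -(1 / 2 * d ^ 2) / (4 * r) = -(d ^ 2 / 8 / r) := by field_simp; norm_num
      rw [div_mul_eq_mul_div, div_le_iff₀ (by positivity)] at hrM
      rw [he]
      linarith

/-- A bounded integrable density has finite energy. -/
lemma pE_withDensity_ne_top {β : ℝ} (hβ0 : 0 < β) (hn : β < n / 2) {f : Rn n → ℝ≥0∞}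
    {M : ℝ≥0∞} (hM : M ≠ ⊤) (hfM : ∀ x, f x ≤ M) (hfi : ∫⁻ x, f x ≠ ⊤) :
    pE β (volume.withDensity f) (volume.withDensity f) ≠ ⊤ := by
  obtain ⟨T, hT, hTx⟩ := mixK_restrict_Ioi_le (n := n) hn one_ne_zero
  have hmass : (volume.withDensity f) univ ≠ ⊤ := by
    rwa [withDensity_apply _ MeasurableSet.univ, setLIntegral_univ]
  have hb : ∀ x, mixP (kM β) (volume.withDensity f) x ≤
      vM β T univ * M + (volume.withDensity f) univ := fun x => by
    rw [kM_eq_add β hT, mixP_add_measure]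
    refine add_le_add ?_ ?_
    · calc _ ≤ mixF (vM β T) (fun _ => M) x := mixF_mono (vM β T) hfM x
        _ = _ := mixF_const (vM_ae_pos β T) M x
    · calc _ ≤ ∫⁻ _, 1 ∂(volume.withDensity f) := lintegral_mono fun y => hTx _
        _ = _ := by rw [lintegral_one]
  refine ne_top_of_le_ne_top ?_ (lintegral_mono hb)
  rw [lintegral_const]
  have := vM_univ_lt_top hβ0 T
  finiteness

/-- The defect `1 - U^γ` propagates from a measure `θ` off the support of `γ` to a set near `θ`. -/
lemma exists_setLIntegral_defect_le {β a d : ℝ} (hβ0 : 0 < β) (hβ1 : β ≤ 1) (hn : β < n / 2)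
    (hd : 0 < d) (ha : 0 ≤ a) (had : β = 1 → a < d) {δ : ℝ} (hδ : 0 < δ) {F B : Set (Rn n)}
    (hB : MeasurableSet B) {θ : Measure (Rn n)} [IsFiniteMeasure θ] (hθ0 : θ ≠ 0)
    (hθ : ∀ᵐ x ∂θ, (∀ y ∈ F, d ≤ ‖x - y‖) ∧ ∀ z ∈ B, ‖x - z‖ ≤ a) :
    ∃ C : ℝ≥0∞, C ≠ ⊤ ∧ ∀ (γ : Measure (Rn n)) [IsFiniteMeasure γ], γ Fᶜ = 0 →
      (∀ᵐ x, mixP (kM β) γ x ≤ 1) → (∀ᵐ x ∂θ, mixP (kM β) γ x ≤ 1) →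
      ∫⁻ z in B, (1 - mixP (kM β) γ z) ≤
        C * ∫⁻ x, (1 - mixP (kM β) γ x) ∂θ + ENNReal.ofReal δ := by
  obtain ⟨r, hr, l, hl0, hlt, hl, hV⟩ := exists_kernel_ratio (n := n) hβ0 hβ1 hn hd ha had hδ
  have hθu : θ univ ≠ 0 := by simpa using hθ0
  have hθt : θ univ ≠ ⊤ := measure_ne_top _ _
  have hlθ : l * θ univ ≠ 0 := mul_ne_zero hl0 hθu
  have hlθt : l * θ univ ≠ ⊤ := ENNReal.mul_ne_top hlt hθt
  refine ⟨(l * θ univ)⁻¹, ENNReal.inv_ne_top.2 hlθ, fun γ _ hγF hvol hγθ => ?_⟩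
  set w := mixP (kM β) γ with hw
  have hwm : Measurable w := measurable_mixP _ _
  have hum : Measurable fun x => 1 - w x := by fun_prop
  have hpt : ∀ᵐ x ∂θ, l * ∫⁻ z in B, (1 - w z) ≤ (1 - w x) + ENNReal.ofReal δ * l := by
    filter_upwards [hθ, hγθ] with x hx hx1
    have h1 : mixF (nuM β r) (fun z => 1 - w z) x + mixF (nuM β r) w x = 1 := by
      rw [← Pi.add_apply, ← mixF_add _ hum, mixF_apply _ (hum.add hwm)]
      calc _ = ∫⁻ y, mixK (nuM β r) (x - y) * 1 := by
            refine lintegral_congr_ae (hvol.mono fun z hz => ?_)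
            simp only [Pi.add_apply, tsub_add_cancel_of_le hz]
        _ = mixF (nuM β r) (fun _ => 1) x := (mixF_apply _ measurable_const x).symm
        _ = 1 := by rw [mixF_const (nuM_ae_pos β hr), nuM_univ hβ0 hβ1 hr, one_mul]
    have h2 : w x = mixP (vM β r) γ x + mixF (nuM β r) w x := congrFun (mixP_kM_eq hβ0 hβ1 hr γ) x
    have h3 : mixP (vM β r) γ x ≤ ENNReal.ofReal δ * l := by
      calc _ ≤ ∫⁻ y, ENNReal.ofReal δ * l * mixK (kM β) (x - y) ∂γ := by
            refine lintegral_mono_ae ?_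
            have : ∀ᵐ y ∂γ, y ∈ F := hγF
            exact this.mono fun y hy => hV _ (hx.1 y hy)
        _ = ENNReal.ofReal δ * l * w x := lintegral_const_mul _ (by fun_prop)
        _ ≤ _ := mul_le_of_le_one_right' hx1
    have hNt : mixF (nuM β r) w x ≠ ⊤ :=
      ne_top_of_le_ne_top one_ne_top ((le_add_self).trans h1.le)
    have h4 : mixF (nuM β r) (fun z => 1 - w z) x = (1 - w x) + mixP (vM β r) γ x := by
      refine (ENNReal.add_left_inj hNt).1 ?_
      rw [h1, add_assoc, ← h2, tsub_add_cancel_of_le hx1]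
    calc _ = ∫⁻ z in B, l * (1 - w z) := (lintegral_const_mul _ hum).symm
      _ ≤ ∫⁻ z in B, mixK (nuM β r) (x - z) * (1 - w z) :=
          setLIntegral_mono' hB fun z hz => mul_le_mul_left (hl _ (hx.2 z hz)) _
      _ ≤ ∫⁻ z, mixK (nuM β r) (x - z) * (1 - w z) := setLIntegral_le_lintegral _ _
      _ = mixF (nuM β r) (fun z => 1 - w z) x := (mixF_apply _ hum x).symm
      _ ≤ _ := by rw [h4]; gcongr
  have h := lintegral_mono_ae hpt
  rw [lintegral_const, lintegral_add_left hum, lintegral_const] at h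
  have h' : (l * θ univ) * ∫⁻ z in B, (1 - w z) ≤
      ∫⁻ x, (1 - w x) ∂θ + ENNReal.ofReal δ * (l * θ univ) := by
    calc _ = l * (∫⁻ z in B, (1 - w z)) * θ univ := by ring
      _ ≤ _ := h
      _ = _ := by ring
  calc _ = (l * θ univ)⁻¹ * ((l * θ univ) * ∫⁻ z in B, (1 - w z)) := by
        rw [← mul_assoc, ENNReal.inv_mul_cancel hlθ hlθt, one_mul]
    _ ≤ (l * θ univ)⁻¹ * (∫⁻ x, (1 - w x) ∂θ + ENNReal.ofReal δ * (l * θ univ)) := by gcongr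
    _ = _ := by
        rw [mul_add, mul_comm (ENNReal.ofReal δ), ← mul_assoc _ (l * θ univ),
          ENNReal.inv_mul_cancel hlθ hlθt, one_mul]

lemma tendsto_setLIntegral_defect {β a d : ℝ} (hβ0 : 0 < β) (hβ1 : β ≤ 1) (hn : β < n / 2)
    (hd : 0 < d) (ha : 0 ≤ a) (had : β = 1 → a < d) {F B : Set (Rn n)}
    (hB : MeasurableSet B) {θ : Measure (Rn n)} [IsFiniteMeasure θ] (hθ0 : θ ≠ 0)
    (hθ : ∀ᵐ x ∂θ, (∀ y ∈ F, d ≤ ‖x - y‖) ∧ ∀ z ∈ B, ‖x - z‖ ≤ a)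
    {γ : ℕ → Measure (Rn n)} (hγfin : ∀ k, IsFiniteMeasure (γ k)) (hγF : ∀ k, γ k Fᶜ = 0)
    (hvol : ∀ k, ∀ᵐ x, mixP (kM β) (γ k) x ≤ 1)
    (hγθ : ∀ k, ∀ᵐ x ∂θ, mixP (kM β) (γ k) x ≤ 1)
    (hlim : Tendsto (fun k => ∫⁻ x, (1 - mixP (kM β) (γ k) x) ∂θ) atTop (𝓝 0)) :
    Tendsto (fun k => ∫⁻ z in B, (1 - mixP (kM β) (γ k) z)) atTop (𝓝 0) := by
  rw [ENNReal.tendsto_nhds_zero]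
  intro ε hε
  obtain ⟨δ, hδ0, hδ⟩ : ∃ δ : ℝ, 0 < δ ∧ ENNReal.ofReal δ ≤ ε / 2 := by
    refine ⟨(min (ε / 2) 1).toReal, ENNReal.toReal_pos ?_ ?_, ?_⟩
    · exact (lt_min (ENNReal.half_pos hε.ne') one_pos).ne'
    · exact ne_top_of_le_ne_top one_ne_top (min_le_right _ _)
    · exact ENNReal.ofReal_toReal_le.trans (min_le_left _ _)
  obtain ⟨C, hC, hCγ⟩ := exists_setLIntegral_defect_le hβ0 hβ1 hn hd ha had hδ0 hB hθ0 hθ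
  have h := ENNReal.Tendsto.const_mul hlim (Or.inr hC)
  rw [mul_zero, ENNReal.tendsto_nhds_zero] at h
  filter_upwards [h _ (ENNReal.half_pos hε.ne')] with k hk
  have := hγfin k
  calc _ ≤ _ := hCγ (γ k) (hγF k) (hvol k) (hγθ k)
    _ ≤ ε / 2 + ε / 2 := add_le_add hk hδ
    _ = ε := ENNReal.add_halves ε

lemma pE_volume_restrict_ne_top {β : ℝ} (hβ0 : 0 < β) (hn : β < n / 2) {s : Set (Rn n)}
    (hs : MeasurableSet s) (hsf : volume s ≠ ⊤) :
    pE β (volume.restrict s) (volume.restrict s) ≠ ⊤ := by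
  rw [← withDensity_indicator_one hs]
  refine pE_withDensity_ne_top hβ0 hn one_ne_top
    (fun x => indicator_le_self' (f := fun _ => (1 : ℝ≥0∞)) (fun _ _ => zero_le) x) ?_
  rwa [lintegral_indicator_one hs]

/-- A property valid almost everywhere for all measures of finite energy is valid almost
everywhere for Lebesgue measure. -/
lemma ae_volume_of_forall_ae {β : ℝ} (hβ0 : 0 < β) (hn : β < n / 2) {P : Rn n → Prop}
    (h : ∀ (ψ : Measure (Rn n)) [IsFiniteMeasure ψ], pE β ψ ψ ≠ ⊤ → ∀ᵐ x ∂ψ, P x) :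
    ∀ᵐ x, P x := by
  refine ae_of_forall_measure_lt_top_ae_restrict _ fun s hs hsf => ?_
  have : IsFiniteMeasure (volume.restrict s) := isFiniteMeasure_restrict.2 hsf.ne
  exact h _ (pE_volume_restrict_ne_top hβ0 hn hs hsf.ne)

/-- Convergence of the defects to zero spreads from a measure living near a point of the
complement of `F` to every compact subset of that complement. -/
lemma tendsto_setLIntegral_defect_of_isCompact {β : ℝ} (hβ0 : 0 < β) (hβ1 : β ≤ 1)
    (hn : β < n / 2) {F : Set (Rn n)} (hF : IsClosed F) (hconn : β = 1 → IsPreconnected Fᶜ)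
    {γ : ℕ → Measure (Rn n)} (hγfin : ∀ k, IsFiniteMeasure (γ k)) (hγF : ∀ k, γ k Fᶜ = 0)
    (hγ1 : ∀ k, ∀ (ψ : Measure (Rn n)) [IsFiniteMeasure ψ], pE β ψ ψ ≠ ⊤ →
      ∀ᵐ x ∂ψ, mixP (kM β) (γ k) x ≤ 1)
    {ζ : Measure (Rn n)} [IsFiniteMeasure ζ] (hζ : pE β ζ ζ ≠ ⊤) (hζF : ζ Fᶜ ≠ 0)
    (hlim : Tendsto (fun k => ∫⁻ x, (1 - mixP (kM β) (γ k) x) ∂ζ) atTop (𝓝 0))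
    {K : Set (Rn n)} (hK : IsCompact K) (hKF : K ⊆ Fᶜ) :
    Tendsto (fun k => ∫⁻ z in K, (1 - mixP (kM β) (γ k) z)) atTop (𝓝 0) := by
  have hvol : ∀ k, ∀ᵐ x, mixP (kM β) (γ k) x ≤ 1 := fun k =>
    ae_volume_of_forall_ae hβ0 hn (hγ1 k)
  have mono : ∀ {μ ν : Measure (Rn n)}, μ ≤ ν →
      Tendsto (fun k => ∫⁻ z, (1 - mixP (kM β) (γ k) z) ∂ν) atTop (𝓝 0) →
      Tendsto (fun k => ∫⁻ z, (1 - mixP (kM β) (γ k) z) ∂μ) atTop (𝓝 0) := fun hμν h =>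
    tendsto_of_tendsto_of_tendsto_of_le_of_le tendsto_const_nhds h (fun _ => zero_le)
      fun _ => lintegral_mono' hμν le_rfl
  have spread : ∀ {θ : Measure (Rn n)} [IsFiniteMeasure θ] {x x₀ : Rn n} {R s t : ℝ},
      pE β θ θ ≠ ⊤ → Tendsto (fun k => ∫⁻ z, (1 - mixP (kM β) (γ k) z) ∂θ) atTop (𝓝 0) →
      θ ≠ 0 → (∀ᵐ p ∂θ, p ∈ Metric.ball x₀ s) → Metric.ball x₀ R ⊆ Fᶜ → 0 < s → s < R → 0 < t →
      (β = 1 → s + dist x₀ x + t < R - s) →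
      Tendsto (fun k => ∫⁻ z in Metric.ball x t, (1 - mixP (kM β) (γ k) z)) atTop (𝓝 0) := by
    intro θ _ x x₀ R s t hθ hθl hθ0 hθs hR hs hsR ht hβR
    refine tendsto_setLIntegral_defect (a := s + dist x₀ x + t) (d := R - s) hβ0 hβ1 hn
      (by linarith) (by positivity) hβR measurableSet_ball hθ0 ?_ hγfin hγF hvol
      (fun k => hγ1 k θ hθ) hθl
    filter_upwards [hθs] with p hp
    rw [Metric.mem_ball] at hp
    refine ⟨fun y hy => ?_, fun z hz => ?_⟩
    · by_contra hc
      refine hR (?_ : y ∈ Metric.ball x₀ R) hy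
      rw [Metric.mem_ball]
      rw [← dist_eq_norm] at hc
      linarith [dist_triangle y p x₀, dist_comm p y]
    · rw [Metric.mem_ball] at hz
      rw [← dist_eq_norm]
      linarith [dist_triangle p x₀ z, dist_triangle x₀ x z, dist_comm z x]
  have nhd : ∀ x ∈ Fᶜ, ∃ R > 0, Metric.ball x R ⊆ Fᶜ := Metric.isOpen_iff.1 hF.isOpen_compl
  obtain ⟨x₁, hx₁, hpos⟩ := exists_mem_forall_mem_nhdsWithin_pos_measure hζF
  obtain ⟨R₁, hR₁, hball₁⟩ := nhd x₁ hx₁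
  have start : ∀ {x : Rn n} {t : ℝ}, 0 < t → (β = 1 → R₁ / 4 + dist x₁ x + t < R₁ - R₁ / 4) →
      Tendsto (fun k => ∫⁻ z in Metric.ball x t, (1 - mixP (kM β) (γ k) z)) atTop (𝓝 0) := by
    intro x t ht hβR
    refine spread (θ := ζ.restrict (Metric.ball x₁ (R₁ / 4))) (pE_restrict_ne_top hζ _)
      (mono Measure.restrict_le_self hlim) ?_ (ae_restrict_mem measurableSet_ball) hball₁
      (by linarith) (by linarith) ht hβR
    rw [Ne, Measure.restrict_eq_zero]
    exact (hpos _ (mem_nhdsWithin_of_mem_nhds (Metric.ball_mem_nhds _ (by linarith)))).ne'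
  have all : ∀ x ∈ Fᶜ, ∃ t > 0,
      Tendsto (fun k => ∫⁻ z in Metric.ball x t, (1 - mixP (kM β) (γ k) z)) atTop (𝓝 0) := by
    rcases hβ1.eq_or_lt with h1 | h1
    · refine (hconn h1).subset_of_closure_inter_subset (u := {x | ∃ t > 0,
        Tendsto (fun k => ∫⁻ z in Metric.ball x t, (1 - mixP (kM β) (γ k) z)) atTop (𝓝 0)})
        ?_ ⟨x₁, hx₁, R₁ / 4, by linarith, start (by linarith) fun _ => ?_⟩ ?_
      · refine Metric.isOpen_iff.2 fun x ⟨t, ht, hx⟩ => ⟨t, ht, fun y hy => ?_⟩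
        refine ⟨t - dist y x, by linarith [Metric.mem_ball.1 hy],
          mono (Measure.restrict_mono_set _ (Metric.ball_subset_ball' (by linarith))) hx⟩
      · rw [dist_self]
        linarith
      · rintro x ⟨hxc, hxF⟩
        obtain ⟨R, hR, hball⟩ := nhd x hxF
        obtain ⟨z, ⟨t, ht, hz⟩, hxz⟩ := Metric.mem_closure_iff.1 hxc (R / 8) (by linarith)
        have hm : 0 < min t (R / 8) := lt_min ht (by linarith)
        have hm' : min t (R / 8) ≤ R / 8 := min_le_right _ _
        have : IsFiniteMeasure (volume.restrict (Metric.ball z (min t (R / 8)))) :=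
          isFiniteMeasure_restrict.2 measure_ball_lt_top.ne
        refine ⟨R / 8, by linarith, spread (θ := volume.restrict (Metric.ball z (min t (R / 8))))
          (x₀ := z) (s := min t (R / 8)) (R := R - R / 8)
          (pE_volume_restrict_ne_top hβ0 hn measurableSet_ball measure_ball_lt_top.ne)
          (mono (Measure.restrict_mono_set _ (Metric.ball_subset_ball (min_le_left _ _))) hz) ?_
          (ae_restrict_mem measurableSet_ball)
          ((Metric.ball_subset_ball' (by linarith [dist_comm z x])).trans hball) hm
          (by linarith) (by linarith) fun _ => by linarith [dist_comm z x]⟩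
        rw [Ne, Measure.restrict_eq_zero]
        exact (Metric.measure_ball_pos _ _ hm).ne'
    · exact fun x _ => ⟨1, one_pos, start one_pos fun h => absurd h h1.ne⟩
  refine hK.induction_on (p := fun s =>
    Tendsto (fun k => ∫⁻ z in s, (1 - mixP (kM β) (γ k) z)) atTop (𝓝 0)) (by simp)
    (fun s t hst h => mono (Measure.restrict_mono_set _ hst) h) (fun s t hs ht => ?_)
    fun x hx => ?_
  · have h := hs.add ht
    rw [add_zero] at h
    exact tendsto_of_tendsto_of_tendsto_of_le_of_le tendsto_const_nhds h (fun _ => zero_le)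
      fun _ => lintegral_union_le _ _ _
  · obtain ⟨t, ht, h⟩ := all x (hKF hx)
    exact ⟨_, mem_nhdsWithin_of_mem_nhds (Metric.ball_mem_nhds _ ht), h⟩

lemma mixK_nuM_le {β r : ℝ} (hβ0 : 0 < β) (hβ1 : β ≤ 1) (hr : 0 < r) (x : Rn n) :
    mixK (nuM β r) x ≤ heatK n r 0 := by
  calc mixK (nuM β r) x ≤ ∫⁻ _, heatK n r 0 ∂nuM β r := by
        refine lintegral_mono_ae ((nuM_ae_ge β r).mono fun s hs => ?_)
        refine (heatK_le_heatK_zero (hr.le.trans hs) x).trans (ENNReal.ofReal_le_ofReal ?_)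
        have h : (4 * Real.pi * s) ^ (-((n : ℝ) / 2)) ≤ (4 * Real.pi * r) ^ (-((n : ℝ) / 2)) :=
          Real.rpow_le_rpow_of_nonpos (by positivity) (by gcongr) (neg_nonpos.2 (by positivity))
        simpa using h
    _ = _ := by rw [lintegral_const, nuM_univ hβ0 hβ1 hr, mul_one]

/-- A probability measure with bounded density which tests the part of the kernel beyond
scale `T`. -/
lemma exists_probe {β T : ℝ} (hβ0 : 0 < β) (hβ1 : β ≤ 1) (hn : β < n / 2) (hT : 0 < T) :
    ∃ ψ : Measure (Rn n), IsProbabilityMeasure ψ ∧ pE β ψ ψ ≠ ⊤ ∧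
      (∃ M : ℝ≥0∞, M ≠ ⊤ ∧ ψ ≤ M • volume) ∧
      ∀ (γ : Measure (Rn n)) [SFinite γ],
        ∫⁻ x, mixP (kM β) γ x ∂ψ = mixP ((kM β).restrict (Ioi T)) γ 0 := by
  have hm : Measurable fun y : Rn n => mixK (nuM β T) (0 - y) := by fun_prop
  have h1 : ∫⁻ y : Rn n, mixK (nuM β T) (0 - y) = 1 := by
    have h := mixF_const (n := n) (nuM_ae_pos β hT) 1 0
    rw [mixF_apply _ measurable_const, nuM_univ hβ0 hβ1 hT] at h
    simpa using h
  have hb := mixK_nuM_le (n := n) hβ0 hβ1 hT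
  refine ⟨volume.withDensity fun y => mixK (nuM β T) (0 - y), ⟨?_⟩, ?_,
    ⟨heatK n T 0, heatK_ne_top _ _, ?_⟩, fun γ _ => ?_⟩
  · rw [withDensity_apply _ MeasurableSet.univ, setLIntegral_univ, h1]
  · exact pE_withDensity_ne_top hβ0 hn (heatK_ne_top _ _) (fun x => hb _) (by rw [h1]; exact one_ne_top)
  · rw [← withDensity_const]
    exact withDensity_mono (ae_of_all _ fun x => hb _)
  · rw [lintegral_withDensity_eq_lintegral_mul _ hm (by fun_prop)]
    simp only [Pi.mul_apply]
    rw [← mixF_apply _ (by fun_prop), mixF_mixP (nuM_ae_pos β hT) (kM_ae_pos β),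
      nuM_conv_kM hβ0 hβ1 hT]

lemma tendsto_measure_inter_closedBall (μ : Measure (Rn n)) (F : Set (Rn n)) (N : ℕ) :
    Tendsto (fun k : ℕ => μ (F ∩ Metric.closedBall 0 ((N + k : ℕ) : ℝ))) atTop (𝓝 (μ F)) := by
  have hm : Monotone fun k : ℕ => F ∩ Metric.closedBall (0 : Rn n) ((N + k : ℕ) : ℝ) :=
    fun i j hij => inter_subset_inter_right _ (Metric.closedBall_subset_closedBall (by
      exact_mod_cast Nat.add_le_add_left hij N))
  have h := tendsto_measure_iUnion_atTop (μ := μ) hm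
  have hu : ⋃ k : ℕ, F ∩ Metric.closedBall (0 : Rn n) ((N + k : ℕ) : ℝ) = F := by
    refine Subset.antisymm (iUnion_subset fun k => inter_subset_left) fun x hx => ?_
    obtain ⟨k, hk⟩ := exists_nat_ge ‖x‖
    refine mem_iUnion.2 ⟨k, hx, mem_closedBall_zero_iff.2 (hk.trans ?_)⟩
    exact_mod_cast Nat.le_add_left k N
  rwa [hu] at h

/-- If the potential of a measure on a thin closed set `F` is dominated on `F` by the potential
of a measure `ζ` of mass at most one charging the complement of `F`, its mass is not one. -/
theorem measure_univ_ne_one {β : ℝ} (hβ0 : 0 < β) (hβ1 : β ≤ 1) (hn : β < n / 2)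
    {F : Set (Rn n)} (hF : IsClosed F) (hconn : β = 1 → IsPreconnected Fᶜ)
    (hthin : InnerThinAtInfinity n (2 * β) F) {μ ζ : Measure (Rn n)} [IsFiniteMeasure μ]
    [IsFiniteMeasure ζ] (hμ : pE β μ μ ≠ ⊤) (hζ : pE β ζ ζ ≠ ⊤) (hμF : μ Fᶜ = 0)
    (hζ1 : ζ univ ≤ 1) (hζF : ζ Fᶜ ≠ 0)
    (hle : ∀ᵐ x ∂μ, mixP (kM β) μ x ≤ mixP (kM β) ζ x) : μ univ ≠ 1 := by
  intro hμ1
  have hμF1 : μ F = 1 := by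
    rw [← hμ1, ← measure_add_measure_compl hF.measurableSet, hμF, add_zero]
  obtain ⟨N, hN⟩ : ∃ N : ℕ, 0 < μ (F ∩ Metric.closedBall 0 ((0 + N : ℕ) : ℝ)) :=
    ((tendsto_measure_inter_closedBall μ F 0).eventually_const_lt (by
      rw [hμF1]; exact one_pos)).exists
  rw [zero_add] at hN
  set S : ℕ → Set (Rn n) := fun k => F ∩ Metric.closedBall 0 ((N + k : ℕ) : ℝ) with hS
  have hSc : ∀ k, IsCompact (S k) := fun k => (isCompact_closedBall _ _).inter_left hF
  have hSF : ∀ k, S k ⊆ F := fun k => inter_subset_left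
  have hex := fun k => exists_equilibrium (β := β) (hSc k) (θ := μ.restrict (S k))
    (by rw [Measure.restrict_apply (hSc k).measurableSet.compl, compl_inter_self, measure_empty])
    (by
      rw [Ne, Measure.restrict_eq_zero]
      refine (hN.trans_le (measure_mono (inter_subset_inter_right _
        (Metric.closedBall_subset_closedBall ?_)))).ne'
      exact_mod_cast Nat.le_add_right N k)
    (pE_restrict_ne_top hμ _)
  choose γ hγfin hγS hγE hγle hγge using hex
  have hγF : ∀ k, γ k Fᶜ = 0 := fun k =>
    measure_mono_null (compl_subset_compl.2 (hSF k)) (hγS k)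
  have hγ1 : ∀ k, ∀ (ψ : Measure (Rn n)) [IsFiniteMeasure ψ], pE β ψ ψ ≠ ⊤ →
      ∀ᵐ x ∂ψ, mixP (kM β) (γ k) x ≤ 1 := fun k ψ _ hψ =>
    ae_mixP_le_const hβ0 hβ1 (hγE k) hψ (hγle k)
  have hsplit : ∀ k, ∀ (ψ : Measure (Rn n)) [IsFiniteMeasure ψ], pE β ψ ψ ≠ ⊤ →
      ∫⁻ x, (1 - mixP (kM β) (γ k) x) ∂ψ + ∫⁻ x, mixP (kM β) (γ k) x ∂ψ = ψ univ := by
    intro k ψ _ hψ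
    rw [← lintegral_add_right _ (by fun_prop), ← lintegral_one]
    exact lintegral_congr_ae ((hγ1 k ψ hψ).mono fun x hx => tsub_add_cancel_of_le hx)
  have hlim : Tendsto (fun k => ∫⁻ x, (1 - mixP (kM β) (γ k) x) ∂ζ) atTop (𝓝 0) := by
    have h1 : ∀ k, ∫⁻ x, (1 - mixP (kM β) (γ k) x) ∂ζ ≤ 1 - μ (S k) := fun k => by
      refine ENNReal.le_sub_of_add_le_right (measure_ne_top _ _) ?_
      refine le_trans (add_le_add_right ?_ _) ((hsplit k ζ hζ).trans_le hζ1)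
      calc μ (S k) ≤ pE β (γ k) μ := hγge k μ hμ
        _ = pE β μ (γ k) := pE_comm _ _ _
        _ ≤ pE β ζ (γ k) := lintegral_mono_ae (ae_mixP_le_mixP hβ0 hβ1 hμ (hγE k) hle)
        _ = pE β (γ k) ζ := pE_comm _ _ _
    have h2 := ENNReal.Tendsto.sub (tendsto_const_nhds (x := (1 : ℝ≥0∞)))
      (tendsto_measure_inter_closedBall μ F N) (Or.inl one_ne_top)
    rw [hμF1, tsub_self] at h2
    exact tendsto_of_tendsto_of_tendsto_of_le_of_le tendsto_const_nhds h2 (fun _ => zero_le) h1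
  obtain ⟨T, hT, hTγ⟩ := exists_mixP_restrict_le hn hthin 0 (ε := 1 / 2) (by simp)
  obtain ⟨ψ, hψP, hψE, ⟨M, hM, hψM⟩, hψ⟩ := exists_probe (n := n) hβ0 hβ1 hn hT
  obtain ⟨K, hKF, hK, hKψ⟩ := hF.isOpen_compl.measurableSet.exists_isCompact_lt_add
    (measure_ne_top ψ _) (ε := 1 / 4) (by simp)
  have hKlim : Tendsto (fun k => ∫⁻ x in K, (1 - mixP (kM β) (γ k) x) ∂ψ) atTop (𝓝 0) := by
    have h := ENNReal.Tendsto.const_mul (tendsto_setLIntegral_defect_of_isCompact hβ0 hβ1 hn hF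
      hconn hγfin hγF hγ1 hζ hζF hlim hK hKF) (Or.inr hM)
    rw [mul_zero] at h
    refine tendsto_of_tendsto_of_tendsto_of_le_of_le tendsto_const_nhds h (fun _ => zero_le)
      fun k => ?_
    calc _ ≤ ∫⁻ x in K, (1 - mixP (kM β) (γ k) x) ∂(M • volume) :=
          lintegral_mono' (Measure.restrict_mono_measure hψM _) le_rfl
      _ = _ := by rw [Measure.restrict_smul, lintegral_smul_measure, smul_eq_mul]
  have hk : ∀ k, ψ (S k) + ψ K ≤ 1 / 2 + ∫⁻ x in K, (1 - mixP (kM β) (γ k) x) ∂ψ := by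
    intro k
    have h1 : ψ (S k) ≤ ∫⁻ x in F, mixP (kM β) (γ k) x ∂ψ := by
      have h := hγge k (ψ.restrict F) (pE_restrict_ne_top hψE _)
      rwa [Measure.restrict_eq_self _ (hSF k)] at h
    have h2 := hsplit k (ψ.restrict K) (pE_restrict_ne_top hψE _)
    rw [Measure.restrict_apply_univ] at h2
    have h3 : ∫⁻ x in F, mixP (kM β) (γ k) x ∂ψ + ∫⁻ x in K, mixP (kM β) (γ k) x ∂ψ ≤ 1 / 2 := by
      rw [← lintegral_union hK.measurableSet (disjoint_compl_right.mono_right hKF)]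
      exact (setLIntegral_le_lintegral _ _).trans ((hψ _).trans_le (hTγ (γ k) (hγF k) (hγle k)))
    calc _ ≤ ∫⁻ x in F, mixP (kM β) (γ k) x ∂ψ + ψ K := by gcongr
      _ = (∫⁻ x in F, mixP (kM β) (γ k) x ∂ψ + ∫⁻ x in K, mixP (kM β) (γ k) x ∂ψ) +
          ∫⁻ x in K, (1 - mixP (kM β) (γ k) x) ∂ψ := by rw [← h2]; ring
      _ ≤ _ := by gcongr
  have hfin : ψ F + ψ K ≤ 1 / 2 + 0 :=
    le_of_tendsto_of_tendsto' ((tendsto_measure_inter_closedBall ψ F N).add tendsto_const_nhds)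
      (tendsto_const_nhds.add hKlim) hk
  have hone : ψ F + ψ Fᶜ = 1 := by
    rw [measure_add_measure_compl hF.measurableSet, measure_univ]
  have : (1 : ℝ≥0∞) ≤ 1 / 2 + 1 / 4 := by
    calc (1 : ℝ≥0∞) = ψ F + ψ Fᶜ := hone.symm
      _ ≤ ψ F + (ψ K + 1 / 4) := by gcongr
      _ = (ψ F + ψ K) + 1 / 4 := by ring
      _ ≤ _ := by rw [add_zero] at hfin; gcongr
  rw [← ENNReal.toReal_le_toReal one_ne_top (by simp), ENNReal.toReal_add (by simp) (by simp)] at this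
  norm_num at this

lemma Concentrated.measure_compl_eq_zero {n : ℕ} {μ : Measure (Rn n)} {A : Set (Rn n)}
    (h : Concentrated μ A) : μ Aᶜ = 0 := by
  have hu : Aᶜ = ⋃ k : ℕ, Aᶜ ∩ Metric.closedBall (0 : Rn n) k := by
    rw [← inter_iUnion, Metric.iUnion_closedBall_nat, inter_univ]
  rw [hu]
  exact measure_iUnion_null fun k => h _ (isCompact_closedBall _ _)

theorem stmt15 (n : ℕ) (hn : 2 ≤ n) (α : ℝ) (hα0 : 0 < α) (hαn : α < n) (hα2 : α ≤ 2)
    (A : Set (Rn n)) (ζ : Measure (Rn n)) (f : Rn n → EReal)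
    (hclosed : StrongClosedEplusOn (rieszKernel n α) A)
    (hcapinf : innerCap (rieszKernel n α) A = ⊤)
    (hcap0 : innerCap (rieszKernel n α) A ≠ 0)
    (hζ : memEplus (rieszKernel n α) ζ) (hζ1 : ζ Set.univ ≤ 1)
    (hf : ∀ x, f x = -((potential (rieszKernel n α) ζ x : ℝ≥0∞) : EReal))
    (hthin : InnerThinAtInfinity n α (closure A))
    (hconn : α = 2 → IsConnected (closure A)ᶜ)
    (hζD : 0 < ζ ((closure A)ᶜ)) :
    ¬ ∃ l : Measure (Rn n), IsSolution (rieszKernel n α) A f l := by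
  rintro ⟨l, hl⟩
  obtain ⟨β, rfl⟩ : ∃ β, α = 2 * β := ⟨α / 2, by ring⟩
  have hβ0 : 0 < β := by linarith
  have hβ1 : β ≤ 1 := by linarith
  have hβn : β < n / 2 := by linarith
  have : IsFiniteMeasure ζ := ⟨hζ1.trans_lt one_lt_top⟩
  have : IsProbabilityMeasure l := ⟨hl.1.1.2.2⟩
  have hζE : pE β ζ ζ ≠ ⊤ := (energy_ne_top_iff hβn ζ).1 hζ.2.ne
  have hlE : pE β l l ≠ ⊤ := (energy_ne_top_iff hβn l).1 hl.1.1.1.2.ne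
  exact measure_univ_ne_one hβ0 hβ1 hβn isClosed_closure
    (fun h => (hconn (by rw [h, mul_one])).isPreconnected) hthin hlE hζE
    (measure_mono_null (compl_subset_compl.2 subset_closure) hl.1.1.2.1.measure_compl_eq_zero)
    hζ1 hζD.ne' (ae_mixP_le_of_isSolution hβn hf hζE hcapinf hl) measure_univ

end GaussVar
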